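/- arXiv:1706.03302 — 2 statements merged into one kernel-verified Lean document; each statement's English description precedes it below -/
import Mathlib

section
/- Let k be a field that is algebraic over ℚ, admits a ring embedding into ℝ, and contains a square root of 2. Let T be transcendental over k, let K be a finite extension of k(T) in which k is relatively algebraically closed, and let 𝔮 be a prime of K of degree 1 (its residue field equals k) with ord_𝔮(T) = −1. Then: (1) if f ∈ K has ord_𝔮(f) odd, then for all ξ₁, ξ₂ ∈ k^× and ξ₃ ∈ k the equation X² + Y² + Z² + W² = ξ₁f³ + ξ₂T + ξ₃ has no solution X, Y, Z, W ∈ K; (2) if f ∈ k[T] is non-constant of even degree, then there exist ξ₁, ξ₂ ∈ k^×, ξ₃ ∈ k and X, Y, Z, W ∈ K with X² + Y² + Z² + W² = ξ₁f³ + ξ₂T + ξ₃. -/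
/-- A Diophantine definition data. -/
def IsDiophantine {R : Type*} [CommRing R] {n : ℕ} (A : Set (Fin n → R)) : Prop :=
  ∃ (m : ℕ) (f : MvPolynomial (Fin n ⊕ Fin m) R),
    ∀ t : Fin n → R, t ∈ A ↔ ∃ x : Fin m → R, MvPolynomial.eval (Sum.elim t x) f = 0

def HasSingleFoldDiophantineDefinition {R : Type*} [CommRing R] {n : ℕ}
    (A : Set (Fin n → R)) : Prop :=
  ∃ (m : ℕ) (f : MvPolynomial (Fin n ⊕ Fin m) R),
    ∀ t : Fin n → R, t ∈ A ↔ ∃! x : Fin m → R, MvPolynomial.eval (Sum.elim t x) f = 0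

def HasFiniteFoldDiophantineDefinition {R : Type*} [CommRing R] {n : ℕ}
    (A : Set (Fin n → R)) : Prop :=
  ∃ (m : ℕ) (f : MvPolynomial (Fin n ⊕ Fin m) R),
    (∀ t : Fin n → R, t ∈ A ↔ ∃ x : Fin m → R, MvPolynomial.eval (Sum.elim t x) f = 0) ∧
    ∀ t : Fin n → R, {x : Fin m → R | MvPolynomial.eval (Sum.elim t x) f = 0}.Finite

/-- A prime of the function field `K` over the constant field `k`, given by its
normalized `ℤ`-valued valuation (with the junk convention `ord 0 = 0`). -/
structure FFPrime (k K : Type*) [Field k] [Field K] [Algebra k K] where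
  ord : K → ℤ
  ord_zero' : ord 0 = 0
  ord_mul : ∀ {x y : K}, x ≠ 0 → y ≠ 0 → ord (x * y) = ord x + ord y
  min_le_ord_add : ∀ {x y : K}, x ≠ 0 → y ≠ 0 → x + y ≠ 0 → min (ord x) (ord y) ≤ ord (x + y)
  ord_algebraMap : ∀ {c : k}, c ≠ 0 → ord (algebraMap k K c) = 0
  exists_uniformizer : ∃ u : K, u ≠ 0 ∧ ord u = 1

namespace FFPrime

variable {k K : Type*} [Field k] [Field K] [Algebra k K]

/-- The image of `a` in the residue field of the prime `v` is a square. -/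
def ResidueIsSquare (v : FFPrime k K) (a : K) : Prop :=
  ∃ b : K, 0 ≤ v.ord b ∧ (a = b ^ 2 ∨ 1 ≤ v.ord (a - b ^ 2))

/-- The prime `v` has degree one: its residue field is (identified with) `k`. -/
def DegreeOne (v : FFPrime k K) : Prop :=
  ∀ x : K, 0 ≤ v.ord x →
    ∃ c : k, x = algebraMap k K c ∨ 1 ≤ v.ord (x - algebraMap k K c)

theorem ord_one (v : FFPrime k K) : v.ord 1 = 0 := by
  have := v.ord_algebraMap (one_ne_zero (α := k))
  simpa using this

theorem ord_neg (v : FFPrime k K) {x : K} (hx : x ≠ 0) : v.ord (-x) = v.ord x := by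
  have h : (-1 : K) ≠ 0 := by norm_num
  have hm : (-x) = (-1) * x := by ring
  have h1 : v.ord (-1 : K) = 0 := by
    have heq : ((algebraMap k K) (-1 : k)) = (-1 : K) := by simp
    have h2 := v.ord_algebraMap (c := (-1 : k)) (by norm_num)
    rwa [heq] at h2
  rw [hm, v.ord_mul h hx, h1, zero_add]

end FFPrime

/-- The ring of `S`-integers of `K`. -/
def SIntegers {k K : Type*} [Field k] [Field K] [Algebra k K]
    (S : Set (FFPrime k K)) : Subring K where
  carrier := {x | ∀ v : FFPrime k K, v ∉ S → 0 ≤ v.ord x}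
  zero_mem' := by intro v hv; rw [v.ord_zero']
  one_mem' := by intro v hv; rw [v.ord_one]
  add_mem' := by
    intro x y hx hy v hv
    by_cases hx0 : x = 0
    · simpa [hx0] using hy v hv
    by_cases hy0 : y = 0
    · simpa [hy0] using hx v hv
    by_cases hxy : x + y = 0
    · rw [hxy, v.ord_zero']
    · exact le_trans (le_min (hx v hv) (hy v hv)) (v.min_le_ord_add hx0 hy0 hxy)
  mul_mem' := by
    intro x y hx hy v hv
    by_cases hx0 : x = 0
    · simp [hx0, v.ord_zero']
    by_cases hy0 : y = 0
    · simp [hy0, v.ord_zero']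
    rw [v.ord_mul hx0 hy0]
    exact add_nonneg (hx v hv) (hy v hv)
  neg_mem' := by
    intro x hx v hv
    by_cases hx0 : x = 0
    · simp [hx0, v.ord_zero']
    rw [v.ord_neg hx0]
    exact hx v hv

namespace FFPrime

variable {k K : Type*} [Field k] [Field K] [Algebra k K]

theorem ord_pow (v : FFPrime k K) {x : K} (hx : x ≠ 0) (n : ℕ) : v.ord (x ^ n) = n * v.ord x := by
  induction n with
  | zero => simp [v.ord_one]
  | succ n ih =>
    rw [pow_succ, v.ord_mul (pow_ne_zero n hx) hx, ih]
    push_cast; ring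

theorem ord_inv (v : FFPrime k K) {x : K} (hx : x ≠ 0) : v.ord x⁻¹ = - v.ord x := by
  have h := v.ord_mul hx (inv_ne_zero hx)
  rw [mul_inv_cancel₀ hx, v.ord_one] at h
  linarith

/-- If `x` has strictly smaller order than `y` then `x` dominates the sum. -/
theorem ord_add_of_lt (v : FFPrime k K) {x y : K} (hx : x ≠ 0) (h : y = 0 ∨ v.ord x < v.ord y) :
    x + y ≠ 0 ∧ v.ord (x + y) = v.ord x := by
  by_cases hy : y = 0
  · simp [hy, hx]
  have h := h.resolve_left hy
  have hxy : x + y ≠ 0 := by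
    intro h0
    rw [eq_neg_of_add_eq_zero_left h0, v.ord_neg hy] at h
    exact lt_irrefl _ h
  refine ⟨hxy, le_antisymm ?_ ?_⟩
  · have h1 := v.min_le_ord_add (x := x + y) (y := -y) hxy (neg_ne_zero.2 hy) (by simpa using hx)
    rw [v.ord_neg hy, add_neg_cancel_right] at h1
    rcases min_le_iff.1 h1 with h2 | h2
    · exact h2
    · exact absurd h2 (not_le.2 h)
  · have h1 := v.min_le_ord_add hx hy hxy
    rwa [min_eq_left h.le] at h1

/-- A finite sum of squares has even order at a prime whose residue field is real. -/
theorem even_ord_sum_four_sq (v : FFPrime k K) (hdeg : v.DegreeOne) (φ : k →+* ℝ)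
    (X : Fin 4 → K) : Even (v.ord (∑ i, X i ^ 2)) := by
  classical
  by_cases hX : ∀ i, X i = 0
  · simp [hX, v.ord_zero']
  push Not at hX
  obtain ⟨i₀, hi₀⟩ := hX
  obtain ⟨m, hm, hmin⟩ := Finset.exists_min_image (Finset.univ.filter fun i => X i ≠ 0)
    (fun i => v.ord (X i)) ⟨i₀, by simp [hi₀]⟩
  have hm0 : X m ≠ 0 := by simpa using hm
  have hY : ∀ i, ∃ c : k, X i / X m = algebraMap k K c ∨
      1 ≤ v.ord (X i / X m - algebraMap k K c) := fun i => by
    apply hdeg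
    by_cases hi : X i = 0
    · simp [hi, v.ord_zero']
    · rw [div_eq_mul_inv, v.ord_mul hi (inv_ne_zero hm0), v.ord_inv hm0]
      have := hmin i (by simp [hi])
      linarith
  choose c hc using hY
  let R : Subring K :=
    { carrier := {x | 0 ≤ v.ord x}
      zero_mem' := by simp [v.ord_zero']
      one_mem' := by simp [v.ord_one]
      add_mem' := by
        intro x y hx hy
        by_cases hx0 : x = 0
        · simpa [hx0] using hy
        by_cases hy0 : y = 0
        · simpa [hy0] using hx
        by_cases hxy : x + y = 0
        · simp [hxy, v.ord_zero']
        · exact le_trans (le_min hx hy) (v.min_le_ord_add hx0 hy0 hxy)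
      mul_mem' := by
        intro x y hx hy
        by_cases hx0 : x = 0
        · simp [hx0, v.ord_zero']
        by_cases hy0 : y = 0
        · simp [hy0, v.ord_zero']
        exact (add_nonneg hx hy).trans_eq (v.ord_mul hx0 hy0).symm
      neg_mem' := by
        intro x hx
        by_cases hx0 : x = 0
        · simp [hx0, v.ord_zero']
        simpa [v.ord_neg hx0] using hx }
  have hadd : ∀ x y : K, (x = 0 ∨ 1 ≤ v.ord x) → (y = 0 ∨ 1 ≤ v.ord y) →
      (x + y = 0 ∨ 1 ≤ v.ord (x + y)) := by
    intro x y hx hy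
    by_cases hx0 : x = 0
    · simpa [hx0] using hy
    by_cases hy0 : y = 0
    · simpa [hy0] using hx
    by_cases hxy : x + y = 0
    · exact Or.inl hxy
    · exact Or.inr (le_trans (le_min (hx.resolve_left hx0) (hy.resolve_left hy0))
        (v.min_le_ord_add hx0 hy0 hxy))
  have halg : ∀ a : k, 0 ≤ v.ord (algebraMap k K a) := fun a => by
    by_cases ha : a = 0
    · simp [ha, v.ord_zero']
    · rw [v.ord_algebraMap ha]
  have hsq : ∀ i, ((X i / X m) ^ 2 - algebraMap k K (c i ^ 2) = 0 ∨
      1 ≤ v.ord ((X i / X m) ^ 2 - algebraMap k K (c i ^ 2))) := fun i => by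
    have hfac : (X i / X m) ^ 2 - algebraMap k K (c i ^ 2) =
      (X i / X m - algebraMap k K (c i)) * ((X i / X m - algebraMap k K (c i)) +
        algebraMap k K (2 * c i)) := by simp only [map_pow, map_mul, map_ofNat]; ring
    rw [hfac]
    rcases hc i with h | h
    · left; rw [h]; simp
    · set d := X i / X m - algebraMap k K (c i)
      by_cases hd : d = 0
      · simp [hd]
      by_cases he : d + algebraMap k K (2 * c i) = 0
      · rw [he]; simp
      right
      have he' : d + algebraMap k K (2 * c i) ∈ R :=
        R.add_mem (show 0 ≤ v.ord d by linarith) (halg _)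
      have : 0 ≤ v.ord (d + algebraMap k K (2 * c i)) := he'
      rw [v.ord_mul hd he]; linarith
  have hsum : (∑ i, (X i / X m) ^ 2) - algebraMap k K (∑ i, c i ^ 2) = 0 ∨
      1 ≤ v.ord ((∑ i, (X i / X m) ^ 2) - algebraMap k K (∑ i, c i ^ 2)) := by
    rw [map_sum, ← Finset.sum_sub_distrib]
    refine Finset.sum_induction _ (fun x => x = 0 ∨ 1 ≤ v.ord x) hadd (Or.inl rfl) fun i _ => hsq i
  have hcm : c m ≠ 0 := by
    intro h0
    have := hc m
    rw [div_self hm0, h0, map_zero, sub_zero, v.ord_one] at this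
    simp at this
  have hc0 : ∑ i, c i ^ 2 ≠ 0 := by
    intro h0
    have h1 : ∑ i, φ (c i) ^ 2 = 0 := by
      simpa using congrArg φ h0
    have h2 := (Finset.sum_eq_zero_iff_of_nonneg (fun i _ => sq_nonneg (φ (c i)))).1 h1 m
      (Finset.mem_univ _)
    exact hcm (by simpa using h2)
  have hA : algebraMap k K (∑ i, c i ^ 2) ≠ 0 :=
    (map_ne_zero (algebraMap k K)).2 hc0
  obtain ⟨hne, hord⟩ := v.ord_add_of_lt (x := algebraMap k K (∑ i, c i ^ 2))
    (y := (∑ i, (X i / X m) ^ 2) - algebraMap k K (∑ i, c i ^ 2)) hA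
    (by rw [v.ord_algebraMap hc0]; exact hsum.imp id fun h => by linarith)
  rw [add_sub_cancel] at hne hord
  have hX : ∑ i, X i ^ 2 = X m ^ 2 * ∑ i, (X i / X m) ^ 2 := by
    rw [Finset.mul_sum]
    refine Finset.sum_congr rfl fun i _ => ?_
    field_simp
  rw [hX, v.ord_mul (pow_ne_zero 2 hm0) hne, hord, v.ord_algebraMap hc0, v.ord_pow hm0]
  simp

/-- A cubic expression in a function of odd order, plus a function with a simple pole, has
odd order. -/
theorem odd_ord_cubic (v : FFPrime k K) {T f : K} (hordT : v.ord T = -1) (hf : Odd (v.ord f))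
    {ξ₁ ξ₂ ξ₃ : k} (h₁ : ξ₁ ≠ 0) (h₂ : ξ₂ ≠ 0) :
    Odd (v.ord (algebraMap k K ξ₁ * f ^ 3 + algebraMap k K ξ₂ * T + algebraMap k K ξ₃)) := by
  have hf0 : f ≠ 0 := by
    rintro rfl
    simp [v.ord_zero'] at hf
  have hT0 : T ≠ 0 := by
    rintro rfl
    simp [v.ord_zero'] at hordT
  have hA₁ : algebraMap k K ξ₁ ≠ 0 := by simpa using h₁
  have hA₂ : algebraMap k K ξ₂ ≠ 0 := by simpa using h₂
  have hx0 : algebraMap k K ξ₁ * f ^ 3 ≠ 0 := mul_ne_zero hA₁ (pow_ne_zero 3 hf0)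
  have hy0 : algebraMap k K ξ₂ * T ≠ 0 := mul_ne_zero hA₂ hT0
  have hx : v.ord (algebraMap k K ξ₁ * f ^ 3) = 3 * v.ord f := by
    rw [v.ord_mul hA₁ (pow_ne_zero 3 hf0), v.ord_algebraMap h₁, v.ord_pow hf0]; simp
  have hy : v.ord (algebraMap k K ξ₂ * T) = -1 := by
    rw [v.ord_mul hA₂ hT0, v.ord_algebraMap h₂, hordT]; simp
  have hz : algebraMap k K ξ₃ = 0 ∨ v.ord (algebraMap k K ξ₃) = 0 := by
    by_cases h : ξ₃ = 0
    · simp [h]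
    · exact Or.inr (v.ord_algebraMap h)
  obtain ⟨n, hn⟩ := hf
  rcases lt_or_ge (v.ord f) 0 with h | h
  · obtain ⟨h1, h2⟩ := v.ord_add_of_lt (y := algebraMap k K ξ₂ * T) hx0
      (Or.inr (by rw [hx, hy]; omega))
    obtain ⟨-, h4⟩ := v.ord_add_of_lt (y := algebraMap k K ξ₃) h1
      (hz.imp id fun h => by rw [h, h2, hx]; omega)
    rw [h4, h2, hx]
    exact ⟨3 * n + 1, by omega⟩
  · obtain ⟨h1, h2⟩ := v.ord_add_of_lt (y := algebraMap k K ξ₁ * f ^ 3) hy0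
      (Or.inr (by rw [hx, hy]; omega))
    obtain ⟨-, h4⟩ := v.ord_add_of_lt (y := algebraMap k K ξ₃) h1
      (hz.imp id fun h => by rw [h, h2, hy]; omega)
    rw [add_comm (algebraMap k K ξ₁ * f ^ 3), h4, h2, hy]
    exact ⟨-1, by omega⟩

end FFPrime

namespace Polynomial

variable {F : Type*} [Field F]

/-- `p` is a sum of four squares of rational functions. -/
def IsSumFourSq (p : F[X]) : Prop :=
  ∃ d a b c e : F[X], d ≠ 0 ∧ d ^ 2 * p = a ^ 2 + b ^ 2 + c ^ 2 + e ^ 2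

theorem IsSumFourSq.mul {p q : F[X]} (hp : p.IsSumFourSq) (hq : q.IsSumFourSq) :
    (p * q).IsSumFourSq := by
  obtain ⟨d, a, b, c, e, hd, h⟩ := hp
  obtain ⟨d', a', b', c', e', hd', h'⟩ := hq
  refine ⟨d * d', a * a' - b * b' - c * c' - e * e', a * b' + b * a' + c * e' - e * c',
    a * c' - b * e' + c * a' + e * b', a * e' + b * c' - c * b' + e * a', mul_ne_zero hd hd', ?_⟩
  calc (d * d') ^ 2 * (p * q) = (d ^ 2 * p) * (d' ^ 2 * q) := by ring
    _ = _ := by rw [h, h']; ring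

/-- `p` is a constant multiple of a sum of four squares of rational functions. -/
def IsSumFourSqUpToConst (p : F[X]) : Prop :=
  ∃ c : F, c ≠ 0 ∧ (C c * p).IsSumFourSq

theorem IsSumFourSqUpToConst.mul {p q : F[X]} (hp : p.IsSumFourSqUpToConst)
    (hq : q.IsSumFourSqUpToConst) : (p * q).IsSumFourSqUpToConst := by
  obtain ⟨c, hc, h⟩ := hp
  obtain ⟨c', hc', h'⟩ := hq
  refine ⟨c * c', mul_ne_zero hc hc', ?_⟩
  have := h.mul h'
  rwa [show C c * p * (C c' * q) = C (c * c') * (p * q) by rw [C_mul]; ring] at this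

theorem isSumFourSqUpToConst_of_isUnit {p : F[X]} (hp : IsUnit p) : p.IsSumFourSqUpToConst := by
  obtain ⟨u, hu, rfl⟩ := isUnit_iff.1 hp
  refine ⟨u⁻¹, inv_ne_zero hu.ne_zero, 1, 1, 0, 0, 0, one_ne_zero, ?_⟩
  rw [← C_mul, inv_mul_cancel₀ hu.ne_zero]
  simp

theorem isSumFourSqUpToConst_of_irreducible_factors {p : F[X]} (hp : p ≠ 0)
    (h : ∀ q : F[X], Irreducible q → q ∣ p → q.IsSumFourSqUpToConst) :
    p.IsSumFourSqUpToConst := by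
  induction p using WfDvdMonoid.induction_on_irreducible with
  | zero => exact absurd rfl hp
  | unit u hu => exact isSumFourSqUpToConst_of_isUnit hu
  | mul a i ha hi ih =>
    exact (h i hi (dvd_mul_right _ _)).mul (ih ha fun q hq hqa => h q hq (hqa.mul_left _))

theorem dvd_sub_mod_self (a q : F[X]) : q ∣ a - a % q :=
  ⟨a / q, by rw [sub_eq_iff_eq_add, EuclideanDomain.div_add_mod]⟩

theorem isSumFourSqUpToConst_of_irreducible (hF : ∀ a b : F, a ^ 2 + b ^ 2 + 1 ≠ 0) {q : F[X]}
    (hq : Irreducible q) (h : ∃ a b : F[X], q ∣ a ^ 2 + b ^ 2 + 1) :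
    q.IsSumFourSqUpToConst := by
  induction hn : q.natDegree using Nat.strong_induction_on generalizing q with
  | _ n ih =>
    obtain ⟨a, b, hab⟩ := h
    have hab' : q ∣ (a % q) ^ 2 + (b % q) ^ 2 + 1 := by
      have h1 : q ∣ a - a % q := dvd_sub_mod_self _ _
      have h2 : q ∣ b - b % q := dvd_sub_mod_self _ _
      have h3 : (a % q) ^ 2 + (b % q) ^ 2 + 1 = (a ^ 2 + b ^ 2 + 1) -
        ((a - a % q) * (a + a % q) + (b - b % q) * (b + b % q)) := by ring
      rw [h3]
      exact dvd_sub hab (dvd_add (h1.mul_right _) (h2.mul_right _))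
    obtain ⟨s, hs⟩ := hab'
    have hq0 : 0 < q.natDegree := hq.natDegree_pos
    have hda : (a % q).natDegree < q.natDegree := natDegree_mod_lt a hq0.ne'
    have hdb : (b % q).natDegree < q.natDegree := natDegree_mod_lt b hq0.ne'
    have hs0 : s ≠ 0 := by
      rintro rfl
      have := congrArg (eval 0) hs
      simp only [eval_add, eval_pow, eval_one, mul_zero, eval_zero] at this
      exact hF _ _ this
    have hds : s.natDegree < q.natDegree := by
      have h1 : (q * s).natDegree ≤ 2 * (q.natDegree - 1) := by
        rw [← hs]
        refine natDegree_add_le_of_degree_le (natDegree_add_le_of_degree_le ?_ ?_) (by simp)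
        · exact natDegree_pow_le_of_le 2 (by omega)
        · exact natDegree_pow_le_of_le 2 (by omega)
      rw [natDegree_mul hq.ne_zero hs0] at h1
      omega
    have hS : s.IsSumFourSqUpToConst := by
      refine isSumFourSqUpToConst_of_irreducible_factors hs0 fun r hr hrs => ?_
      exact ih r.natDegree ((natDegree_le_of_dvd hrs hs0).trans_lt (hn ▸ hds)) hr
        ⟨a % q, b % q, hs ▸ hrs.mul_left q⟩ rfl
    obtain ⟨c, hc, d, x, y, z, w, hd, h⟩ := hS
    have h1 : (q * s).IsSumFourSq := ⟨1, a % q, b % q, 1, 0, one_ne_zero, by rw [← hs]; ring⟩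
    obtain ⟨d', x, y, z, w, hd', h⟩ := h1.mul ⟨d, x, y, z, w, hd, h⟩
    refine ⟨c, hc, d' * s, x, y, z, w, mul_ne_zero hd' hs0, ?_⟩
    rw [← h]; ring

theorem isSumFourSq_of_monic (φ : F →+* ℝ) {p : F[X]} (hp : p.Monic)
    (h : p.IsSumFourSqUpToConst) : p.IsSumFourSq := by
  obtain ⟨u, hu, d, a, b, c, e, hd, h⟩ := h
  set m := max (max a.natDegree b.natDegree) (max c.natDegree e.natDegree) with hm
  have hcoeff : ∀ r : F[X], r.natDegree ≤ m → (r ^ 2).coeff (2 * m) = r.coeff m ^ 2 := fun r hr =>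
    coeff_pow_of_natDegree_le hr |>.symm ▸ rfl
  have hA : (a ^ 2 + b ^ 2 + c ^ 2 + e ^ 2).coeff (2 * m) =
      a.coeff m ^ 2 + b.coeff m ^ 2 + c.coeff m ^ 2 + e.coeff m ^ 2 := by
    simp only [coeff_add]
    rw [hcoeff a (by simp [hm]), hcoeff b (by simp [hm]), hcoeff c (by simp [hm]),
      hcoeff e (by simp [hm])]
  have hle : (a ^ 2 + b ^ 2 + c ^ 2 + e ^ 2).natDegree ≤ 2 * m := by
    refine natDegree_add_le_of_degree_le (natDegree_add_le_of_degree_le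
      (natDegree_add_le_of_degree_le ?_ ?_) ?_) ?_ <;> exact natDegree_pow_le_of_le 2 (by simp [hm])
  have hL : (d ^ 2 * (C u * p)).leadingCoeff = d.leadingCoeff ^ 2 * u := by
    simp [hp.leadingCoeff]
  have hne : d ^ 2 * (C u * p) ≠ 0 :=
    mul_ne_zero (pow_ne_zero 2 hd) (mul_ne_zero (C_ne_zero.2 hu) hp.ne_zero)
  have hnz : a.coeff m ^ 2 + b.coeff m ^ 2 + c.coeff m ^ 2 + e.coeff m ^ 2 ≠ 0 := by
    intro h0
    have h1 : φ (a.coeff m) ^ 2 + φ (b.coeff m) ^ 2 + φ (c.coeff m) ^ 2 + φ (e.coeff m) ^ 2 =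
        0 := by
      simpa using congrArg φ h0
    have h2 : ∀ r : F, φ r ^ 2 = 0 → r = 0 := fun r hr => by simpa using hr
    have ha' := sq_nonneg (φ (a.coeff m))
    have hb' := sq_nonneg (φ (b.coeff m))
    have hc' := sq_nonneg (φ (c.coeff m))
    have he' := sq_nonneg (φ (e.coeff m))
    have ha : a.coeff m = 0 := h2 _ (by linarith)
    have hb : b.coeff m = 0 := h2 _ (by linarith)
    have hc : c.coeff m = 0 := h2 _ (by linarith)
    have he : e.coeff m = 0 := h2 _ (by linarith)
    have hzero : ∀ r : F[X], r.natDegree = m → r.coeff m = 0 → r = 0 := fun r hr h => by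
      rwa [← hr, coeff_natDegree, leadingCoeff_eq_zero] at h
    have hm0 : m = 0 := by
      rcases max_choice (max a.natDegree b.natDegree) (max c.natDegree e.natDegree) with h3 | h3
      · rcases max_choice a.natDegree b.natDegree with h4 | h4
        · have := hzero a (by rw [hm, h3, h4]) ha
          rw [hm, h3, h4, this, natDegree_zero]
        · have := hzero b (by rw [hm, h3, h4]) hb
          rw [hm, h3, h4, this, natDegree_zero]
      · rcases max_choice c.natDegree e.natDegree with h4 | h4
        · have := hzero c (by rw [hm, h3, h4]) hc
          rw [hm, h3, h4, this, natDegree_zero]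
        · have := hzero e (by rw [hm, h3, h4]) he
          rw [hm, h3, h4, this, natDegree_zero]
    have hr : ∀ r : F[X], r.natDegree ≤ m → r.coeff m = 0 → r = 0 := fun r hr h =>
      hzero r (by omega) h
    apply hne
    rw [h, hr a (by simp [hm]) ha, hr b (by simp [hm]) hb, hr c (by simp [hm]) hc,
      hr e (by simp [hm]) he]
    ring
  have hdeg : (a ^ 2 + b ^ 2 + c ^ 2 + e ^ 2).natDegree = 2 * m :=
    le_antisymm hle (le_natDegree_of_ne_zero (hA ▸ hnz))
  have hu' : d.leadingCoeff ^ 2 * u =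
      a.coeff m ^ 2 + b.coeff m ^ 2 + c.coeff m ^ 2 + e.coeff m ^ 2 := by
    rw [← hL, h, leadingCoeff, hdeg, hA]
  have hCu : (C u).IsSumFourSq := by
    refine ⟨C d.leadingCoeff, C (a.coeff m), C (b.coeff m), C (c.coeff m), C (e.coeff m),
      by simpa using hd, ?_⟩
    rw [← C_pow, ← C_mul, hu']
    simp
  obtain ⟨d', a', b', c', e', hd', h'⟩ := hCu.mul ⟨d, a, b, c, e, hd, h⟩
  refine ⟨d' * C u, a', b', c', e', mul_ne_zero hd' (C_ne_zero.2 hu), ?_⟩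
  rw [← h']; ring

/-- A monic polynomial over a real field is a sum of four squares of rational functions as soon
as `-1` is a sum of two squares modulo each of its irreducible factors. -/
theorem isSumFourSq_of_factors (φ : F →+* ℝ) {p : F[X]} (hp : p.Monic)
    (h : ∀ q : F[X], Irreducible q → q ∣ p → ∃ a b : F[X], q ∣ a ^ 2 + b ^ 2 + 1) :
    p.IsSumFourSq := by
  refine isSumFourSq_of_monic φ hp (isSumFourSqUpToConst_of_irreducible_factors hp.ne_zero
    fun q hq hqp => isSumFourSqUpToConst_of_irreducible (fun a b hab => ?_) hq (h q hq hqp))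
  have : φ a ^ 2 + φ b ^ 2 + 1 = 0 := by simpa using congrArg φ hab
  nlinarith [sq_nonneg (φ a), sq_nonneg (φ b)]

end Polynomial

section AmbiguousClass

variable {X J : Type*} [CommGroup X] [CommGroup J]

/-- The endomorphism `x ↦ x / σ x`. -/
def divTwist (σ : X →* X) : X →* X := MonoidHom.id X / σ

/-- The endomorphism `x ↦ x * σ x`. -/
def mulTwist (σ : X →* X) : X →* X := MonoidHom.id X * σ

@[simp] lemma divTwist_apply (σ : X →* X) (x : X) : divTwist σ x = x / σ x := rfl

@[simp] lemma mulTwist_apply (σ : X →* X) (x : X) : mulTwist σ x = x * σ x := rfl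

/-- The counting argument behind the Hasse norm principle for an everywhere unramified
quadratic extension, abstracted from ideals, elements and units. -/
theorem mem_range_mulTwist_of_index_le (σ : X →* X) (τ : J →* J) (d : X →* J)
    (hσ : ∀ x, σ (σ x) = x) (hτ : ∀ b, τ (τ b) = b) (hd : ∀ x, d (σ x) = τ (d x))
    (h90 : (mulTwist σ).ker ≤ (divTwist σ).range)
    (hfin : d.range.index ≠ 0)
    (hfin' : ((divTwist σ).ker.map d).relIndex (divTwist τ).ker ≠ 0)
    (hB : ((mulTwist τ).range ⊔ (divTwist σ).ker.map d).relIndex (divTwist τ).ker ≤ 2)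
    (hA : 2 * (d.ker.map (mulTwist σ)).relIndex (d.ker ⊓ (divTwist σ).ker) =
      (d.ker.map (divTwist σ)).relIndex (d.ker ⊓ (mulTwist σ).ker))
    (hA0 : (d.ker.map (mulTwist σ)).relIndex (d.ker ⊓ (divTwist σ).ker) ≠ 0) :
    d.ker ⊓ (divTwist σ).ker ≤ (mulTwist σ).range := by
  set DL := (divTwist σ).ker.map d with hDL
  set Jσ := (divTwist τ).ker with hJσ
  set D := d.range with hD
  set NA := d.ker.map (mulTwist σ) with hNA
  set Ap := d.ker ⊓ (divTwist σ).ker with hAp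
  set B := D.comap (divTwist τ) with hBdef
  have hDLD : DL ≤ D := by
    rintro _ ⟨x, -, rfl⟩; exact ⟨x, rfl⟩
  have hDLJ : DL ≤ Jσ := by
    rintro _ ⟨x, hx, rfl⟩
    simp only [SetLike.mem_coe, MonoidHom.mem_ker, divTwist_apply, hJσ, div_eq_one] at hx ⊢
    rw [← hd, ← hx]
  have hDB : D ≤ B := by
    rintro _ ⟨x, rfl⟩
    exact ⟨x / σ x, by simp [hd]⟩
  have hJB : Jσ ≤ B := by
    intro b hb
    have : divTwist τ b = 1 := hb
    rw [hBdef, Subgroup.mem_comap, this]; exact one_mem _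
  have hNJ : (mulTwist τ).range ≤ Jσ := by
    rintro _ ⟨b, rfl⟩
    simp [hJσ, MonoidHom.mem_ker, hτ, mul_comm]
  have hNAle : NA ≤ Ap ⊓ (mulTwist σ).range := by
    rintro _ ⟨x, hx, rfl⟩
    have hx' : d x = 1 := hx
    refine ⟨⟨?_, ?_⟩, ⟨x, rfl⟩⟩
    · simp [hd, hx']
    · simp [hσ, mul_comm]
  -- the index of `D` in `B`
  have c1 : D.relIndex B = ((divTwist τ).range ⊔ D).index := by
    have e1 := Subgroup.relIndex_mul_index hDB
    have e2 := Subgroup.relIndex_mul_index (le_sup_right : D ≤ (divTwist τ).range ⊔ D)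
    rw [Subgroup.relIndex_sup_right] at e2
    rw [hBdef, Subgroup.index_comap] at e1
    have h0 : D.relIndex (divTwist τ).range ≠ 0 := by
      intro h; rw [h, zero_mul] at e2; exact hfin e2.symm
    apply Nat.eq_of_mul_eq_mul_left (Nat.pos_of_ne_zero h0)
    rw [e2, ← e1, mul_comm]
  have c2 : DL.relIndex (mulTwist τ).range ≤ D.relIndex B := by
    rw [c1, ← Subgroup.index_comap]
    have hle : (divTwist τ).range ⊔ D ≤ DL.comap (mulTwist τ) := by
      refine sup_le ?_ ?_
      · rintro _ ⟨b, rfl⟩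
        rw [Subgroup.mem_comap]
        have : mulTwist τ (divTwist τ b) = 1 := by simp [hτ]
        rw [this]; exact one_mem _
      · rintro _ ⟨x, rfl⟩
        refine ⟨x * σ x, ?_, by simp [hd]⟩
        simp [hσ, mul_comm]
    refine Nat.le_of_dvd (Nat.pos_of_ne_zero fun h => hfin ?_) (Subgroup.index_dvd_of_le hle)
    rw [← Subgroup.relIndex_mul_index (le_sup_right : D ≤ (divTwist τ).range ⊔ D), h, mul_zero]
  have c3 : DL.relIndex Jσ ≤ 2 * D.relIndex B := by
    rw [← Subgroup.relIndex_mul_relIndex DL _ Jσ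
      (le_sup_right : DL ≤ (mulTwist τ).range ⊔ DL) (sup_le hNJ hDLJ), Subgroup.relIndex_sup_right,
      mul_comm]
    exact Nat.mul_le_mul hB c2
  have c4 : DL.relIndex (D ⊓ Jσ) ≤ 2 * (Jσ ⊔ D).relIndex B := by
    rw [← Subgroup.relIndex_mul_relIndex D _ B (le_sup_right : D ≤ Jσ ⊔ D) (sup_le hJB hDB),
      Subgroup.relIndex_sup_right, ← Subgroup.relIndex_mul_relIndex DL (D ⊓ Jσ) Jσ
      (le_inf hDLD hDLJ) inf_le_right, Subgroup.inf_relIndex_right] at c3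
    have h0 : D.relIndex Jσ ≠ 0 := by
      intro h
      exact hfin (Subgroup.index_eq_zero_of_relIndex_eq_zero h)
    refine Nat.le_of_mul_le_mul_right ?_ (Nat.pos_of_ne_zero h0)
    linarith
  have hAX : NA.relIndex (Ap ⊓ (mulTwist σ).range) ≠ 0 := fun h =>
    hA0 (Subgroup.relIndex_eq_zero_of_le_right inf_le_left h)
  have c5 : (Jσ ⊔ D).relIndex B ≤ NA.relIndex (Ap ⊓ (mulTwist σ).range) := by
    set P : Subgroup (J × X) :=
      MonoidHom.eqLocus ((divTwist τ).comp (MonoidHom.fst J X)) (d.comp (MonoidHom.snd J X))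
    have hP : P.map (MonoidHom.fst J X) = B := by
      ext b
      constructor
      · rintro ⟨⟨b, x⟩, hx, rfl⟩
        exact ⟨x, (show divTwist τ b = d x from hx).symm⟩
      · rintro ⟨x, hx⟩
        exact ⟨(b, x), hx.symm, rfl⟩
    have hP2 : P.map ((mulTwist σ).comp (MonoidHom.snd J X)) ≤ Ap ⊓ (mulTwist σ).range := by
      rintro _ ⟨⟨b, x⟩, hx, rfl⟩
      have hx : divTwist τ b = d x := hx
      refine ⟨⟨?_, ?_⟩, ⟨x, rfl⟩⟩
      · simp [hd, ← hx, hτ]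
      · simp [hσ, mul_comm]
    have hne : NA.relIndex (P.map ((mulTwist σ).comp (MonoidHom.snd J X))) ≠ 0 := fun h =>
      hAX (Subgroup.relIndex_eq_zero_of_le_right hP2 h)
    refine le_trans ?_ (Subgroup.relIndex_le_of_le_right hP2 hAX)
    refine Nat.le_of_dvd (Nat.pos_of_ne_zero hne) ?_
    rw [← hP, ← Subgroup.relIndex_comap, ← Subgroup.relIndex_comap,
      ← Subgroup.inf_relIndex_right (NA.comap _)]
    refine Subgroup.relIndex_dvd_of_le_left _ ?_
    rintro ⟨b, x⟩ ⟨⟨a, ha, hax⟩, hx⟩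
    have hx : divTwist τ b = d x := hx
    have ha : d a = 1 := ha
    have hax : a * σ a = x * σ x := hax
    have hk : x / a ∈ (mulTwist σ).ker := by
      rw [MonoidHom.mem_ker, mulTwist_apply, map_div, div_mul_div_comm, ← hax, div_self']
    obtain ⟨y, hy⟩ := h90 hk
    have hy : y / σ y = x / a := hy
    rw [Subgroup.mem_comap, MonoidHom.coe_fst]
    have : b = (b / d y) * d y := by simp
    rw [this]
    refine mul_mem (Subgroup.mem_sup_left ?_) (Subgroup.mem_sup_right ⟨y, rfl⟩)
    rw [hJσ, MonoidHom.mem_ker, map_div, hx]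
    have : d x = divTwist τ (d y) := by
      rw [divTwist_apply, ← hd, ← map_div, hy, map_div, ha, div_one]
    rw [this, div_self']
  have c6 : (d.ker.map (divTwist σ)).relIndex (d.ker ⊓ (mulTwist σ).ker) ≤
      DL.relIndex (D ⊓ Jσ) := by
    have hP : (Jσ.comap d).map d = D ⊓ Jσ := by
      rw [Subgroup.map_comap_eq]
    have hP2 : (Jσ.comap d).map (divTwist σ) = d.ker ⊓ (mulTwist σ).ker := by
      ext x
      constructor
      · rintro ⟨x, hx, rfl⟩
        have hx : divTwist τ (d x) = 1 := hx
        refine ⟨?_, ?_⟩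
        · change d (x / σ x) = 1
          rw [map_div, hd]; exact hx
        · simp [hσ]
      · rintro ⟨hx1, hx2⟩
        obtain ⟨y, rfl⟩ := h90 hx2
        refine ⟨y, ?_, rfl⟩
        have hx1 : d (y / σ y) = 1 := hx1
        rw [map_div, hd] at hx1
        exact hx1
    have hDLfin : DL.relIndex (D ⊓ Jσ) ≠ 0 := fun h =>
      hfin' (Subgroup.relIndex_eq_zero_of_le_right inf_le_right h)
    refine Nat.le_of_dvd (Nat.pos_of_ne_zero hDLfin) ?_
    rw [← hP, ← hP2, ← Subgroup.relIndex_comap, ← Subgroup.relIndex_comap]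
    refine Subgroup.relIndex_dvd_of_le_left _ ?_
    rintro x ⟨y, hy, hyx⟩
    have hy : divTwist σ y = 1 := hy
    refine ⟨x / y, ?_, ?_⟩
    · simp [hyx]
    · rw [map_div, hy, div_one]
  have hlast := Subgroup.relIndex_mul_relIndex NA _ Ap hNAle inf_le_left
  have : (Ap ⊓ (mulTwist σ).range).relIndex Ap ≤ 1 := by
    have h1 : NA.relIndex Ap ≤ NA.relIndex (Ap ⊓ (mulTwist σ).range) := by omega
    rw [← hlast] at h1
    refine Nat.le_of_mul_le_mul_left (by simpa using h1) (Nat.pos_of_ne_zero hAX)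
  have h1 : (Ap ⊓ (mulTwist σ).range).relIndex Ap = 1 := by
    refine le_antisymm this (Nat.one_le_iff_ne_zero.mpr fun h => hA0 ?_)
    rw [← hlast, h, mul_zero]
  exact (Subgroup.relIndex_eq_one.mp h1).trans inf_le_right

end AmbiguousClass

section TwistIndex

open Module

lemma finrank_int_eq_zero_of_finite (F : Type*) [AddCommGroup F] [Finite F] :
    finrank ℤ F = 0 := by
  refine Module.finrank_eq_zero_iff_isTorsion.mpr fun {x} => ?_
  exact ⟨⟨(Nat.card F : ℤ), mem_nonZeroDivisors_of_ne_zero (by exact_mod_cast Nat.card_pos.ne')⟩,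
    by simp [Submonoid.smul_def]⟩

lemma finrank_int_range_add_ker {G H : Type*} [AddCommGroup G] [AddCommGroup H]
    [Module.Finite ℤ G] (f : G →ₗ[ℤ] H) :
    finrank ℤ (LinearMap.range f) + finrank ℤ (LinearMap.ker f) = finrank ℤ G := by
  rw [← Submodule.finrank_quotient_add_finrank (LinearMap.ker f),
    f.quotKerEquivRange.finrank_eq]

lemma index_range_two_smul_of_equiv {G F : Type*} [AddCommGroup G] [AddCommGroup F]
    [Module.Finite ℤ G] [Finite F] {n : ℕ} (f : G ≃+ (Fin n → ℤ) × F) :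
    (zsmulAddGroupHom 2 : G →+ G).range.index =
      2 ^ finrank ℤ G * Nat.card (zsmulAddGroupHom 2 : G →+ G).ker := by
  have hrank : finrank ℤ G = n := by
    have h := finrank_int_range_add_ker
      ((LinearMap.fst ℤ (Fin n → ℤ) F).comp f.toIntLinearEquiv.toLinearMap)
    have h1 : LinearMap.range ((LinearMap.fst ℤ (Fin n → ℤ) F).comp
        f.toIntLinearEquiv.toLinearMap) = ⊤ := by
      rw [LinearMap.range_eq_top]
      exact fun x => ⟨f.symm (x, 0), by simp⟩
    have h2 : Finite (LinearMap.ker ((LinearMap.fst ℤ (Fin n → ℤ) F).comp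
        f.toIntLinearEquiv.toLinearMap)) := by
      refine Finite.of_injective (fun x => (f x.1).2) fun x y hxy => ?_
      have hx : (f x.1).1 = 0 := x.2
      have hy : (f y.1).1 = 0 := y.2
      exact Subtype.ext (f.injective (Prod.ext (hx.trans hy.symm) hxy))
    rw [h1, finrank_int_eq_zero_of_finite (LinearMap.ker _), finrank_top] at h
    simpa using h.symm
  have hG : (zsmulAddGroupHom 2 : G →+ G).range.map (f : G →+ (Fin n → ℤ) × F) =
      (AddSubgroup.pi Set.univ fun _ => AddSubgroup.zmultiples (2 : ℤ)).prod
        (zsmulAddGroupHom 2 : F →+ F).range := by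
    ext ⟨x, y⟩
    simp only [AddSubgroup.mem_map, AddMonoidHom.mem_range, zsmulAddGroupHom_apply,
      exists_exists_eq_and, AddSubgroup.mem_prod, AddSubgroup.mem_pi, Set.mem_univ, forall_const,
      Int.mem_zmultiples_iff, AddMonoidHom.coe_coe]
    constructor
    · rintro ⟨a, ha⟩
      rw [map_zsmul] at ha
      exact ⟨fun i => ⟨(f a).1 i, by simpa using (congrFun (congrArg Prod.fst ha) i).symm⟩,
        (f a).2, congrArg Prod.snd ha⟩
    · rintro ⟨h1, z, hz⟩
      choose w hw using h1
      refine ⟨f.symm (w, z), ?_⟩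
      rw [map_zsmul, f.apply_symm_apply]
      exact Prod.ext (funext fun i => by simp [hw]) hz
  have hker : Nat.card (zsmulAddGroupHom 2 : G →+ G).ker =
      Nat.card (zsmulAddGroupHom 2 : F →+ F).ker := by
    refine Nat.card_eq_of_bijective (fun x => ⟨(f x.1).2, ?_⟩) ⟨fun x y hxy => ?_, fun y => ?_⟩
    · have hx : (2 : ℤ) • x.1 = 0 := x.2
      have := congrArg (fun z => (f z).2) hx
      simpa [map_zsmul, AddMonoidHom.mem_ker] using this
    · have key : ∀ x : (zsmulAddGroupHom 2 : G →+ G).ker, (f x.1).1 = 0 := by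
        intro x
        have hx : (2 : ℤ) • x.1 = 0 := x.2
        have := congrArg (fun z => (f z).1) hx
        ext i
        have := congrFun this i
        simpa [map_zsmul] using this
      exact Subtype.ext (f.injective (Prod.ext ((key x).trans (key y).symm)
        (congrArg Subtype.val hxy)))
    · have hy : (2 : ℤ) • y.1 = 0 := y.2
      refine ⟨⟨f.symm (0, y.1), ?_⟩, by simp⟩
      rw [AddMonoidHom.mem_ker, zsmulAddGroupHom_apply, ← map_zsmul]
      simp [Prod.smul_mk, hy]
  have h3 : (zsmulAddGroupHom 2 : F →+ F).range.index =
      Nat.card (zsmulAddGroupHom 2 : F →+ F).ker := AddSubgroup.index_range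
  rw [hrank, hker, ← h3, ← AddSubgroup.index_map_equiv _ f, hG, AddSubgroup.index_prod,
    AddSubgroup.index_pi]
  simp [Int.index_zmultiples]

/-- For a finitely generated abelian group `G`, the index of `2 • G` is `2 ^ rank G * #G[2]`. -/
theorem index_range_two_smul (G : Type*) [AddCommGroup G] [Module.Finite ℤ G] :
    (zsmulAddGroupHom 2 : G →+ G).range.index =
      2 ^ finrank ℤ G * Nat.card (zsmulAddGroupHom 2 : G →+ G).ker := by
  have : AddGroup.FG G := Module.Finite.iff_addGroup_fg.mp inferInstance
  obtain ⟨n, ι, _, p, hp, e, ⟨f⟩⟩ := AddCommGroup.equiv_free_prod_directSum_zmod G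
  have : ∀ i, NeZero (p i ^ e i) := fun i => ⟨pow_ne_zero _ (hp i).ne_zero⟩
  classical
  have hfin : Finite (DirectSum ι fun i => ZMod (p i ^ e i)) := by
    exact Finite.of_equiv _ (DirectSum.addEquivProd (fun i => ZMod (p i ^ e i))).symm.toEquiv
  exact index_range_two_smul_of_equiv (f.trans ((Finsupp.linearEquivFunOnFinite ℤ ℤ
    (Fin n)).toAddEquiv.prodCongr (AddEquiv.refl _)))

/-- For a finitely generated abelian group `G` with exactly two elements of order dividing `2`,
the index of the squares is `2 ^ (rank G + 1)`. -/
theorem index_range_sq {G : Type*} [CommGroup G] [Module.Finite ℤ (Additive G)] {ε : G}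
    (hε : ε ≠ 1) (hε2 : ε ^ 2 = 1) (h2 : ∀ a : G, a ^ 2 = 1 → a = 1 ∨ a = ε) :
    (powMonoidHom 2 : G →* G).range.index = 2 ^ (finrank ℤ (Additive G) + 1) := by
  have h := index_range_two_smul (Additive G)
  have h1 : Nat.card (zsmulAddGroupHom 2 : Additive G →+ Additive G).ker = 2 := by
    have : ((zsmulAddGroupHom 2 : Additive G →+ Additive G).ker : Set (Additive G)) =
        {Additive.ofMul 1, Additive.ofMul ε} := by
      ext x
      obtain ⟨x, rfl⟩ := Additive.ofMul.surjective x
      have : x ∈ ({1, ε} : Set G) ↔ x ^ 2 = 1 :=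
        ⟨by rintro (rfl | rfl) <;> simp [hε2], h2 x⟩
      have e : ((zsmulAddGroupHom 2) (Additive.ofMul x) = 0) ↔ x ^ 2 = 1 := by
        rw [zsmulAddGroupHom_apply, ← ofMul_zpow, ofMul_eq_zero, zpow_ofNat]
      rw [SetLike.mem_coe, AddMonoidHom.mem_ker, e, ← this]
      simp
    rw [← SetLike.coe_sort_coe, Nat.card_coe_set_eq, this, Set.ncard_pair]
    exact fun h => hε (Additive.ofMul.injective h).symm
  rw [h1, ← pow_succ] at h
  rw [← h, ← Subgroup.index_toAddSubgroup]
  congr 1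
  ext x
  obtain ⟨x, rfl⟩ := Additive.ofMul.surjective x
  constructor
  · rintro ⟨y, hy⟩
    refine ⟨Additive.ofMul y, ?_⟩
    rw [zsmulAddGroupHom_apply, ← ofMul_zpow]
    exact congrArg Additive.ofMul (by simpa using hy)
  · rintro ⟨y, hy⟩
    refine ⟨y.toMul, ?_⟩
    have := congrArg Additive.toMul hy
    simpa using this

lemma finrank_additive_range_add_ker {G H : Type*} [CommGroup G] [CommGroup H]
    [Module.Finite ℤ (Additive G)] (f : G →* H) :
    finrank ℤ (Additive f.range) + finrank ℤ (Additive f.ker) = finrank ℤ (Additive G) := by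
  have h := finrank_int_range_add_ker (MonoidHom.toAdditive f).toIntLinearMap
  rw [← h]
  congr 1

lemma finrank_additive_le_of_injective {G H : Type*} [CommGroup G] [CommGroup H]
    [Module.Finite ℤ (Additive H)] (f : G →* H) (hf : Function.Injective f) :
    finrank ℤ (Additive G) ≤ finrank ℤ (Additive H) :=
  LinearMap.finrank_le_finrank_of_injective (f := (MonoidHom.toAdditive f).toIntLinearMap) hf

instance finite_additive_subgroup {G : Type*} [CommGroup G] [Module.Finite ℤ (Additive G)]
    (H : Subgroup G) : Module.Finite ℤ (Additive H) :=
  Module.Finite.of_injective (MonoidHom.toAdditive H.subtype).toIntLinearMap H.subtype_injective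

lemma finrank_additive_ker_sq {G : Type*} [CommGroup G] [Module.Finite ℤ (Additive G)] :
    finrank ℤ (Additive (powMonoidHom 2 : G →* G).ker) = 0 := by
  refine Module.finrank_eq_zero_iff_isTorsion.mpr fun {x} =>
    ⟨⟨2, mem_nonZeroDivisors_of_ne_zero two_ne_zero⟩, ?_⟩
  obtain ⟨x, rfl⟩ := Additive.ofMul.surjective x
  have : x ^ 2 = 1 := Subtype.ext x.2
  change (2 : ℤ) • Additive.ofMul x = 0
  rw [← ofMul_zpow, zpow_ofNat, this, ofMul_one]

/-- The index of the squares in a subgroup having exactly two elements of order dividing `2`. -/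
lemma relIndex_map_sq {G : Type*} [CommGroup G] [Module.Finite ℤ (Additive G)] {ε : G}
    (hε : ε ≠ 1) (hε2 : ε ^ 2 = 1) (h2 : ∀ a : G, a ^ 2 = 1 → a = 1 ∨ a = ε) {H : Subgroup G}
    (hH : ε ∈ H) :
    (H.map (powMonoidHom 2)).relIndex H = 2 ^ (finrank ℤ (Additive H) + 1) := by
  rw [← index_range_sq (G := H) (ε := ⟨ε, hH⟩) (fun h => hε (congrArg Subtype.val h))
    (Subtype.ext hε2) (fun a ha => (h2 a (congrArg Subtype.val ha)).imp Subtype.ext Subtype.ext)]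
  rw [Subgroup.relIndex]
  congr 1
  ext x
  constructor
  · rintro ⟨y, hy, hyx⟩
    exact ⟨⟨y, hy⟩, Subtype.ext hyx⟩
  · rintro ⟨y, rfl⟩
    exact ⟨y, y.2, rfl⟩

/-- Herbrand-type comparison of the two unit indices attached to an involution. -/
theorem two_mul_relIndex_range_mulTwist {A : Type*} [CommGroup A] [Module.Finite ℤ (Additive A)]
    (σ : A →* A) (hσ : ∀ a, σ (σ a) = a) {ε : A} (hε : ε ≠ 1) (hε2 : ε ^ 2 = 1)
    (h2 : ∀ a : A, a ^ 2 = 1 → a = 1 ∨ a = ε) (hσε : σ ε = ε)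
    (hrank : finrank ℤ (Additive A) = 2 * finrank ℤ (Additive (divTwist σ).ker) + 1) :
    2 * (mulTwist σ).range.relIndex (divTwist σ).ker =
      (divTwist σ).range.relIndex (mulTwist σ).ker ∧
    (mulTwist σ).range.relIndex (divTwist σ).ker ≠ 0 := by
  set Ap := (divTwist σ).ker
  set Am := (mulTwist σ).ker
  have hAp : ∀ a, a ∈ Ap ↔ σ a = a := fun a => by
    simp only [Ap, MonoidHom.mem_ker, divTwist_apply, div_eq_one]; exact eq_comm
  have hAm : ∀ a, a ∈ Am ↔ σ a = a⁻¹ := fun a => by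
    simp only [Am, MonoidHom.mem_ker, mulTwist_apply]
    rw [mul_eq_one_iff_inv_eq]; exact eq_comm
  have e1 : Ap.map (mulTwist σ) = Ap.map (powMonoidHom 2) := by
    ext x
    constructor <;> rintro ⟨a, ha, rfl⟩ <;> refine ⟨a, ha, ?_⟩ <;>
      simp [(hAp a).mp ha, pow_two]
  have e2 : Am.map (divTwist σ) = Am.map (powMonoidHom 2) := by
    ext x
    constructor <;> rintro ⟨a, ha, rfl⟩ <;> refine ⟨a, ha, ?_⟩ <;>
      simp [(hAm a).mp ha, pow_two]
  have hN : (mulTwist σ).range ≤ Ap := by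
    rintro _ ⟨a, rfl⟩; simp [hAp, hσ, mul_comm]
  have hD : (divTwist σ).range ≤ Am := by
    rintro _ ⟨a, rfl⟩; simp [hAm, hσ]
  have hεp : ε ∈ Ap := (hAp ε).mpr hσε
  have hεm : ε ∈ Am := (hAm ε).mpr (by
    rw [hσε]; exact eq_inv_of_mul_eq_one_left (by rw [← pow_two, hε2]))
  have i1 := Subgroup.relIndex_mul_relIndex (Ap.map (mulTwist σ)) _ Ap
    (Subgroup.map_le_range _ _) hN
  have i2 := Subgroup.relIndex_mul_relIndex (Am.map (divTwist σ)) _ Am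
    (Subgroup.map_le_range _ _) hD
  have j1 : (Ap.map (mulTwist σ)).relIndex (mulTwist σ).range = (Ap ⊔ Am).index := by
    rw [MonoidHom.range_eq_map, Subgroup.relIndex_map_map, top_sup_eq, Subgroup.relIndex_top_right]
  have j2 : (Am.map (divTwist σ)).relIndex (divTwist σ).range = (Ap ⊔ Am).index := by
    rw [MonoidHom.range_eq_map, Subgroup.relIndex_map_map, top_sup_eq, Subgroup.relIndex_top_right,
      sup_comm]
  rw [e1, relIndex_map_sq hε hε2 h2 hεp, ← e1, j1] at i1
  rw [e2, relIndex_map_sq hε hε2 h2 hεm, ← e2, j2] at i2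
  have r1 := finrank_additive_range_add_ker (mulTwist σ)
  have r2 : finrank ℤ (Additive (mulTwist σ).range) = finrank ℤ (Additive Ap) := by
    refine le_antisymm (finrank_additive_le_of_injective (Subgroup.inclusion hN)
      (Subgroup.inclusion_injective hN)) ?_
    have h := finrank_additive_range_add_ker (powMonoidHom 2 : Ap →* Ap)
    rw [finrank_additive_ker_sq, add_zero] at h
    rw [← h]
    have hmem : ∀ x : (powMonoidHom 2 : Ap →* Ap).range, (x.1.1 : A) ∈ (mulTwist σ).range := by
      rintro ⟨_, ⟨y, rfl⟩⟩
      exact ⟨y.1, by simp [(hAp y).mp y.2, pow_two]⟩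
    let g : (powMonoidHom 2 : Ap →* Ap).range →* (mulTwist σ).range :=
      { toFun := fun x => ⟨x.1.1, hmem x⟩, map_one' := rfl, map_mul' := fun _ _ => rfl }
    exact finrank_additive_le_of_injective g
      fun x y hxy => Subtype.ext (Subtype.ext (congrArg (fun z => z.1) hxy))
  have r3 : finrank ℤ (Additive Am) = finrank ℤ (Additive Ap) + 1 := by
    have : finrank ℤ (Additive (mulTwist σ).ker) = finrank ℤ (Additive Am) := rfl
    omega
  rw [r3, pow_succ 2 (_ + 1), ← i1] at i2
  have h0 : (Ap ⊔ Am).index * (mulTwist σ).range.relIndex Ap ≠ 0 := by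
    rw [i1]; positivity
  refine ⟨?_, right_ne_zero_of_mul h0⟩
  refine Nat.eq_of_mul_eq_mul_left (Nat.pos_of_ne_zero (left_ne_zero_of_mul h0)) ?_
  rw [i2]; ring

end TwistIndex

section Tent

/-- The tent function `max 0 (1 - |x|)`. -/
noncomputable def tent (x : ℝ) : ℝ := max 0 (1 - |x|)

lemma tent_nonneg (x : ℝ) : 0 ≤ tent x := le_max_left _ _

lemma tent_le_one (x : ℝ) : tent x ≤ 1 := max_le zero_le_one (by linarith [abs_nonneg x])

lemma abs_lt_one_of_tent_ne_zero {x : ℝ} (h : tent x ≠ 0) : |x| < 1 := by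
  by_contra! h1
  exact h (max_eq_left (by linarith))

lemma abs_tent_sub_tent_le (x y : ℝ) : |tent x - tent y| ≤ |x - y| := by
  unfold tent
  refine (abs_max_sub_max_le_max _ _ _ _).trans ?_
  rw [sub_self, abs_zero, max_eq_right (abs_nonneg _), sub_sub_sub_cancel_left, abs_sub_comm x y]
  exact abs_abs_sub_abs_le_abs_sub y x

lemma abs_prod_sub_prod_le {κ : Type*} (t : Finset κ) (f g : κ → ℝ) (hf : ∀ i, |f i| ≤ 1)
    (hg : ∀ i, |g i| ≤ 1) : |∏ i ∈ t, f i - ∏ i ∈ t, g i| ≤ ∑ i ∈ t, |f i - g i| := by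
  classical
  induction t using Finset.induction_on with
  | empty => simp
  | insert i t hi ih =>
    rw [Finset.prod_insert hi, Finset.prod_insert hi, Finset.sum_insert hi]
    have h1 : |∏ i ∈ t, f i| ≤ 1 := by
      rw [Finset.abs_prod]; exact Finset.prod_le_one (fun _ _ => abs_nonneg _) fun i _ => hf i
    calc |f i * ∏ i ∈ t, f i - g i * ∏ i ∈ t, g i|
        = |(f i - g i) * ∏ i ∈ t, f i + g i * (∏ i ∈ t, f i - ∏ i ∈ t, g i)| := by ring_nf
      _ ≤ |f i - g i| * |∏ i ∈ t, f i| + |g i| * |∏ i ∈ t, f i - ∏ i ∈ t, g i| := by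
          rw [← abs_mul, ← abs_mul]; exact abs_add_le _ _
      _ ≤ |f i - g i| * 1 + 1 * ∑ i ∈ t, |f i - g i| := by
          gcongr
          exact hg i
      _ = _ := by ring

/-- The integer translates of the tent function form a partition of unity. -/
lemma exists_finset_sum_tent (x : ℝ) :
    ∃ s : Finset ℤ, (∀ n ∉ s, tent (x + n) = 0) ∧ ∑ n ∈ s, tent (x + n) = 1 := by
  have h0 := Int.floor_le x
  have h1 := Int.lt_floor_add_one x
  have key : ∑ n ∈ ({-⌊x⌋, -⌊x⌋ - 1} : Finset ℤ), tent (x + n) = 1 := by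
    rw [Finset.sum_pair (by omega)]
    push_cast
    unfold tent
    rw [abs_of_nonneg (by linarith), abs_of_nonpos (by linarith), max_eq_right (by linarith),
      max_eq_right (by linarith)]
    ring
  refine ⟨_, fun n hn => ?_, key⟩
  by_contra h
  have := abs_lt.mp (abs_lt_one_of_tent_ne_zero h)
  refine hn ?_
  have a1 : -⌊x⌋ - 2 < n := by
    have : ((-⌊x⌋ - 2 : ℤ) : ℝ) < n := by push_cast; linarith
    exact_mod_cast this
  have a2 : n < -⌊x⌋ + 1 := by
    have : (n : ℝ) < ((-⌊x⌋ + 1 : ℤ) : ℝ) := by push_cast; linarith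
    exact_mod_cast this
  rw [Finset.mem_insert, Finset.mem_singleton]
  omega

lemma hasSum_prod_tent {κ : Type*} [Fintype κ] (x : κ → ℝ) :
    HasSum (fun n : κ → ℤ => ∏ i, tent (x i + n i)) 1 := by
  classical
  choose s hs0 hs1 using fun i => exists_finset_sum_tent (x i)
  have key : ∑ n ∈ Fintype.piFinset s, ∏ i, tent (x i + n i) = 1 := by
    rw [← Finset.prod_univ_sum s fun i n => tent (x i + n)]
    simp [hs1]
  rw [← key]
  refine hasSum_sum_of_ne_finset_zero fun n hn => ?_
  simp only [Fintype.mem_piFinset, not_forall] at hn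
  obtain ⟨i, hi⟩ := hn
  exact Finset.prod_eq_zero (Finset.mem_univ i) (hs0 i _ hi)

end Tent

section ConeFunction

lemma abs_exp_neg_sub_exp_neg_le {x y q : ℝ} (hx : q ≤ x) (hy : q ≤ y) :
    |Real.exp (-x) - Real.exp (-y)| ≤ |x - y| * Real.exp (-q) := by
  wlog h : x ≤ y generalizing x y
  · rw [abs_sub_comm, abs_sub_comm x]
    exact this hy hx (le_of_not_ge h)
  have h1 : Real.exp (-y) ≤ Real.exp (-x) := Real.exp_le_exp.mpr (by linarith)
  rw [abs_of_nonneg (by linarith), abs_of_nonpos (by linarith)]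
  have h2 : Real.exp (-y) = Real.exp (-x) * Real.exp (-(y - x)) := by
    rw [← Real.exp_add]; ring_nf
  have h3 := Real.add_one_le_exp (-(y - x))
  have h4 : Real.exp (-x) ≤ Real.exp (-q) := Real.exp_le_exp.mpr (by linarith)
  have h5 := Real.exp_pos (-x)
  rw [h2]
  nlinarith

variable {ι κ : Type*} [Fintype κ] (ℓ : κ → (ι → ℝ) →L[ℝ] ℝ)

/-- A product of tent functions of linear forms in the logarithms of the coordinates. -/
noncomputable def logTent (a : ι → ℝ) : ℝ := ∏ i, tent (ℓ i fun w => Real.log (a w))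

lemma logTent_nonneg (a : ι → ℝ) : 0 ≤ logTent ℓ a :=
  Finset.prod_nonneg fun _ _ => tent_nonneg _

lemma logTent_le_one (a : ι → ℝ) : logTent ℓ a ≤ 1 :=
  Finset.prod_le_one (fun _ _ => tent_nonneg _) fun _ _ => tent_le_one _

variable [Fintype ι] (m : ι → ℕ)

open Classical in
/-- A cut-off of the function `a ↦ (∏ w, a w ^ m w) ^ (-s)` to a neighbourhood of a cone. -/
noncomputable def coneFun (s : ℝ) (a : ι → ℝ) : ℝ :=
  if ∀ w, 0 < a w then logTent ℓ a * Real.exp (-(s * ∑ w, m w * Real.log (a w))) else 0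

lemma coneFun_nonneg (s : ℝ) (a : ι → ℝ) : 0 ≤ coneFun ℓ m s a := by
  unfold coneFun
  split_ifs
  · exact mul_nonneg (logTent_nonneg _ _) (Real.exp_pos _).le
  · exact le_rfl

lemma exists_abs_coneFun_sub_le_of_log :
    ∃ Λ : ℝ, 0 ≤ Λ ∧ ∀ s : ℝ, 0 ≤ s → s ≤ 2 → ∀ (a b : ι → ℝ) (δ q : ℝ), (∀ w, 0 < a w) →
      (∀ w, 0 < b w) → 0 ≤ δ → (∀ w, |Real.log (a w) - Real.log (b w)| ≤ δ) →
      q ≤ ∑ w, m w * Real.log (a w) → q ≤ ∑ w, m w * Real.log (b w) →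
      |coneFun ℓ m s a - coneFun ℓ m s b| ≤ Λ * δ * Real.exp (-(s * q)) := by
  refine ⟨∑ i, ‖ℓ i‖ + 2 * ∑ w, (m w : ℝ), by positivity, ?_⟩
  intro s hs0 hs2 a b δ q ha hb hδ hab hqa hqb
  have h1 : |logTent ℓ a - logTent ℓ b| ≤ (∑ i, ‖ℓ i‖) * δ := by
    refine (abs_prod_sub_prod_le _ _ _ (fun i => ?_) (fun i => ?_)).trans ?_
    · rw [abs_of_nonneg (tent_nonneg _)]; exact tent_le_one _
    · rw [abs_of_nonneg (tent_nonneg _)]; exact tent_le_one _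
    rw [Finset.sum_mul]
    refine Finset.sum_le_sum fun i _ => (abs_tent_sub_tent_le _ _).trans ?_
    rw [← map_sub, ← Real.norm_eq_abs]
    refine (ContinuousLinearMap.le_opNorm _ _).trans ?_
    gcongr
    exact (pi_norm_le_iff_of_nonneg hδ).mpr hab
  have h2 : |s * ∑ w, m w * Real.log (a w) - s * ∑ w, m w * Real.log (b w)| ≤
      (2 * ∑ w, (m w : ℝ)) * δ := by
    rw [← mul_sub, abs_mul, abs_of_nonneg hs0, ← Finset.sum_sub_distrib, mul_assoc]
    gcongr
    rw [Finset.sum_mul]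
    refine (Finset.abs_sum_le_sum_abs _ _).trans (Finset.sum_le_sum fun w _ => ?_)
    rw [← mul_sub, abs_mul, Nat.abs_cast]
    gcongr
    exact hab w
  have h3 := abs_exp_neg_sub_exp_neg_le (mul_le_mul_of_nonneg_left hqa hs0)
    (mul_le_mul_of_nonneg_left hqb hs0)
  have h4 : Real.exp (-(s * ∑ w, m w * Real.log (a w))) ≤ Real.exp (-(s * q)) :=
    Real.exp_le_exp.mpr (neg_le_neg (mul_le_mul_of_nonneg_left hqa hs0))
  unfold coneFun
  rw [if_pos ha, if_pos hb]
  set P := Real.exp (-(s * ∑ w, m w * Real.log (a w)))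
  set Q := Real.exp (-(s * ∑ w, m w * Real.log (b w)))
  calc |logTent ℓ a * P - logTent ℓ b * Q|
      = |(logTent ℓ a - logTent ℓ b) * P + logTent ℓ b * (P - Q)| := by ring_nf
    _ ≤ |logTent ℓ a - logTent ℓ b| * P + logTent ℓ b * |P - Q| := by
        refine (abs_add_le _ _).trans ?_
        rw [abs_mul, abs_mul, abs_of_pos (Real.exp_pos _ : 0 < P),
          abs_of_nonneg (logTent_nonneg ℓ b)]
    _ ≤ ((∑ i, ‖ℓ i‖) * δ) * Real.exp (-(s * q)) +
        1 * (((2 * ∑ w, (m w : ℝ)) * δ) * Real.exp (-(s * q))) := by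
        gcongr
        · exact logTent_le_one ℓ b
        · exact h3.trans (mul_le_mul_of_nonneg_right h2 (Real.exp_pos _).le)
    _ = _ := by ring

lemma norm_le_mul_of_logTent_ne_zero {R : ℝ}
    (hR : ∀ v : ι → ℝ, (∀ i, |ℓ i v| < 1) → ∀ w w', v w ≤ v w' + R) {a : ι → ℝ}
    (ha : ∀ w, 0 < a w) (h : logTent ℓ a ≠ 0) (w : ι) : Real.exp (-R) * ‖a‖ ≤ a w := by
  have h1 := hR (fun w => Real.log (a w)) fun i =>
    abs_lt_one_of_tent_ne_zero (Finset.prod_ne_zero_iff.mp h i (Finset.mem_univ i))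
  have h2 : ‖a‖ ≤ a w * Real.exp R := by
    refine (pi_norm_le_iff_of_nonneg (mul_pos (ha w) (Real.exp_pos R)).le).mpr fun w' => ?_
    rw [Real.norm_eq_abs, abs_of_pos (ha w')]
    have := Real.exp_le_exp.mpr (h1 w' w)
    rwa [Real.exp_add, Real.exp_log (ha w), Real.exp_log (ha w')] at this
  rw [Real.exp_neg, inv_mul_le_iff₀ (Real.exp_pos R), mul_comm]
  exact h2

lemma abs_log_sub_log_le {x y z : ℝ} (hz : 0 < z) (hx : z ≤ x) (hy : z ≤ y) :
    |Real.log x - Real.log y| ≤ |x - y| / z := by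
  wlog h : y ≤ x generalizing x y
  · rw [abs_sub_comm, abs_sub_comm x]
    exact this hy hx (le_of_not_ge h)
  have hy0 : 0 < y := hz.trans_le hy
  have h1 : Real.log y ≤ Real.log x := Real.log_le_log hy0 h
  rw [abs_of_nonneg (by linarith), abs_of_nonneg (by linarith), ← Real.log_div (by linarith)
    (by linarith)]
  refine (Real.log_le_sub_one_of_pos (div_pos (hz.trans_le hx) hy0)).trans ?_
  rw [div_sub_one hy0.ne']
  exact div_le_div_of_nonneg_left (by linarith) hz hy

/-- The cut-off function varies slowly far away from the origin. -/
theorem exists_abs_coneFun_sub_le {R : ℝ} (hR0 : 0 ≤ R)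
    (hR : ∀ v : ι → ℝ, (∀ i, |ℓ i v| < 1) → ∀ w w', v w ≤ v w' + R) (ρ : ℝ) (hρ : 0 ≤ ρ) :
    ∃ C X : ℝ, 0 ≤ C ∧ 1 ≤ X ∧ ∀ s : ℝ, 1 ≤ s → s ≤ 2 → ∀ a b : ι → ℝ, (∀ w, 0 ≤ a w) →
      (∀ w, 0 ≤ b w) → ‖a - b‖ ≤ ρ → X ≤ ‖a‖ →
      |coneFun ℓ m s a - coneFun ℓ m s b| ≤ C * (‖a‖ ^ (∑ w, m w + 1))⁻¹ := by
  obtain ⟨Λ, hΛ, hF⟩ := exists_abs_coneFun_sub_le_of_log ℓ m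
  set c := Real.exp (-R) with hc
  have hc0 : 0 < c := Real.exp_pos _
  have hc1 : c ≤ 1 := Real.exp_le_one_iff.mpr (by linarith)
  set d := ∑ w, m w with hd
  -- the case where the first function does not vanish
  have one : ∀ s : ℝ, 1 ≤ s → s ≤ 2 → ∀ a b : ι → ℝ, (∀ w, 0 < a w) → logTent ℓ a ≠ 0 →
      ‖a - b‖ ≤ ρ → ∀ y : ℝ, 1 ≤ y → ρ ≤ y → y ≤ c * ‖a‖ / 2 →
      |coneFun ℓ m s a - coneFun ℓ m s b| ≤ Λ * ρ * (y ^ (d + 1))⁻¹ := by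
    intro s hs1 hs2 a b ha hta hab y hy1 hρy hy
    have hy0 : 0 < y := by linarith
    have h1 : ∀ w, 2 * y ≤ a w := fun w => by
      have := norm_le_mul_of_logTent_ne_zero ℓ hR ha hta w
      linarith
    have h2 : ∀ w, |a w - b w| ≤ ρ := (pi_norm_le_iff_of_nonneg hρ).mp hab
    have h3 : ∀ w, y ≤ b w := fun w => by
      have := (abs_le.mp (h2 w)).2
      linarith [h1 w]
    have h4 := hF s (by linarith) hs2 a b (ρ / y) (d * Real.log y) ha
      (fun w => hy0.trans_le (h3 w)) (by positivity)
      (fun w => (abs_log_sub_log_le hy0 (by linarith [h1 w]) (h3 w)).trans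
        (by gcongr; exact h2 w)) ?_ ?_
    · refine h4.trans ?_
      have h5 : Real.exp (-(s * (d * Real.log y))) ≤ (y ^ d)⁻¹ := by
        have : (y ^ d)⁻¹ = Real.exp (-(d * Real.log y)) := by
          rw [Real.exp_neg, ← Real.log_pow, Real.exp_log (by positivity)]
        rw [this]
        refine Real.exp_le_exp.mpr (neg_le_neg ?_)
        have : 0 ≤ d * Real.log y := mul_nonneg (Nat.cast_nonneg _) (Real.log_nonneg hy1)
        nlinarith
      calc Λ * (ρ / y) * Real.exp (-(s * (d * Real.log y))) ≤ Λ * (ρ / y) * (y ^ d)⁻¹ := by gcongr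
        _ = _ := by rw [pow_succ, mul_inv]; ring
    · rw [hd, Nat.cast_sum, Finset.sum_mul]
      refine Finset.sum_le_sum fun w _ => ?_
      gcongr
      linarith [h1 w]
    · rw [hd, Nat.cast_sum, Finset.sum_mul]
      refine Finset.sum_le_sum fun w _ => ?_
      gcongr
      exact h3 w
  refine ⟨Λ * ρ * ((c / 4) ^ (d + 1))⁻¹, 4 / c * max ρ 1, by positivity, ?_, ?_⟩
  · have : 1 ≤ 4 / c := by rw [le_div_iff₀ hc0]; linarith
    nlinarith [le_max_right ρ 1]
  intro s hs1 hs2 a b ha hb hab hX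
  have hy : max ρ 1 ≤ c / 4 * ‖a‖ := by
    rw [div_mul_eq_mul_div, div_le_iff₀ hc0] at hX
    linarith
  have hy1 := (le_max_right ρ 1).trans hy
  have hyρ := (le_max_left ρ 1).trans hy
  have hres : Λ * ρ * ((c / 4) ^ (d + 1))⁻¹ * (‖a‖ ^ (d + 1))⁻¹ =
      Λ * ρ * ((c / 4 * ‖a‖) ^ (d + 1))⁻¹ := by
    rw [mul_pow, mul_inv]; ring
  rw [hres]
  have hn : 0 ≤ c * ‖a‖ := by positivity
  by_cases h1 : (∀ w, 0 < a w) ∧ logTent ℓ a ≠ 0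
  · exact one s hs1 hs2 a b h1.1 h1.2 hab _ hy1 hyρ (by linarith)
  by_cases h2 : (∀ w, 0 < b w) ∧ logTent ℓ b ≠ 0
  · rw [abs_sub_comm]
    refine one s hs1 hs2 b a h2.1 h2.2 (by rwa [norm_sub_rev]) _ hy1 hyρ ?_
    have h3 : ‖a‖ ≤ ‖b‖ + ρ := by
      have := norm_sub_norm_le a b
      linarith
    have h4 : ‖a‖ / 2 ≤ ‖b‖ := by nlinarith [norm_nonneg a]
    nlinarith
  · have e : ∀ x : ι → ℝ, ¬((∀ w, 0 < x w) ∧ logTent ℓ x ≠ 0) → coneFun ℓ m s x = 0 := by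
      intro x hx
      unfold coneFun
      split_ifs with h
      · have : logTent ℓ x = 0 := by
          by_contra h'
          exact hx ⟨h, h'⟩
        rw [this, zero_mul]
      · rfl
    rw [e a h1, e b h2, sub_zero, abs_zero]
    positivity

end ConeFunction

section UnitCoordinates

open NumberField NumberField.Units NumberField.Units.dirichletUnitTheorem
  NumberField.mixedEmbedding.fundamentalCone

variable (K : Type*) [Field K]

/-- The vector of the absolute values of an algebraic integer at the infinite places. -/
noncomputable def absVec (α : 𝓞 K) (w : InfinitePlace K) : ℝ := w (α : K)

variable {K}

lemma absVec_pos {α : 𝓞 K} (hα : α ≠ 0) (w : InfinitePlace K) : 0 < absVec K α w :=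
  InfinitePlace.pos_iff.mpr (by simpa using hα)

lemma absVec_nonneg (α : 𝓞 K) (w : InfinitePlace K) : 0 ≤ absVec K α w := apply_nonneg _ _

variable [NumberField K]

variable (K) in
open scoped Classical in
/-- The coordinates on the space of logarithms of absolute values, modulo the diagonal, with
respect to a fundamental system of units. -/
noncomputable def unitCoord (i : Fin (rank K)) : (InfinitePlace K → ℝ) →L[ℝ] ℝ :=
  LinearMap.toContinuousLinearMap
    ((((basisUnitLattice K).ofZLatticeBasis ℝ (unitLattice K)).coord i ∘ₗ
      realSpaceToLogSpace) ∘ₗ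
        LinearMap.pi fun w => (w.mult : ℝ) • (LinearMap.proj w : (InfinitePlace K → ℝ) →ₗ[ℝ] ℝ))

open scoped Classical in
lemma unitCoord_apply (i : Fin (rank K)) (v : InfinitePlace K → ℝ) :
    unitCoord K i v = ((basisUnitLattice K).ofZLatticeBasis ℝ (unitLattice K)).repr
      (realSpaceToLogSpace fun w => w.mult * v w) i := rfl

lemma unitCoord_log_unit {ζ : (𝓞 K)ˣ} (hζ : ζ ∈ torsion K) (e : Fin (rank K) → ℤ)
    (i : Fin (rank K)) :
    unitCoord K i (fun w => Real.log (w ((ζ * ∏ j, fundSystem K j ^ e j : (𝓞 K)ˣ) : K))) = e i := by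
  set u := ζ * ∏ j, fundSystem K j ^ e j with hu
  have h1 : realSpaceToLogSpace (fun w : InfinitePlace K => w.mult * Real.log (w (u : K))) =
      logEmbedding K (Additive.ofMul u) := by
    ext w
    rw [realSpaceToLogSpace_apply, sum_mult_mul_log, mul_zero, zero_mul, sub_zero]
    rfl
  have h2 : logEmbedding K (Additive.ofMul u) =
      ((∑ j, e j • basisUnitLattice K j : unitLattice K) : logSpace K) := by
    have h0 : logEmbedding K (Additive.ofMul ζ) = 0 := logEmbedding_eq_zero_iff.mpr hζ
    rw [hu, ofMul_mul, map_add, h0, zero_add, ofMul_prod, map_sum]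
    simp only [ofMul_zpow, map_zsmul, logEmbedding_fundSystem]
    simp
  rw [unitCoord_apply, h1, h2, Module.Basis.ofZLatticeBasis_repr_apply,
    Module.Basis.repr_sum_self]

lemma abs_le_card_mul_of_sum_mul_eq_zero {ι : Type*} [Fintype ι] {m : ι → ℕ} (hm : ∀ w, 0 < m w)
    {w₀ : ι} {x : ι → ℝ} {R : ℝ} (hsum : ∑ w, m w * x w = 0) (hR : 0 ≤ R)
    (hne : ∀ w, w ≠ w₀ → |m w * x w| ≤ R) (w : ι) : |x w| ≤ Fintype.card ι * R := by
  classical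
  have hm1 : (1 : ℝ) ≤ m w := by exact_mod_cast hm w
  have h1 : (1 : ℝ) ≤ Fintype.card ι := by
    exact_mod_cast Fintype.card_pos_iff.mpr ⟨w⟩
  have h2 : |m w * x w| ≤ Fintype.card ι * R := by
    rcases eq_or_ne w w₀ with rfl | hw
    · rw [← Finset.add_sum_erase _ _ (Finset.mem_univ w)] at hsum
      rw [eq_neg_of_add_eq_zero_left hsum, abs_neg]
      refine (Finset.abs_sum_le_sum_abs _ _).trans ?_
      refine (Finset.sum_le_card_nsmul _ _ R fun w' hw' =>
          hne w' (Finset.ne_of_mem_erase hw')).trans ?_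
      rw [nsmul_eq_mul]
      gcongr
      exact_mod_cast Finset.card_le_univ _
    · exact (hne w hw).trans (le_mul_of_one_le_left hR h1)
  rw [abs_mul, Nat.abs_cast] at h2
  exact (le_mul_of_one_le_left (abs_nonneg _) hm1).trans h2

lemma exists_le_add_of_abs_unitCoord_lt :
    ∃ R : ℝ, 0 ≤ R ∧ ∀ v : InfinitePlace K → ℝ, (∀ i, |unitCoord K i v| < 1) →
      ∀ w w', v w ≤ v w' + R := by
  classical
  set B := (basisUnitLattice K).ofZLatticeBasis ℝ (unitLattice K) with hB
  set R₀ : ℝ := ∑ i, ‖B i‖ with hR₀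
  have hR₀0 : 0 ≤ R₀ := by positivity
  set d : ℝ := (Module.finrank ℚ K : ℝ) with hd
  have hd0 : d ≠ 0 := by rw [hd]; exact_mod_cast Module.finrank_pos.ne'
  have hdsum : ∑ w : InfinitePlace K, (w.mult : ℝ) = d := by
    rw [hd, ← InfinitePlace.sum_mult_eq]; push_cast; rfl
  refine ⟨2 * (Fintype.card (InfinitePlace K) * R₀), by positivity, ?_⟩
  intro v hv
  set avg : ℝ := (∑ w : InfinitePlace K, w.mult * v w) * d⁻¹ with havg
  set y : logSpace K := realSpaceToLogSpace fun w : InfinitePlace K => w.mult * v w with hy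
  have hyn : ‖y‖ ≤ R₀ := by
    rw [← B.sum_repr y]
    refine (norm_sum_le _ _).trans (Finset.sum_le_sum fun i _ => ?_)
    rw [norm_smul]
    exact mul_le_of_le_one_left (norm_nonneg _) (hv i).le
  have hne : ∀ w : InfinitePlace K, w ≠ w₀ → |w.mult * (v w - avg)| ≤ R₀ := by
    intro w hw
    have h1 := (norm_le_pi_norm y ⟨w, hw⟩).trans hyn
    rw [hy, realSpaceToLogSpace_apply, Real.norm_eq_abs] at h1
    have h2 : (w.mult : ℝ) * (v w - avg) = w.mult * v w -
        (w.mult * ∑ w' : InfinitePlace K, w'.mult * v w') * (Module.finrank ℚ K : ℝ)⁻¹ := by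
      rw [havg]; ring
    rw [h2]
    exact h1
  have hsum : ∑ w : InfinitePlace K, w.mult * (v w - avg) = 0 := by
    simp only [mul_sub, Finset.sum_sub_distrib, ← Finset.sum_mul, hdsum, havg]
    field_simp
    ring
  have hall : ∀ w : InfinitePlace K, |v w - avg| ≤ Fintype.card (InfinitePlace K) * R₀ :=
    abs_le_card_mul_of_sum_mul_eq_zero (fun w => InfinitePlace.mult_pos) hsum hR₀0 hne
  intro w w'
  have h1 := abs_le.mp (hall w)
  have h2 := abs_le.mp (hall w')
  linarith [h1.2, h2.1]

variable (K) in
/-- The function `coneFun` on algebraic integers attached to a fundamental system of units. -/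
noncomputable def normCone (s : ℝ) (α : 𝓞 K) : ℝ :=
  coneFun (unitCoord K) (fun w : InfinitePlace K => w.mult) s (absVec K α)

lemma normCone_zero (s : ℝ) : normCone K s 0 = 0 := by
  unfold normCone coneFun
  rw [if_neg]
  intro h
  simpa [absVec] using h (Classical.arbitrary _)

lemma normCone_nonneg (s : ℝ) (α : 𝓞 K) : 0 ≤ normCone K s α := coneFun_nonneg _ _ _ _

lemma sum_mult_log_absVec {α : 𝓞 K} (hα : α ≠ 0) :
    ∑ w : InfinitePlace K, w.mult * Real.log (absVec K α w) =
      Real.log (Ideal.absNorm (Ideal.span {α})) := by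
  have h : ((Ideal.absNorm (Ideal.span {α}) : ℕ) : ℝ) =
      ∏ w : InfinitePlace K, w (α : K) ^ w.mult := by
    rw [InfinitePlace.prod_eq_abs_norm, Ideal.absNorm_span_singleton, ← Algebra.coe_norm_int,
      Nat.cast_natAbs]
    push_cast
    rfl
  rw [h, Real.log_prod (fun w _ => (pow_pos (InfinitePlace.pos_iff.mpr (by simpa using hα)) _).ne')]
  simp only [Real.log_pow]
  rfl

lemma normCone_of_ne_zero (s : ℝ) {α : 𝓞 K} (hα : α ≠ 0) :
    normCone K s α = logTent (unitCoord K) (absVec K α) *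
      (Ideal.absNorm (Ideal.span {α}) : ℝ) ^ (-s) := by
  unfold normCone coneFun
  have hpos : (0 : ℝ) < Ideal.absNorm (Ideal.span {α}) := by
    rw [Nat.cast_pos, Nat.pos_iff_ne_zero, Ne, Ideal.absNorm_eq_zero_iff,
      Ideal.span_singleton_eq_bot]
    exact hα
  rw [if_pos (absVec_pos hα), sum_mult_log_absVec hα, Real.rpow_def_of_pos hpos]
  ring_nf

lemma normCone_le_one {s : ℝ} (hs : 0 ≤ s) (α : 𝓞 K) : normCone K s α ≤ 1 := by
  rcases eq_or_ne α 0 with rfl | hα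
  · rw [normCone_zero]; exact zero_le_one
  rw [normCone_of_ne_zero s hα]
  have h1 : (1 : ℝ) ≤ Ideal.absNorm (Ideal.span {α}) := by
    rw [Nat.one_le_cast, Nat.one_le_iff_ne_zero, Ne, Ideal.absNorm_eq_zero_iff,
      Ideal.span_singleton_eq_bot]
    exact hα
  exact mul_le_one₀ (logTent_le_one _ _) (Real.rpow_nonneg (by linarith) _)
    (Real.rpow_le_one_of_one_le_of_nonpos h1 (by linarith))

variable (K) in
/-- The decomposition of the unit group given by a fundamental system of units. -/
noncomputable def unitsEquivTorsionProd : torsion K × (Fin (rank K) → ℤ) ≃ (𝓞 K)ˣ :=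
  Equiv.ofBijective (fun ζe => ζe.1 * ∏ i, fundSystem K i ^ ζe.2 i) <| by
    constructor
    · intro x y h
      exact (exist_unique_eq_mul_prod K _).unique rfl h
    · intro u
      obtain ⟨x, hx, -⟩ := exist_unique_eq_mul_prod K u
      exact ⟨x, hx.symm⟩

lemma unitCoord_log_mul {α : 𝓞 K} (hα : α ≠ 0) (p : torsion K × (Fin (rank K) → ℤ))
    (i : Fin (rank K)) :
    unitCoord K i (fun w => Real.log (absVec K (unitsEquivTorsionProd K p * α) w)) =
      unitCoord K i (fun w => Real.log (absVec K α w)) + p.2 i := by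
  rw [← unitCoord_log_unit p.1.2 p.2 i, ← map_add]
  congr 1
  ext w
  have h : absVec K (unitsEquivTorsionProd K p * α) w =
      absVec K (unitsEquivTorsionProd K p : 𝓞 K) w * absVec K α w := by
    unfold absVec
    rw [← map_mul]
    exact congrArg w (map_mul (algebraMap (𝓞 K) K) _ _)
  rw [Pi.add_apply, h, Real.log_mul (absVec_pos (Units.ne_zero _) w).ne' (absVec_pos hα w).ne',
    add_comm]
  rfl

lemma normCone_unit_mul (s : ℝ) {α : 𝓞 K} (hα : α ≠ 0) (p : torsion K × (Fin (rank K) → ℤ)) :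
    normCone K s (unitsEquivTorsionProd K p * α) =
      (∏ i, tent (unitCoord K i (fun w => Real.log (absVec K α w)) + p.2 i)) *
        (Ideal.absNorm (Ideal.span {α}) : ℝ) ^ (-s) := by
  rw [normCone_of_ne_zero s (mul_ne_zero (Units.ne_zero _) hα),
    Ideal.span_singleton_mul_left_unit (Units.isUnit _)]
  unfold logTent
  simp only [unitCoord_log_mul hα]

lemma hasSum_snd_of_finite {ι G : Type*} [Finite G] {f : ι → ℝ} (hf : HasSum f 1)
    (hf0 : 0 ≤ f) : HasSum (fun p : G × ι => f p.2) (Nat.card G) := by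
  have : Fintype G := Fintype.ofFinite _
  rw [Nat.card_eq_fintype_card]
  have h2 : HasSum (fun _ : G => (1 : ℝ)) (Fintype.card G : ℝ) := by
    simpa using hasSum_fintype (fun _ : G => (1 : ℝ))
  have h3 := h2.mul hf (h2.summable.mul_of_nonneg hf.summable (fun _ => zero_le_one) hf0)
  simpa using h3

lemma hasSum_normCone_units_mul (s : ℝ) {α : 𝓞 K} (hα : α ≠ 0) :
    HasSum (fun u : (𝓞 K)ˣ => normCone K s (u * α))
      (torsionOrder K * (Ideal.absNorm (Ideal.span {α}) : ℝ) ^ (-s)) := by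
  rw [← (unitsEquivTorsionProd K).hasSum_iff]
  refine ((hasSum_snd_of_finite (G := torsion K)
    (hasSum_prod_tent fun i => unitCoord K i fun w => Real.log (absVec K α w))
    fun e => Finset.prod_nonneg fun _ _ => tent_nonneg _).mul_right _).congr_fun ?_
  exact normCone_unit_mul s hα

end UnitCoordinates

section LatticeSums

open NumberField NumberField.Units

/-- An element of a ring is the sum of a fixed representative of its class modulo an ideal and of
an element of the ideal. -/
noncomputable def quotientProdIdealEquiv {A : Type*} [CommRing A] (I : Ideal A) :
    (A ⧸ I) × I ≃ A :=
  Equiv.ofBijective (fun p => p.1.out + p.2) <| by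
    have hmk : ∀ p : (A ⧸ I) × I, Ideal.Quotient.mk I (p.1.out + p.2) = p.1 := fun p => by
      rw [map_add, Ideal.Quotient.eq_zero_iff_mem.mpr p.2.2, add_zero]
      exact Quotient.out_eq _
    constructor
    · intro p p' h
      have h1 : p.1 = p'.1 := by
        rw [← hmk p, ← hmk p']
        exact congrArg _ h
      refine Prod.ext h1 (Subtype.ext ?_)
      simp only [h1] at h
      exact add_left_cancel h
    · intro a
      refine ⟨⟨Ideal.Quotient.mk I a, ⟨a - (Ideal.Quotient.mk I a).out, ?_⟩⟩, by simp⟩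
      rw [← Ideal.Quotient.eq_zero_iff_mem, map_sub, sub_eq_zero]
      exact (Quotient.out_eq (Ideal.Quotient.mk I a)).symm

lemma abs_tsum_sub_card_mul_tsum_le {A : Type*} [CommRing A] (I : Ideal A) [Finite (A ⧸ I)]
    {F G : A → ℝ} (hF : Summable F) (hG : Summable G) (hG0 : 0 ≤ G)
    (h : ∀ (q : A ⧸ I) (b : A), |F (q.out + b) - F b| ≤ G b) :
    |∑' a, F a - Nat.card (A ⧸ I) * ∑' b : I, F b| ≤ Nat.card (A ⧸ I) * ∑' a, G a := by
  have : Fintype (A ⧸ I) := Fintype.ofFinite _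
  have hFI : Summable fun b : I => F b := hF.subtype _
  have hGI : Summable fun b : I => G b := hG.subtype _
  have hFe : Summable fun p : (A ⧸ I) × I => F (p.1.out + p.2) :=
    (quotientProdIdealEquiv I).summable_iff.mpr hF
  have hFq : ∀ q : A ⧸ I, Summable fun b : I => F (q.out + b) := fun q => hFe.prod_factor q
  have h1 : ∑' a, F a = ∑ q : A ⧸ I, ∑' b : I, F (q.out + b) := by
    rw [← (quotientProdIdealEquiv I).tsum_eq F]
    change ∑' p : (A ⧸ I) × I, F (p.1.out + p.2) = _
    rw [hFe.tsum_prod, tsum_fintype]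
  have h2 : (Nat.card (A ⧸ I) : ℝ) * ∑' b : I, F b = ∑ q : A ⧸ I, ∑' b : I, F b := by
    rw [Finset.sum_const, nsmul_eq_mul, Nat.card_eq_fintype_card]; rfl
  have h3 : (Nat.card (A ⧸ I) : ℝ) * ∑' a, G a = ∑ q : A ⧸ I, ∑' a, G a := by
    rw [Finset.sum_const, nsmul_eq_mul, Nat.card_eq_fintype_card]; rfl
  rw [h1, h2, h3, ← Finset.sum_sub_distrib]
  refine (Finset.abs_sum_le_sum_abs _ _).trans (Finset.sum_le_sum fun q _ => ?_)
  rw [← (hFq q).tsum_sub hFI]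
  have hs : Summable fun b : I => |F (q.out + b) - F b| :=
    Summable.of_nonneg_of_le (fun _ => abs_nonneg _) (fun b => h q b) hGI
  calc |∑' b : I, (F (q.out + b) - F b)| ≤ ∑' b : I, |F (q.out + b) - F b| := by
        simpa only [Real.norm_eq_abs] using
          norm_tsum_le_tsum_norm (f := fun b : I => F (q.out + b) - F b) hs
    _ ≤ ∑' b : I, G b := hs.tsum_le_tsum (fun b => h q b) hGI
    _ ≤ ∑' a, G a := hG.tsum_subtype_le G (I : Set A) hG0

variable {K : Type*} [Field K] [NumberField K]

open scoped Classical in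
lemma norm_absVec (α : 𝓞 K) : ‖absVec K α‖ = ‖mixedEmbedding K (α : K)‖ := by
  rw [mixedEmbedding.norm_eq_sup'_normAtPlace]
  simp only [mixedEmbedding.normAtPlace_apply]
  refine le_antisymm ?_ ?_
  · refine (pi_norm_le_iff_of_nonempty _).mpr fun w => ?_
    rw [Real.norm_eq_abs, abs_of_nonneg (absVec_nonneg α w)]
    exact Finset.le_sup' (fun w : InfinitePlace K => w (α : K)) (Finset.mem_univ w)
  · refine Finset.sup'_le _ _ fun w _ => ?_
    exact (le_abs_self _).trans (norm_le_pi_norm (absVec K α) w)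

lemma norm_absVec_pos {α : 𝓞 K} (hα : α ≠ 0) : 0 < ‖absVec K α‖ :=
  (absVec_pos hα (Classical.arbitrary _)).trans_le
    ((le_abs_self _).trans (norm_le_pi_norm (absVec K α) _))

lemma norm_absVec_add_sub_le (α β : 𝓞 K) :
    ‖absVec K (α + β) - absVec K β‖ ≤ ‖absVec K α‖ := by
  refine (pi_norm_le_iff_of_nonneg (norm_nonneg _)).mpr fun w => ?_
  refine le_trans ?_ (norm_le_pi_norm (absVec K α) w)
  rw [Pi.sub_apply, Real.norm_eq_abs, Real.norm_eq_abs, abs_of_nonneg (absVec_nonneg α w)]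
  change |w ((α + β : 𝓞 K) : K) - w (β : K)| ≤ w (α : K)
  rw [RingOfIntegers.coe_eq_algebraMap, map_add]
  simp only [← InfinitePlace.norm_embedding_eq, map_add]
  refine (abs_norm_sub_norm_le _ _).trans_eq ?_
  rw [add_sub_cancel_right]

open scoped Classical in
lemma summable_norm_absVec_rpow {r : ℝ} (hr : r < -Module.finrank ℚ K) :
    Summable fun α : 𝓞 K => ‖absVec K α‖ ^ r := by
  have h1 : Module.finrank ℤ (mixedEmbedding.integerLattice K) = Module.finrank ℚ K := by
    rw [ZLattice.rank ℝ, mixedEmbedding.finrank]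
  have h2 := ZLattice.summable_norm_rpow (mixedEmbedding.integerLattice K) r (by rwa [h1])
  have h3 : Function.Injective (fun α : 𝓞 K =>
      (⟨mixedEmbedding K (α : K), ⟨α, rfl⟩⟩ : mixedEmbedding.integerLattice K)) := by
    intro α β h
    exact RingOfIntegers.coe_injective (mixedEmbedding_injective K (congrArg Subtype.val h))
  refine (h2.comp_injective h3).congr fun α => ?_
  rw [norm_absVec]
  rfl

lemma exists_normCone_le :
    ∃ C : ℝ, ∀ s : ℝ, 0 ≤ s → ∀ α : 𝓞 K,
      normCone K s α ≤ Real.exp (s * C) * ‖absVec K α‖ ^ (-(Module.finrank ℚ K * s)) := by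
  obtain ⟨R, hR0, hR⟩ := exists_le_add_of_abs_unitCoord_lt (K := K)
  refine ⟨Module.finrank ℚ K * R, fun s hs α => ?_⟩
  have hnn : 0 ≤ Real.exp (s * (Module.finrank ℚ K * R)) *
      ‖absVec K α‖ ^ (-(Module.finrank ℚ K * s)) := by positivity
  rcases eq_or_ne α 0 with rfl | hα
  · rwa [normCone_zero]
  by_cases ht : logTent (unitCoord K) (absVec K α) = 0
  · rwa [normCone_of_ne_zero s hα, ht, zero_mul]
  have h1 : ∀ w, Real.log ‖absVec K α‖ - R ≤ Real.log (absVec K α w) := by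
    intro w
    have h2 := norm_le_mul_of_logTent_ne_zero (unitCoord K) hR (absVec_pos hα) ht w
    have h3 := Real.log_le_log (mul_pos (Real.exp_pos _) (norm_absVec_pos hα)) h2
    rw [Real.log_mul (Real.exp_ne_zero _) (norm_absVec_pos hα).ne', Real.log_exp] at h3
    linarith
  have h2 : Module.finrank ℚ K * (Real.log ‖absVec K α‖ - R) ≤
      ∑ w : InfinitePlace K, w.mult * Real.log (absVec K α w) := by
    rw [← InfinitePlace.sum_mult_eq, Nat.cast_sum, Finset.sum_mul]
    exact Finset.sum_le_sum fun w _ => mul_le_mul_of_nonneg_left (h1 w) (Nat.cast_nonneg _)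
  unfold normCone coneFun
  rw [if_pos (absVec_pos hα), Real.rpow_def_of_pos (norm_absVec_pos hα), ← Real.exp_add]
  refine (mul_le_of_le_one_left (Real.exp_pos _).le (logTent_le_one _ _)).trans ?_
  rw [Real.exp_le_exp]
  nlinarith [mul_le_mul_of_nonneg_left h2 hs]

lemma summable_normCone {s : ℝ} (hs : 1 < s) : Summable (normCone K s) := by
  obtain ⟨C, hC⟩ := exists_normCone_le (K := K)
  refine Summable.of_nonneg_of_le (normCone_nonneg s) (hC s (by linarith)) ?_
  refine (summable_norm_absVec_rpow ?_).mul_left _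
  have : (0 : ℝ) < Module.finrank ℚ K := by exact_mod_cast Module.finrank_pos
  nlinarith

lemma exists_abs_tsum_normCone_sub_le (I : Ideal (𝓞 K)) (hI : I ≠ ⊥) :
    ∃ C : ℝ, ∀ s : ℝ, 1 < s → s ≤ 2 →
      |∑' α, normCone K s α - Ideal.absNorm I * ∑' β : I, normCone K s β| ≤ C := by
  have : Finite (𝓞 K ⧸ I) := Ideal.finiteQuotientOfFreeOfNeBot I hI
  obtain ⟨R, hR0, hR⟩ := exists_le_add_of_abs_unitCoord_lt (K := K)
  have : Fintype (𝓞 K ⧸ I) := Fintype.ofFinite _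
  set ρ : ℝ := ∑ q : 𝓞 K ⧸ I, ‖absVec K q.out‖ with hρ
  have hρ0 : 0 ≤ ρ := by positivity
  obtain ⟨C, X, hC, hX, hCX⟩ := exists_abs_coneFun_sub_le (unitCoord K)
    (fun w : InfinitePlace K => w.mult) hR0 hR ρ hρ0
  rw [InfinitePlace.sum_mult_eq] at hCX
  set d := Module.finrank ℚ K with hd
  classical
  set G : 𝓞 K → ℝ := fun β => (C + X ^ (d + 1)) * (‖absVec K β‖ ^ (d + 1))⁻¹ +
    if β = 0 then 1 else 0 with hG
  have hG0 : 0 ≤ G := by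
    intro β
    have hX0 : 0 ≤ X := by linarith
    simp only [hG, Pi.zero_apply]
    positivity
  have hGs : Summable G := by
    refine Summable.add (Summable.mul_left _ ?_) ?_
    · refine (summable_norm_absVec_rpow (r := -((d + 1 : ℕ) : ℝ)) ?_).congr fun β => ?_
      · push_cast; linarith
      · rw [Real.rpow_neg (norm_nonneg _), Real.rpow_natCast]
    · exact summable_of_hasFiniteSupport (Set.Finite.subset (Set.finite_singleton 0) fun β hβ => by
        by_contra h; simp_all)
  refine ⟨Nat.card (𝓞 K ⧸ I) * ∑' a, G a, fun s hs1 hs2 => ?_⟩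
  have hcard : (Ideal.absNorm I : ℝ) = Nat.card (𝓞 K ⧸ I) := by
    rw [Ideal.absNorm_apply, Submodule.cardQuot_apply]
  rw [hcard]
  refine abs_tsum_sub_card_mul_tsum_le I (summable_normCone hs1) hGs hG0 fun q b => ?_
  have hle1 : |normCone K s (q.out + b) - normCone K s b| ≤ 1 := by
    have h1 := normCone_le_one (K := K) (s := s) (by linarith) (q.out + b)
    have h2 := normCone_le_one (K := K) (s := s) (by linarith) b
    have h3 := normCone_nonneg (K := K) s (q.out + b)
    have h4 := normCone_nonneg (K := K) s b
    rw [abs_le]; constructor <;> linarith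
  have hX0 : 0 ≤ X := by linarith
  by_cases hb : b = 0
  · refine hle1.trans ?_
    simp only [hG, if_pos hb]
    have : 0 ≤ (C + X ^ (d + 1)) * (‖absVec K b‖ ^ (d + 1))⁻¹ := by positivity
    linarith
  have hbn := norm_absVec_pos hb
  simp only [hG, if_neg hb, add_zero]
  by_cases hbX : X ≤ ‖absVec K b‖
  · rw [abs_sub_comm]
    refine (hCX s hs1.le hs2 (absVec K b) (absVec K (q.out + b)) (absVec_nonneg b)
      (absVec_nonneg _) ?_ hbX).trans ?_
    · rw [norm_sub_rev]
      refine (norm_absVec_add_sub_le _ _).trans ?_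
      exact Finset.single_le_sum (f := fun q : 𝓞 K ⧸ I => ‖absVec K q.out‖)
        (fun _ _ => norm_nonneg _) (Finset.mem_univ q)
    · gcongr
      linarith [pow_nonneg hX0 (d + 1)]
  · refine hle1.trans ?_
    rw [← div_eq_mul_inv, le_div_iff₀ (by positivity), one_mul]
    have := pow_le_pow_left₀ hbn.le (not_le.mp hbX).le (d + 1)
    linarith

end LatticeSums

section ClassZeta

open NumberField NumberField.Units nonZeroDivisors

variable {K : Type*} [Field K] [NumberField K]

lemma absNorm_pos (I : (Ideal (𝓞 K))⁰) : 0 < Ideal.absNorm (I : Ideal (𝓞 K)) := by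
  rw [Nat.pos_iff_ne_zero, Ne, Ideal.absNorm_eq_zero_iff]
  exact nonZeroDivisors.coe_ne_zero I

lemma exists_span_eq_mul {c : ClassGroup (𝓞 K)} {J : (Ideal (𝓞 K))⁰} (hJ : ClassGroup.mk0 J = c⁻¹)
    (I : {I : (Ideal (𝓞 K))⁰ // ClassGroup.mk0 I = c}) :
    ∃ α : 𝓞 K, α ≠ 0 ∧ Ideal.span {α} = (I.1 : Ideal (𝓞 K)) * J := by
  have h : ClassGroup.mk0 (I.1 * J) = 1 := by rw [map_mul, hJ, I.2, mul_inv_cancel]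
  obtain ⟨α, hα⟩ := (ClassGroup.mk0_eq_one_iff (I.1 * J).2).mp h
  refine ⟨α, ?_, hα.symm⟩
  rintro rfl
  refine nonZeroDivisors.coe_ne_zero (I.1 * J) ?_
  simpa using hα

lemma exists_mul_eq_span {c : ClassGroup (𝓞 K)} {J : (Ideal (𝓞 K))⁰}
    (hJ : ClassGroup.mk0 J = c⁻¹) {β : 𝓞 K} (hβ : β ∈ (J : Ideal (𝓞 K))) (hβ0 : β ≠ 0) :
    ∃ I : {I : (Ideal (𝓞 K))⁰ // ClassGroup.mk0 I = c},
      (I.1 : Ideal (𝓞 K)) * J = Ideal.span {β} := by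
  obtain ⟨I, hI⟩ := Ideal.dvd_iff_le.mpr ((Ideal.span_singleton_le_iff_mem _).mpr hβ)
  have hI0 : I ∈ (Ideal (𝓞 K))⁰ := by
    refine mem_nonZeroDivisors_of_ne_zero ?_
    rintro rfl
    rw [mul_zero] at hI
    exact hβ0 (Ideal.span_singleton_eq_bot.mp hI)
  lift I to (Ideal (𝓞 K))⁰ using hI0
  have h1 : ClassGroup.mk0 (J * I) = 1 := by
    refine (ClassGroup.mk0_eq_one_iff (J * I).2).mpr ⟨β, ?_⟩
    rw [Ideal.submodule_span_eq, hI]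
    rfl
  have h2 : ClassGroup.mk0 I = c := by
    rw [map_mul, hJ, inv_mul_eq_one] at h1
    exact h1.symm
  exact ⟨⟨I, h2⟩, by rw [hI, mul_comm]⟩

lemma tsum_eq_tsum_tsum_fiber {A B : Type*} (p : A → B) {f : A → ℝ} (hf : Summable f) :
    ∑' a, f a = ∑' b, ∑' a : {a // p a = b}, f a := by
  rw [← (Equiv.sigmaFiberEquiv p).tsum_eq]
  exact ((Equiv.sigmaFiberEquiv p).summable_iff.mpr hf).tsum_sigma

lemma hasSum_normCone_of_span {ι : Type*} {J : Ideal (𝓞 K)} (hJ : J ≠ ⊥) {I : ι → Ideal (𝓞 K)}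
    (hI : Function.Injective I) (hspan : ∀ i, ∃ α : 𝓞 K, α ≠ 0 ∧ Ideal.span {α} = I i * J)
    (hsurj : ∀ β ∈ J, β ≠ 0 → ∃ i, I i * J = Ideal.span {β}) {s : ℝ} (hs : 1 < s) :
    HasSum (fun i => torsionOrder K * (Ideal.absNorm (I i) * Ideal.absNorm J : ℝ) ^ (-s))
      (∑' β : J, normCone K s β) := by
  choose α hα0 hα using hspan
  have hmem : ∀ p : ι × (𝓞 K)ˣ, (p.2 : 𝓞 K) * α p.1 ∈ J := fun p => by
    refine Ideal.mul_mem_left _ _ ((Ideal.mul_le_right : I p.1 * J ≤ J) ?_)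
    rw [← hα p.1]
    exact Ideal.mem_span_singleton_self _
  have hg : ∀ p : ι × (𝓞 K)ˣ, Ideal.span {(p.2 : 𝓞 K) * α p.1} = I p.1 * J := fun p => by
    rw [← hα p.1]
    exact Ideal.span_singleton_mul_left_unit p.2.isUnit _
  have hinj : Function.Injective fun p : ι × (𝓞 K)ˣ => (⟨_, hmem p⟩ : J) := by
    rintro ⟨i, u⟩ ⟨i', u'⟩ h
    have h3 : (u : 𝓞 K) * α i = u' * α i' := congrArg Subtype.val h
    have h1 : I i * J = I i' * J := by rw [← hg (i, u), ← hg (i', u'), h3]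
    obtain rfl : i = i' := hI (mul_right_cancel₀ hJ h1)
    rw [Units.ext (mul_right_cancel₀ (hα0 i) h3)]
  have hzero : ∀ β : J, β ∉ Set.range (fun p : ι × (𝓞 K)ˣ => (⟨_, hmem p⟩ : J)) →
      normCone K s β = 0 := by
    intro β hβ
    by_cases hβ0 : (β : 𝓞 K) = 0
    · rw [hβ0, normCone_zero]
    refine absurd ?_ hβ
    obtain ⟨i, hi⟩ := hsurj β β.2 hβ0
    obtain ⟨u, hu⟩ : Associated (α i) (β : 𝓞 K) := by
      rw [← Ideal.span_singleton_eq_span_singleton, hα i, hi]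
    exact ⟨(i, u), Subtype.ext (by rw [← hu, mul_comm])⟩
  have hsum : Summable fun β : J => normCone K s β := (summable_normCone hs).subtype _
  have h1 : HasSum (fun p : ι × (𝓞 K)ˣ => normCone K s (p.2 * α p.1))
      (∑' β : J, normCone K s β) := (hinj.hasSum_iff hzero).mpr hsum.hasSum
  have h2 : ∀ i, HasSum (fun u : (𝓞 K)ˣ => normCone K s (u * α i))
      (torsionOrder K * (Ideal.absNorm (I i) * Ideal.absNorm J : ℝ) ^ (-s)) := fun i => by
    have h3 := hasSum_normCone_units_mul s (hα0 i)
    rw [hα i, map_mul, Nat.cast_mul] at h3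
    exact h3
  exact h1.prod_fiberwise h2

lemma hasSum_class {c : ClassGroup (𝓞 K)} {J : (Ideal (𝓞 K))⁰} (hJ : ClassGroup.mk0 J = c⁻¹)
    {s : ℝ} (hs : 1 < s) :
    HasSum (fun I : {I : (Ideal (𝓞 K))⁰ // ClassGroup.mk0 I = c} =>
        torsionOrder K *
          (Ideal.absNorm (I.1 : Ideal (𝓞 K)) * Ideal.absNorm (J : Ideal (𝓞 K)) : ℝ) ^ (-s))
      (∑' β : (J : Ideal (𝓞 K)), normCone K s β) :=
  hasSum_normCone_of_span (nonZeroDivisors.coe_ne_zero J)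
    (Subtype.val_injective.comp Subtype.val_injective) (exists_span_eq_mul hJ)
    (fun _ => exists_mul_eq_span hJ) hs

/-- The partial zeta function of an ideal class. -/
noncomputable def classZeta (c : ClassGroup (𝓞 K)) (s : ℝ) : ℝ :=
  ∑' I : {I : (Ideal (𝓞 K))⁰ // ClassGroup.mk0 I = c},
    (Ideal.absNorm (I.1 : Ideal (𝓞 K)) : ℝ) ^ (-s)

lemma summable_class (c : ClassGroup (𝓞 K)) {s : ℝ} (hs : 1 < s) :
    Summable fun I : {I : (Ideal (𝓞 K))⁰ // ClassGroup.mk0 I = c} =>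
      (Ideal.absNorm (I.1 : Ideal (𝓞 K)) : ℝ) ^ (-s) := by
  obtain ⟨J, hJ⟩ := ClassGroup.mk0_surjective c⁻¹
  have hJ0 : (0 : ℝ) < Ideal.absNorm (J : Ideal (𝓞 K)) := by exact_mod_cast absNorm_pos J
  have h0 : (torsionOrder K : ℝ) ≠ 0 := by exact_mod_cast torsionOrder_ne_zero K
  refine ((hasSum_class hJ hs).summable.mul_left ((torsionOrder K : ℝ)⁻¹ *
    (Ideal.absNorm (J : Ideal (𝓞 K)) : ℝ) ^ s)).congr fun I => ?_
  rw [Real.mul_rpow (Nat.cast_nonneg _) hJ0.le, Real.rpow_neg hJ0.le s]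
  have := (Real.rpow_pos_of_pos hJ0 s).ne'
  field_simp

lemma tsum_normCone_eq {c : ClassGroup (𝓞 K)} {J : (Ideal (𝓞 K))⁰} (hJ : ClassGroup.mk0 J = c⁻¹)
    {s : ℝ} (hs : 1 < s) :
    ∑' β : (J : Ideal (𝓞 K)), normCone K s β =
      torsionOrder K * (Ideal.absNorm (J : Ideal (𝓞 K)) : ℝ) ^ (-s) * classZeta c s := by
  rw [← (hasSum_class hJ hs).tsum_eq, classZeta, ← tsum_mul_left]
  refine tsum_congr fun I => ?_
  rw [Real.mul_rpow (Nat.cast_nonneg _) (Nat.cast_nonneg _)]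
  ring

lemma classZeta_nonneg (c : ClassGroup (𝓞 K)) (s : ℝ) : 0 ≤ classZeta c s :=
  tsum_nonneg fun _ => Real.rpow_nonneg (Nat.cast_nonneg _) _

lemma summable_of_abs_le_absNorm_rpow {f : (Ideal (𝓞 K))⁰ → ℝ} {s : ℝ} (hs : 1 < s)
    (hf : ∀ I, |f I| ≤ (Ideal.absNorm (I : Ideal (𝓞 K)) : ℝ) ^ (-s)) : Summable f := by
  refine Summable.of_norm_bounded (g := fun I => (Ideal.absNorm (I : Ideal (𝓞 K)) : ℝ) ^ (-s)) ?_ hf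
  rw [← (Equiv.sigmaFiberEquiv (ClassGroup.mk0 (R := 𝓞 K))).summable_iff]
  refine (summable_sigma_of_nonneg fun _ => Real.rpow_nonneg (Nat.cast_nonneg _) _).mpr
    ⟨fun c => summable_class c hs, ?_⟩
  exact .of_finite

lemma tsum_eq_sum_classZeta (χ : ClassGroup (𝓞 K) → ℝ) {s : ℝ} (hs : 1 < s) :
    ∑' I : (Ideal (𝓞 K))⁰, χ (ClassGroup.mk0 I) * (Ideal.absNorm (I : Ideal (𝓞 K)) : ℝ) ^ (-s) =
      ∑ c, χ c * classZeta c s := by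
  have hsum : Summable fun I : (Ideal (𝓞 K))⁰ =>
      χ (ClassGroup.mk0 I) * (Ideal.absNorm (I : Ideal (𝓞 K)) : ℝ) ^ (-s) := by
    have h1 := (summable_of_abs_le_absNorm_rpow (K := K) hs
      (f := fun I => (Ideal.absNorm (I : Ideal (𝓞 K)) : ℝ) ^ (-s)) fun I => (abs_of_nonneg
        (Real.rpow_nonneg (Nat.cast_nonneg _) _)).le).mul_left (∑ c, |χ c|)
    refine Summable.of_norm_bounded h1 fun I => ?_
    rw [norm_mul, Real.norm_eq_abs, Real.norm_eq_abs,
      abs_of_nonneg (Real.rpow_nonneg (Nat.cast_nonneg _) (-s))]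
    gcongr
    exact Finset.single_le_sum (f := fun c => |χ c|) (fun _ _ => abs_nonneg _) (Finset.mem_univ _)
  rw [tsum_eq_tsum_tsum_fiber (ClassGroup.mk0 (R := 𝓞 K)) hsum, tsum_fintype]
  refine Finset.sum_congr rfl fun c _ => ?_
  rw [classZeta, ← tsum_mul_left]
  refine tsum_congr fun I => ?_
  rw [I.2]

variable (K) in
/-- The Dedekind zeta function on the real half-line `1 < s`, as a sum over ideals. -/
noncomputable def idealZeta (s : ℝ) : ℝ :=
  ∑' I : (Ideal (𝓞 K))⁰, (Ideal.absNorm (I : Ideal (𝓞 K)) : ℝ) ^ (-s)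

lemma summable_absNorm_rpow {s : ℝ} (hs : 1 < s) :
    Summable fun I : (Ideal (𝓞 K))⁰ => (Ideal.absNorm (I : Ideal (𝓞 K)) : ℝ) ^ (-s) :=
  summable_of_abs_le_absNorm_rpow hs fun _ => (abs_of_nonneg
    (Real.rpow_nonneg (Nat.cast_nonneg _) _)).le

lemma classZeta_le_idealZeta (c : ClassGroup (𝓞 K)) {s : ℝ} (hs : 1 < s) :
    classZeta c s ≤ idealZeta K s :=
  (summable_absNorm_rpow hs).tsum_subtype_le _ {I | ClassGroup.mk0 I = c}
    fun _ => Real.rpow_nonneg (Nat.cast_nonneg _) _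

lemma dedekindZeta_eq_idealZeta {s : ℝ} (hs : 1 < s) : dedekindZeta K s = idealZeta K s := by
  have h1 : Summable fun I : (Ideal (𝓞 K))⁰ =>
    (Ideal.absNorm (I : Ideal (𝓞 K)) : ℝ) ^ (-s) := summable_absNorm_rpow hs
  set N : (Ideal (𝓞 K))⁰ → ℕ := fun I => Ideal.absNorm (I : Ideal (𝓞 K)) with hN
  have hfib : ∀ n : ℕ, n ≠ 0 → Nat.card {I : Ideal (𝓞 K) // Ideal.absNorm I = n} =
      Nat.card {I : (Ideal (𝓞 K))⁰ // N I = n} := by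
    intro n hn
    refine Nat.card_congr ⟨fun I => ⟨⟨I.1, mem_nonZeroDivisors_of_ne_zero ?_⟩, I.2⟩,
      fun I => ⟨I.1.1, I.2⟩, fun _ => rfl, fun _ => rfl⟩
    intro h
    refine hn ?_
    rw [← I.2, h]
    exact Ideal.absNorm_bot
  rw [idealZeta, tsum_eq_tsum_tsum_fiber N h1, Complex.ofReal_tsum]
  refine tsum_congr fun n => ?_
  have h2 : ∀ I : {I : (Ideal (𝓞 K))⁰ // N I = n},
      (Ideal.absNorm ((I.1 : (Ideal (𝓞 K))⁰) : Ideal (𝓞 K)) : ℝ) ^ (-s) =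
        (n : ℝ) ^ (-s) := fun I => by
    rw [show Ideal.absNorm ((I.1 : (Ideal (𝓞 K))⁰) : Ideal (𝓞 K)) = n from I.2]
  rw [tsum_congr h2, tsum_const]
  rcases eq_or_ne n 0 with rfl | hn
  · have : IsEmpty {I : (Ideal (𝓞 K))⁰ // N I = 0} := ⟨fun I => (absNorm_pos I.1).ne' I.2⟩
    simp
  rw [LSeries.term_of_ne_zero hn, hfib n hn, nsmul_eq_mul]
  push_cast
  rw [Complex.ofReal_cpow (Nat.cast_nonneg _), div_eq_mul_inv, ← Complex.cpow_neg]
  push_cast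
  rfl

lemma tendsto_sub_one_mul_idealZeta :
    Filter.Tendsto (fun s : ℝ => (s - 1) * idealZeta K s) (nhdsWithin 1 (Set.Ioi 1))
      (nhds (dedekindZeta_residue K)) := by
  have h1 := tendsto_sub_one_mul_dedekindZeta_nhdsGT K
  have h2 : Filter.Tendsto (fun s : ℝ => (((s - 1) * idealZeta K s : ℝ) : ℂ))
      (nhdsWithin 1 (Set.Ioi 1)) (nhds ((dedekindZeta_residue K : ℝ) : ℂ)) := by
    refine Filter.Tendsto.congr' ?_ h1
    filter_upwards [self_mem_nhdsWithin] with s hs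
    rw [dedekindZeta_eq_idealZeta hs]
    push_cast
    ring
  exact (Complex.continuous_re.tendsto _).comp h2

end ClassZeta

section ClassZetaBounded

open NumberField NumberField.Units nonZeroDivisors Filter Topology

variable {K : Type*} [Field K] [NumberField K]

variable (K) in
lemma eventually_sub_one_mul_idealZeta_le :
    ∃ C, ∀ᶠ s in 𝓝[>] (1 : ℝ), (s - 1) * idealZeta K s ≤ C :=
  ⟨_, (tendsto_sub_one_mul_idealZeta (K := K)).eventually_le_const (lt_add_one _)⟩

lemma one_sub_rpow_one_sub_le {x s : ℝ} (hx : 0 < x) :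
    1 - x ^ (1 - s) ≤ (s - 1) * Real.log x := by
  rw [Real.rpow_def_of_pos hx]
  linarith [Real.add_one_le_exp (Real.log x * (1 - s))]

lemma exists_eventually_abs_classZeta_sub_le (c : ClassGroup (𝓞 K)) :
    ∃ C, ∀ᶠ s in 𝓝[>] (1 : ℝ), |classZeta c s - classZeta (K := K) 1 s| ≤ C := by
  obtain ⟨J, hJ⟩ := ClassGroup.mk0_surjective c⁻¹
  obtain ⟨C₁, h₁⟩ := exists_abs_tsum_normCone_sub_le (K := K) _
    (nonZeroDivisors.coe_ne_zero (1 : (Ideal (𝓞 K))⁰))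
  obtain ⟨C₂, h₂⟩ := exists_abs_tsum_normCone_sub_le (K := K) _ (nonZeroDivisors.coe_ne_zero J)
  obtain ⟨C₃, h₃⟩ := eventually_sub_one_mul_idealZeta_le K
  set N : ℝ := (Ideal.absNorm (J : Ideal (𝓞 K)) : ℝ) with hN
  have hN1 : 1 ≤ N := Nat.one_le_cast.mpr (absNorm_pos J)
  have hN0 : 0 < N := by positivity
  have hw : (1 : ℝ) ≤ torsionOrder K := by
    exact_mod_cast Nat.one_le_iff_ne_zero.mpr (torsionOrder_ne_zero K)
  refine ⟨C₁ + C₂ + Real.log N * C₃, ?_⟩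
  filter_upwards [h₃, Ioo_mem_nhdsGT one_lt_two] with s h₃ hs
  have e₁ := h₁ s hs.1 hs.2.le
  have e₂ := h₂ s hs.1 hs.2.le
  rw [tsum_normCone_eq (by rw [map_one, inv_one]) hs.1] at e₁
  rw [tsum_normCone_eq hJ hs.1, ← hN] at e₂
  have hone : Ideal.absNorm ((1 : (Ideal (𝓞 K))⁰) : Ideal (𝓞 K)) = 1 := by
    rw [Submonoid.coe_one, map_one]
  rw [hone, Nat.cast_one, Real.one_rpow, one_mul, mul_one] at e₁
  have hpow : N * N ^ (-s) = N ^ (1 - s) := by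
    rw [sub_eq_add_neg, Real.rpow_add hN0, Real.rpow_one]
  have e₃ : N * (torsionOrder K * N ^ (-s) * classZeta c s) =
      torsionOrder K * (N ^ (1 - s) * classZeta c s) := by
    rw [← hpow]
    ring
  rw [e₃] at e₂
  have e₄ : |N ^ (1 - s) * classZeta c s - classZeta (K := K) 1 s| ≤ C₁ + C₂ := by
    have : |(torsionOrder K : ℝ) *
        (N ^ (1 - s) * classZeta c s - classZeta (K := K) 1 s)| ≤ C₁ + C₂ := by
      rw [abs_le] at e₁ e₂ ⊢
      constructor <;> linarith [e₁.1, e₁.2, e₂.1, e₂.2]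
    rw [abs_mul, abs_of_nonneg (by positivity)] at this
    exact (le_mul_of_one_le_left (abs_nonneg _) hw).trans this
  have hle : N ^ (1 - s) ≤ 1 := Real.rpow_le_one_of_one_le_of_nonpos hN1 (by linarith [hs.1])
  have hc0 := classZeta_nonneg c s
  have hlog : 0 ≤ Real.log N := Real.log_nonneg hN1
  have e₅ : (1 - N ^ (1 - s)) * classZeta c s ≤ Real.log N * C₃ := calc
    (1 - N ^ (1 - s)) * classZeta c s ≤ ((s - 1) * Real.log N) * idealZeta K s :=
      mul_le_mul (one_sub_rpow_one_sub_le hN0) (classZeta_le_idealZeta c hs.1) hc0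
        (mul_nonneg (by linarith [hs.1]) hlog)
    _ = Real.log N * ((s - 1) * idealZeta K s) := by ring
    _ ≤ _ := by gcongr
  have e₆ : 0 ≤ (1 - N ^ (1 - s)) * classZeta c s := mul_nonneg (by linarith) hc0
  rw [abs_le] at e₄ ⊢
  constructor <;> linarith [e₄.1, e₄.2]

lemma exists_eventually_abs_tsum_le {χ : ClassGroup (𝓞 K) → ℝ} (hχ : ∑ c, χ c = 0) :
    ∃ C, ∀ᶠ s in 𝓝[>] (1 : ℝ), |∑' I : (Ideal (𝓞 K))⁰,
      χ (ClassGroup.mk0 I) * (Ideal.absNorm (I : Ideal (𝓞 K)) : ℝ) ^ (-s)| ≤ C := by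
  choose C hC using exists_eventually_abs_classZeta_sub_le (K := K)
  refine ⟨∑ c, |χ c| * C c, ?_⟩
  filter_upwards [self_mem_nhdsWithin, eventually_all.mpr hC] with s hs h
  rw [tsum_eq_sum_classZeta χ hs]
  have h1 : ∑ c, χ c * classZeta c s = ∑ c, χ c * (classZeta c s - classZeta (K := K) 1 s) := by
    simp_rw [mul_sub, Finset.sum_sub_distrib, ← Finset.sum_mul, hχ, zero_mul, sub_zero]
  rw [h1]
  refine (Finset.abs_sum_le_sum_abs _ _).trans (Finset.sum_le_sum fun c _ => ?_)
  rw [abs_mul]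
  gcongr
  exact h c

end ClassZetaBounded

section EulerProduct

open nonZeroDivisors Filter Topology IsDedekindDomain

lemma prod_one_sub_mul_tsum {N : Type*} [CommMonoid N] (f : N →* ℝ)
    (hf : Summable f) (F : Finset N)
    (hinj : ∀ p ∈ F, Function.Injective fun a => p * a)
    (hF : ∀ p ∈ F, ∀ q ∈ F, p ≠ q → ∀ a, q ∣ p * a → q ∣ a) :
    (∏ p ∈ F, (1 - f p)) * ∑' a, f a = ∑' a, {a | ∀ p ∈ F, ¬ p ∣ a}.indicator f a := by
  classical
  induction F using Finset.induction_on with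
  | empty => simp
  | insert p F hp ih =>
    have ih' := ih (fun q hq => hinj q (Finset.mem_insert_of_mem hq))
      fun q hq r hr => hF q (Finset.mem_insert_of_mem hq) r (Finset.mem_insert_of_mem hr)
    have hind (S : Set N) : Summable (S.indicator f) := hf.indicator S
    set g := {a | ∀ p ∈ F, ¬ p ∣ a}.indicator f with hg
    have hinj' : Function.Injective fun a : N => p * a := hinj p (Finset.mem_insert_self p F)
    have h1 : ∀ a, {a | ∀ q ∈ insert p F, ¬ q ∣ a}.indicator f a =
        g a - (Set.range fun a : N => p * a).indicator g a := by
      intro a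
      by_cases hpa : p ∣ a
      · rw [Set.indicator_of_mem (show a ∈ Set.range fun a : N => p * a by
          obtain ⟨b, rfl⟩ := hpa; exact ⟨b, rfl⟩), sub_self]
        exact Set.indicator_of_notMem
          (fun h : ∀ q ∈ insert p F, ¬ q ∣ a => h p (Finset.mem_insert_self p F) hpa) _
      · rw [Set.indicator_of_notMem (s := Set.range fun a : N => p * a) (by
          rintro ⟨b, rfl⟩; exact hpa ⟨b, rfl⟩), sub_zero, hg]
        simp only [Set.indicator_apply, Set.mem_ofPred_eq, Finset.forall_mem_insert, hpa,
          not_false_eq_true, true_and]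
    have h2 : ∀ a, g (p * a) = f p * g a := by
      intro a
      have : (∀ q ∈ F, ¬ q ∣ p * a) ↔ ∀ q ∈ F, ¬ q ∣ a := by
        refine forall₂_congr fun q hq => not_congr ⟨?_, fun h => h.mul_left p⟩
        exact hF p (Finset.mem_insert_self p F) q (Finset.mem_insert_of_mem hq)
          (by rintro rfl; exact hp hq) a
      simp only [hg, Set.indicator_apply, Set.mem_ofPred_eq, this, map_mul, mul_ite, mul_zero]
    rw [Finset.prod_insert hp, mul_assoc, ih', tsum_congr h1,
      (hind _).tsum_sub ((hind _).indicator _), ← tsum_subtype (Set.range fun a : N => p * a) g,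
      tsum_range g hinj', tsum_congr h2, tsum_mul_left]
    ring

variable {R : Type*} [CommRing R] [IsDedekindDomain R]

/-- A nonzero prime ideal as an element of the monoid of nonzero ideals. -/
def primeIdeal (p : HeightOneSpectrum R) : (Ideal R)⁰ :=
  ⟨p.asIdeal, mem_nonZeroDivisors_of_ne_zero p.ne_bot⟩

lemma dvd_iff_coe_dvd_coe {I J : (Ideal R)⁰} : I ∣ J ↔ (I : Ideal R) ∣ J := by
  refine ⟨fun ⟨c, hc⟩ => ⟨c, by rw [hc]; rfl⟩, fun ⟨c, hc⟩ => ?_⟩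
  refine ⟨⟨c, mem_nonZeroDivisors_of_ne_zero ?_⟩, Subtype.ext hc⟩
  rintro rfl
  rw [mul_zero] at hc
  exact nonZeroDivisors.coe_ne_zero J hc

lemma primeIdeal_injective : Function.Injective (primeIdeal (R := R)) := fun _ _ h =>
  HeightOneSpectrum.ext (congrArg Subtype.val h)

lemma dvd_of_primeIdeal_dvd_mul {p q : HeightOneSpectrum R} (hpq : p ≠ q) {I : (Ideal R)⁰}
    (h : primeIdeal q ∣ primeIdeal p * I) : primeIdeal q ∣ I := by
  rw [dvd_iff_coe_dvd_coe] at h ⊢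
  refine (q.prime.dvd_or_dvd h).resolve_left fun h1 => hpq ?_
  refine HeightOneSpectrum.ext ?_
  exact p.isMaximal.eq_of_le q.isPrime.ne_top (Ideal.le_of_dvd h1)

lemma tendsto_prod_one_sub_mul_tsum (f : (Ideal R)⁰ →* ℝ) (hf : Summable f) :
    Tendsto (fun F : Finset (HeightOneSpectrum R) =>
      (∏ p ∈ F, (1 - f (primeIdeal p))) * ∑' I, f I) atTop (𝓝 1) := by
  classical
  have h1 : ∀ F : Finset (HeightOneSpectrum R),
      (∏ p ∈ F, (1 - f (primeIdeal p))) * ∑' I, f I =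
        ∑' I, {I | ∀ p ∈ F, ¬ primeIdeal p ∣ I}.indicator f I := by
    intro F
    have := prod_one_sub_mul_tsum f hf (F.image primeIdeal) ?_ ?_
    · rw [Finset.prod_image primeIdeal_injective.injOn] at this
      simpa only [Finset.forall_mem_image] using this
    · simp only [Finset.forall_mem_image]
      exact fun p _ a b h => Subtype.ext (mul_left_cancel₀ p.ne_bot (congrArg Subtype.val h))
    · simp only [Finset.forall_mem_image]
      intro p _ q _ hpq a h
      exact dvd_of_primeIdeal_dvd_mul (by rintro rfl; exact hpq rfl) h
  simp_rw [h1]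
  have h2 : ∑' I : (Ideal R)⁰, (if I = 1 then (1 : ℝ) else 0) = 1 := tsum_ite_eq 1 _
  rw [← h2]
  refine tendsto_tsum_of_dominated_convergence hf.norm ?_ (.of_forall fun F I => ?_)
  · intro I
    refine tendsto_const_nhds.congr' ?_
    by_cases hI : I = 1
    · subst hI
      refine .of_forall fun F => ?_
      beta_reduce
      rw [if_pos rfl, Set.indicator_of_mem, map_one]
      intro p _ h
      rw [dvd_iff_coe_dvd_coe] at h
      exact p.prime.not_isUnit (isUnit_of_dvd_one h)
    · rw [if_neg hI]
      obtain ⟨P, hP, hPI⟩ := Ideal.exists_le_maximal (I : Ideal R)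
        fun h => hI (Subtype.ext (h.trans Ideal.one_eq_top.symm))
      have hP0 : P ≠ ⊥ := by
        rintro rfl
        exact nonZeroDivisors.coe_ne_zero I (le_bot_iff.mp hPI)
      filter_upwards [eventually_ge_atTop {(⟨P, hP.isPrime, hP0⟩ : HeightOneSpectrum R)}] with F hF
      rw [Set.indicator_of_notMem]
      intro h
      refine h _ (hF (Finset.mem_singleton_self _)) ?_
      rw [dvd_iff_coe_dvd_coe]
      exact Ideal.dvd_iff_le.mpr hPI
  · exact norm_indicator_le_norm_self _ _

end EulerProduct

section TwistedZeta

open NumberField nonZeroDivisors IsDedekindDomain Filter Topology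

lemma heightOneSpectrum_under_surjective {A B : Type*} [CommRing A] [CommRing B] [IsDomain A]
    [IsDomain B] [Algebra A B] [FaithfulSMul A B] [Algebra.IsIntegral A B] :
    Function.Surjective fun P : HeightOneSpectrum B => P.under A := by
  rintro ⟨p, _, hp⟩
  obtain ⟨P, hP, rfl⟩ := p.exists_ideal_over_prime_of_isIntegral_of_isDomain (S := B) (by simp)
  exact ⟨⟨P, hP, by aesop⟩, rfl⟩

variable {K : Type*} [Field K] [NumberField K]

/-- The completely multiplicative function `I ↦ χ(I) N(I)⁻ˢ` on nonzero ideals. -/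
noncomputable def twistHom (χ : ClassGroup (𝓞 K) →* ℝ) (s : ℝ) : (Ideal (𝓞 K))⁰ →* ℝ where
  toFun I := χ (ClassGroup.mk0 I) * (Ideal.absNorm (I : Ideal (𝓞 K)) : ℝ) ^ (-s)
  map_one' := by
    rw [map_one, map_one, Submonoid.coe_one, map_one, Nat.cast_one, Real.one_rpow, one_mul]
  map_mul' I J := by
    rw [map_mul, map_mul, Submonoid.coe_mul, map_mul, Nat.cast_mul,
      Real.mul_rpow (Nat.cast_nonneg _) (Nat.cast_nonneg _)]
    ring

lemma twistHom_apply (χ : ClassGroup (𝓞 K) →* ℝ) (s : ℝ) (I : (Ideal (𝓞 K))⁰) :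
    twistHom χ s I = χ (ClassGroup.mk0 I) * (Ideal.absNorm (I : Ideal (𝓞 K)) : ℝ) ^ (-s) := rfl

lemma twistHom_eq_mul (χ : ClassGroup (𝓞 K) →* ℝ) (s : ℝ) (I : (Ideal (𝓞 K))⁰) :
    twistHom χ s I = χ (ClassGroup.mk0 I) * twistHom 1 s I := by
  simp [twistHom_apply]

lemma tsum_twistHom_one (s : ℝ) : ∑' I, twistHom (K := K) 1 s I = idealZeta K s := by
  simp [twistHom_apply, idealZeta]

lemma summable_twistHom {χ : ClassGroup (𝓞 K) →* ℝ} (hχ : ∀ c, |χ c| ≤ 1) {s : ℝ} (hs : 1 < s) :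
    Summable (twistHom χ s) := by
  refine summable_of_abs_le_absNorm_rpow hs fun I => ?_
  rw [twistHom_apply, abs_mul, abs_of_nonneg (Real.rpow_nonneg (Nat.cast_nonneg _) (-s))]
  exact mul_le_of_le_one_left (Real.rpow_nonneg (Nat.cast_nonneg _) _) (hχ _)

lemma twistHom_one_pos (s : ℝ) (I : (Ideal (𝓞 K))⁰) : 0 < twistHom 1 s I := by
  rw [twistHom_apply, MonoidHom.one_apply, one_mul]
  exact Real.rpow_pos_of_pos (Nat.cast_pos.mpr (absNorm_pos I)) _

lemma twistHom_one_le_one {s : ℝ} (hs : 0 ≤ s) (I : (Ideal (𝓞 K))⁰) : twistHom 1 s I ≤ 1 := by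
  rw [twistHom_apply, MonoidHom.one_apply, one_mul]
  exact Real.rpow_le_one_of_one_le_of_nonpos (Nat.one_le_cast.mpr (absNorm_pos I)) (by linarith)

lemma twistHom_one_two_mul (s : ℝ) (I : (Ideal (𝓞 K))⁰) :
    twistHom 1 (2 * s) I = twistHom 1 s I ^ 2 := by
  rw [twistHom_apply, twistHom_apply, MonoidHom.one_apply, one_mul, one_mul,
    ← Real.rpow_mul_natCast (Nat.cast_nonneg _)]
  congr 1
  push_cast
  ring

variable {L M : Type*} [Field L] [NumberField L] [Field M] [NumberField M] [Algebra L M]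

/-- The relative norm on nonzero ideals. -/
noncomputable def relNorm₀ (L : Type*) [Field L] [NumberField L] [Algebra L M]
    (I : (Ideal (𝓞 M))⁰) : (Ideal (𝓞 L))⁰ :=
  ⟨Ideal.relNorm (𝓞 L) (I : Ideal (𝓞 M)), mem_nonZeroDivisors_of_ne_zero
    (mt Ideal.relNorm_eq_bot_iff.mp (nonZeroDivisors.coe_ne_zero I))⟩

lemma exists_relNorm₀_eq_pow (P : HeightOneSpectrum (𝓞 M)) :
    ∃ n ≠ 0, relNorm₀ L (primeIdeal P) = primeIdeal (P.under (𝓞 L)) ^ n := by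
  have : P.asIdeal.LiesOver (P.under (𝓞 L)).asIdeal := ⟨rfl⟩
  obtain ⟨n, hn⟩ := Ideal.exists_relNorm_eq_pow_of_isPrime P.asIdeal (P.under (𝓞 L)).asIdeal
  refine ⟨n, ?_, Subtype.ext hn⟩
  rintro rfl
  have h := Ideal.absNorm_relNorm (𝓞 L) (𝓞 M) P.asIdeal
  rw [hn, pow_zero, map_one] at h
  exact P.isPrime.ne_top (Ideal.absNorm_eq_one_iff.mp h.symm)

lemma twistHom_one_relNorm₀ (s : ℝ) (I : (Ideal (𝓞 M))⁰) :
    twistHom 1 s (relNorm₀ L I) = twistHom 1 s I := by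
  rw [twistHom_apply, twistHom_apply, MonoidHom.one_apply, MonoidHom.one_apply]
  congr 3
  exact Ideal.absNorm_relNorm (𝓞 L) (𝓞 M) I

lemma card_filter_under_eq_le [IsGalois L M] [DecidableEq (HeightOneSpectrum (𝓞 L))]
    (G : Finset (HeightOneSpectrum (𝓞 M)))
    (p : HeightOneSpectrum (𝓞 L)) :
    (G.filter fun P => P.under (𝓞 L) = p).card ≤ Module.finrank L M := by
  have h1 := Ideal.ncard_primesOver_mul_ramificationIdxIn_mul_inertiaDegIn p.asIdeal (𝓞 M) Gal(M/L)
  have h3 : (p.asIdeal.primesOver (𝓞 M)).ncard ≤ Module.finrank L M := by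
    rw [← IsGalois.card_aut_eq_finrank, ← h1]
    refine Nat.le_mul_of_pos_right _ (Nat.pos_of_ne_zero fun h => ?_)
    rw [h, mul_zero] at h1
    exact Nat.card_pos.ne h1
  refine le_trans ?_ h3
  rw [← Set.ncard_coe_finset]
  refine Set.ncard_le_ncard_of_injOn HeightOneSpectrum.asIdeal ?_ ?_
    (IsDedekindDomain.primesOver_finite _ _)
  · intro P hP
    refine ⟨P.isPrime, ⟨?_⟩⟩
    rw [← (Finset.mem_filter.mp hP).2]
    rfl
  · exact fun _ _ _ _ h => HeightOneSpectrum.ext h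

end TwistedZeta

section NormIndex

open NumberField nonZeroDivisors IsDedekindDomain Filter Topology

lemma sq_one_sub_le_prod_one_sub {ι : Type*} {S : Finset ι} (hS : S.card ≤ 2) {X : ι → ℝ} {y : ℝ}
    (hy0 : 0 ≤ y) (hy1 : y ≤ 1) (hX : ∀ i ∈ S, X i ≤ y) : (1 - y) ^ 2 ≤ ∏ i ∈ S, (1 - X i) := calc
  (1 - y) ^ 2 ≤ (1 - y) ^ S.card :=
    pow_le_pow_of_le_one (by linarith) (by linarith) hS
  _ = ∏ i ∈ S, (1 - y) := (Finset.prod_const _).symm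
  _ ≤ _ := Finset.prod_le_prod (fun _ _ => by linarith) fun i hi => by linarith [hX i hi]

variable {L M : Type*} [Field L] [NumberField L] [Field M] [NumberField M] [Algebra L M]
  [IsGalois L M]

lemma euler_factor_le (hLM : Module.finrank L M = 2) {χ₁ χ₂ : ClassGroup (𝓞 L) →* ℝ}
    (h₁ : ∀ c, χ₁ c ^ 2 = 1) (h₂ : ∀ c, χ₂ c ^ 2 = 1)
    (hN₁ : ∀ I : (Ideal (𝓞 M))⁰, χ₁ (ClassGroup.mk0 (relNorm₀ L I)) = 1)
    (hN₂ : ∀ I : (Ideal (𝓞 M))⁰, χ₂ (ClassGroup.mk0 (relNorm₀ L I)) = 1) {s : ℝ} (hs : 0 ≤ s)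
    [DecidableEq (HeightOneSpectrum (𝓞 L))] (G : Finset (HeightOneSpectrum (𝓞 M)))
    (p : HeightOneSpectrum (𝓞 L)) :
    (1 - twistHom 1 (2 * s) (primeIdeal p)) ^ 4 * ((1 - twistHom 1 s (primeIdeal p)) *
      (1 - twistHom χ₁ s (primeIdeal p)) * (1 - twistHom χ₂ s (primeIdeal p)) *
      (1 - twistHom (χ₁ * χ₂) s (primeIdeal p))) ≤
      (∏ P ∈ G with P.under (𝓞 L) = p, (1 - twistHom 1 s (primeIdeal P))) ^ 2 := by
  have hcard := (card_filter_under_eq_le G p).trans hLM.le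
  rw [twistHom_one_two_mul, twistHom_eq_mul χ₁, twistHom_eq_mul χ₂, twistHom_eq_mul (χ₁ * χ₂),
    MonoidHom.mul_apply]
  have hX : ∀ P ∈ G.filter (fun P => P.under (𝓞 L) = p), ∃ n ≠ 0,
      twistHom 1 s (primeIdeal P) = twistHom 1 s (primeIdeal p) ^ n ∧
      χ₁ (ClassGroup.mk0 (primeIdeal p)) ^ n = 1 ∧ χ₂ (ClassGroup.mk0 (primeIdeal p)) ^ n = 1 := by
    intro P hP
    obtain ⟨n, hn0, hn⟩ := exists_relNorm₀_eq_pow (L := L) P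
    rw [(Finset.mem_filter.mp hP).2] at hn
    refine ⟨n, hn0, ?_, ?_, ?_⟩
    · rw [← twistHom_one_relNorm₀ (L := L), hn, map_pow]
    · rw [← hN₁ (primeIdeal P), hn, map_pow, map_pow]
    · rw [← hN₂ (primeIdeal P), hn, map_pow, map_pow]
  have hx0 := twistHom_one_pos s (primeIdeal p)
  have hx1 := twistHom_one_le_one hs (primeIdeal p)
  have ha := h₁ (ClassGroup.mk0 (primeIdeal p))
  have hb := h₂ (ClassGroup.mk0 (primeIdeal p))
  set x := twistHom 1 s (primeIdeal p)
  set a := χ₁ (ClassGroup.mk0 (primeIdeal p))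
  set b := χ₂ (ClassGroup.mk0 (primeIdeal p))
  have hx2 : x ^ 2 ≤ 1 := pow_le_one₀ hx0.le hx1
  have hy : (1 - x ^ 2) ^ 4 ≤ 1 := pow_le_one₀ (by linarith) (by nlinarith)
  by_cases hab : a = 1 ∧ b = 1
  · have h := sq_one_sub_le_prod_one_sub hcard hx0.le hx1
      (X := fun P => twistHom 1 s (primeIdeal P)) fun P hP => by
        obtain ⟨n, hn0, hn, -⟩ := hX P hP
        rw [hn]
        exact pow_le_of_le_one hx0.le hx1 hn0
    rw [hab.1, hab.2]
    calc _ ≤ 1 * ((1 - x) ^ 2) ^ 2 := by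
          rw [show (1 - x) * (1 - 1 * x) * (1 - 1 * x) * (1 - 1 * 1 * x) =
              ((1 - x) ^ 2) ^ 2 by ring]
          gcongr
      _ ≤ _ := by rw [one_mul]; gcongr
  · have h := sq_one_sub_le_prod_one_sub hcard (sq_nonneg x) hx2
      (X := fun P => twistHom 1 s (primeIdeal P)) fun P hP => by
        obtain ⟨n, hn0, hn, hna, hnb⟩ := hX P hP
        rw [hn]
        refine pow_le_pow_of_le_one hx0.le hx1 ?_
        by_contra! hlt
        obtain rfl : n = 1 := by omega
        exact hab ⟨by simpa using hna, by simpa using hnb⟩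
    have hfac : (1 - x) * (1 - a * x) * (1 - b * x) * (1 - a * b * x) = (1 - x ^ 2) ^ 2 := by
      rcases sq_eq_one_iff.mp ha with ha | ha <;>
        rcases sq_eq_one_iff.mp hb with hb | hb <;> simp_all <;> ring
    rw [hfac]
    calc _ ≤ (1 - x ^ 2) ^ 4 * 1 := by
          gcongr
          exact pow_le_one₀ (by linarith) (by nlinarith)
      _ = ((1 - x ^ 2) ^ 2) ^ 2 := by ring
      _ ≤ _ := by gcongr

theorem idealZeta_sq_le (hLM : Module.finrank L M = 2) {χ₁ χ₂ : ClassGroup (𝓞 L) →* ℝ}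
    (h₁ : ∀ c, χ₁ c ^ 2 = 1) (h₂ : ∀ c, χ₂ c ^ 2 = 1)
    (hN₁ : ∀ I : (Ideal (𝓞 M))⁰, χ₁ (ClassGroup.mk0 (relNorm₀ L I)) = 1)
    (hN₂ : ∀ I : (Ideal (𝓞 M))⁰, χ₂ (ClassGroup.mk0 (relNorm₀ L I)) = 1) {s : ℝ} (hs : 1 < s) :
    idealZeta M s ^ 2 ≤ idealZeta L (2 * s) ^ 4 * (idealZeta L s * (∑' I, twistHom χ₁ s I) *
      (∑' I, twistHom χ₂ s I) * ∑' I, twistHom (χ₁ * χ₂) s I) := by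
  classical
  have habs : ∀ {χ : ClassGroup (𝓞 L) →* ℝ}, (∀ c, χ c ^ 2 = 1) → ∀ c, |χ c| ≤ 1 := fun h c =>
    (sq_le_one_iff_abs_le_one _).mp (h c).le
  have h₃ : ∀ c, (χ₁ * χ₂) c ^ 2 = 1 := fun c => by
    rw [MonoidHom.mul_apply, mul_pow, h₁, h₂, one_mul]
  have h₀ : ∀ c, (1 : ClassGroup (𝓞 L) →* ℝ) c ^ 2 = 1 := fun c => one_pow 2
  have hfac : ∀ {χ : ClassGroup (𝓞 L) →* ℝ}, (∀ c, χ c ^ 2 = 1) →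
      ∀ p, 0 ≤ 1 - twistHom χ s (primeIdeal p) := fun {χ} h p => by
    rw [twistHom_eq_mul, sub_nonneg]
    exact (mul_le_of_le_one_left (twistHom_one_pos _ _).le (le_of_abs_le (habs h _))).trans
      (twistHom_one_le_one (zero_le_one.trans hs.le) _)
  have htend : ∀ {χ : ClassGroup (𝓞 L) →* ℝ} {t : ℝ}, (∀ c, χ c ^ 2 = 1) → 1 < t → Tendsto
      (fun G : Finset (HeightOneSpectrum (𝓞 M)) =>
        (∏ p ∈ G.image (·.under (𝓞 L)), (1 - twistHom χ t (primeIdeal p))) *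
          ∑' I, twistHom χ t I) atTop (𝓝 1) := fun {χ t} h ht =>
    (tendsto_prod_one_sub_mul_tsum (twistHom χ t) (summable_twistHom (habs h) ht)).comp
      (tendsto_finset_image_atTop_atTop
        (Function.rightInverse_surjInv heightOneSpectrum_under_surjective))
  have t₀ := htend h₀ hs
  have t₁ := htend h₁ hs
  have t₂ := htend h₂ hs
  have t₃ := htend h₃ hs
  have t₄ := htend h₀ (show 1 < 2 * s by linarith)
  have t₅ := tendsto_prod_one_sub_mul_tsum (twistHom (K := M) 1 s)
    (summable_twistHom (fun c => by simp) hs)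
  rw [tsum_twistHom_one] at t₀ t₄ t₅
  have hA := ((t₀.mul t₁).mul t₂).mul t₃
  simp only [one_mul] at hA
  set Λ := idealZeta L s * (∑' I, twistHom χ₁ s I) * (∑' I, twistHom χ₂ s I) *
    ∑' I, twistHom (χ₁ * χ₂) s I with hΛ
  have hG : ∀ G : Finset (HeightOneSpectrum (𝓞 M)),
      (∏ p ∈ G.image (·.under (𝓞 L)), (1 - twistHom 1 (2 * s) (primeIdeal p))) ^ 4 *
      ((∏ p ∈ G.image (·.under (𝓞 L)), (1 - twistHom 1 s (primeIdeal p))) *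
      (∏ p ∈ G.image (·.under (𝓞 L)), (1 - twistHom χ₁ s (primeIdeal p))) *
      (∏ p ∈ G.image (·.under (𝓞 L)), (1 - twistHom χ₂ s (primeIdeal p))) *
      ∏ p ∈ G.image (·.under (𝓞 L)), (1 - twistHom (χ₁ * χ₂) s (primeIdeal p))) ≤
      (∏ P ∈ G, (1 - twistHom 1 s (primeIdeal P))) ^ 2 := by
    intro G
    rw [← Finset.prod_fiberwise_of_maps_to (s := G) (t := G.image (·.under (𝓞 L)))
      (g := (·.under (𝓞 L))) fun P hP => Finset.mem_image_of_mem _ hP]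
    rw [← Finset.prod_pow, ← Finset.prod_pow, ← Finset.prod_mul_distrib, ← Finset.prod_mul_distrib,
      ← Finset.prod_mul_distrib, ← Finset.prod_mul_distrib]
    refine Finset.prod_le_prod (fun p _ => ?_)
      fun p _ => euler_factor_le hLM h₁ h₂ hN₁ hN₂ (zero_le_one.trans hs.le) G p
    have := hfac h₀ p
    have := hfac h₁ p
    have := hfac h₂ p
    have := hfac h₃ p
    positivity
  have hpos : ∀ G : Finset (HeightOneSpectrum (𝓞 M)), ∀ {χ : ClassGroup (𝓞 L) →* ℝ},
      (∀ c, χ c ^ 2 = 1) → 0 ≤ ∏ p ∈ G.image (·.under (𝓞 L)), (1 - twistHom χ s (primeIdeal p)) :=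
    fun G {χ} h => Finset.prod_nonneg fun p _ => hfac h p
  have hΛ0 : 0 ≤ Λ := by
    obtain ⟨G, hG⟩ := (hA.eventually_const_lt zero_lt_one).exists
    by_contra! hneg
    have := mul_nonneg (mul_nonneg (mul_nonneg (hpos G h₀) (hpos G h₁)) (hpos G h₂)) (hpos G h₃)
    nlinarith
  have hlim := le_of_tendsto_of_tendsto' (((t₄.pow 4).mul hA).mul_const (idealZeta M s ^ 2))
    ((t₅.pow 2).mul_const (idealZeta L (2 * s) ^ 4 * Λ)) fun G => ?_
  · simpa only [one_pow, one_mul] using hlim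
  · have := mul_le_mul_of_nonneg_right (hG G)
      (show 0 ≤ idealZeta M s ^ 2 * (idealZeta L (2 * s) ^ 4 * Λ) by positivity)
    rw [hΛ] at this ⊢
    linarith

end NormIndex

section NormIndex

open NumberField nonZeroDivisors Filter Topology

lemma exists_pair_characters {Q : Type*} [CommGroup Q] [Finite Q] (hsq : ∀ a : Q, a ^ 2 = 1)
    (hcard : 2 < Nat.card Q) : ∃ χ₁ χ₂ : Q →* ℝ, (∀ a, χ₁ a ^ 2 = 1) ∧ (∀ a, χ₂ a ^ 2 = 1) ∧
      χ₁ ≠ 1 ∧ χ₂ ≠ 1 ∧ χ₁ * χ₂ ≠ 1 := by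
  have : Nontrivial Q := Finite.one_lt_card_iff_nontrivial.mp (by omega)
  have hexp : Monoid.exponent Q = 2 :=
    (Nat.dvd_prime Nat.prime_two).mp (Monoid.exponent_dvd_of_forall_pow_eq_one hsq) |>.resolve_left
      (by rw [Monoid.exp_eq_one_iff]; exact not_subsingleton Q)
  have hroots : HasEnoughRootsOfUnity ℝ (Monoid.exponent Q) := by
    rw [hexp]
    exact ⟨⟨-1, IsPrimitiveRoot.neg_one 0 (by norm_num)⟩, inferInstance⟩
  have hex : ∀ a : Q, a ≠ 1 → ∃ χ : Q →* ℝ, (∀ b, χ b ^ 2 = 1) ∧ χ a ≠ 1 := fun a ha => by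
    obtain ⟨φ, hφ⟩ := CommGroup.exists_apply_ne_one_of_hasEnoughRootsOfUnity Q ℝ ha
    refine ⟨(Units.coeHom ℝ).comp φ, fun b => ?_, ?_⟩
    · rw [← map_pow, hsq, map_one]
    · simpa using hφ
  obtain ⟨a, ha⟩ := exists_ne (1 : Q)
  obtain ⟨χ₁, h₁, h₁a⟩ := hex a ha
  obtain ⟨b, hb, hb1⟩ : ∃ b ≠ 1, χ₁ b = 1 := by
    by_contra! h
    have hinj : Function.Injective χ₁ := (injective_iff_map_eq_one χ₁).mpr fun b hb => by
      by_contra hb'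
      exact h b hb' hb
    have := Set.ncard_le_ncard_of_injOn χ₁ (s := Set.univ) (t := {1, -1})
      (fun b _ => by simpa using sq_eq_one_iff.mp (h₁ b)) hinj.injOn
    rw [Set.ncard_univ, Set.ncard_pair (by norm_num)] at this
    omega
  obtain ⟨χ₂, h₂, h₂b⟩ := hex b hb
  refine ⟨χ₁, χ₂, h₁, h₂, ?_, ?_, ?_⟩
  · rintro rfl
    exact h₁a rfl
  · rintro rfl
    exact h₂b rfl
  · intro h
    have := DFunLike.congr_fun h b
    rw [MonoidHom.mul_apply, hb1, one_mul] at this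
    exact h₂b this

lemma exists_eventually_abs_tsum_twistHom_le {K : Type*} [Field K] [NumberField K]
    {χ : ClassGroup (𝓞 K) →* ℝ} (hχ : χ ≠ 1) :
    ∃ C, ∀ᶠ s in 𝓝[>] (1 : ℝ), |∑' I, twistHom χ s I| ≤ C :=
  exists_eventually_abs_tsum_le (sum_hom_units_eq_zero χ hχ)

lemma idealZeta_anti {K : Type*} [Field K] [NumberField K] {s t : ℝ} (hs : 1 < s) (hst : s ≤ t) :
    idealZeta K t ≤ idealZeta K s := by
  refine (summable_absNorm_rpow (hs.trans_le hst)).tsum_le_tsum (fun I => ?_)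
    (summable_absNorm_rpow hs)
  exact Real.rpow_le_rpow_of_exponent_le (Nat.one_le_cast.mpr (absNorm_pos I)) (by linarith)

lemma idealZeta_nonneg {K : Type*} [Field K] [NumberField K] (s : ℝ) : 0 ≤ idealZeta K s :=
  tsum_nonneg fun _ => Real.rpow_nonneg (Nat.cast_nonneg _) _

variable {L M : Type*} [Field L] [NumberField L] [Field M] [NumberField M] [Algebra L M]

lemma relNorm₀_map (I : (Ideal (𝓞 L))⁰) (J : (Ideal (𝓞 M))⁰)
    (hJ : (J : Ideal (𝓞 M)) = (I : Ideal (𝓞 L)).map (algebraMap (𝓞 L) (𝓞 M))) :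
    relNorm₀ L J = I ^ Module.finrank L M := by
  refine Subtype.ext ?_
  rw [SubmonoidClass.coe_pow, IsFractionRing.finrank_eq (𝓞 L) L (𝓞 M) M,
    ← Ideal.relNorm_algebraMap, ← hJ]
  rfl

variable [IsGalois L M]

/-- The norms of ideal classes from a quadratic extension have index at most `2`. -/
theorem index_le_two_of_relNorm_mem (hLM : Module.finrank L M = 2) (H : Subgroup (ClassGroup (𝓞 L)))
    (hH : ∀ I : (Ideal (𝓞 M))⁰, ClassGroup.mk0 (relNorm₀ L I) ∈ H) : H.index ≤ 2 := by
  by_contra! hcard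
  have hsq : ∀ a : ClassGroup (𝓞 L) ⧸ H, a ^ 2 = 1 := by
    intro a
    obtain ⟨c, rfl⟩ := QuotientGroup.mk'_surjective H a
    obtain ⟨I, rfl⟩ := ClassGroup.mk0_surjective c
    rw [← map_pow, ← map_pow, ← hLM, QuotientGroup.mk'_apply, QuotientGroup.eq_one_iff,
      ← relNorm₀_map I ⟨(I : Ideal (𝓞 L)).map (algebraMap (𝓞 L) (𝓞 M)),
        mem_nonZeroDivisors_of_ne_zero ?_⟩ rfl]
    · exact hH _
    · exact mt (Ideal.map_eq_bot_iff_of_injective (FaithfulSMul.algebraMap_injective _ _)).mp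
        (nonZeroDivisors.coe_ne_zero I)
  obtain ⟨ψ₁, ψ₂, hψ₁, hψ₂, h1, h2, h3⟩ := exists_pair_characters hsq hcard
  have hne : ∀ {ψ : ClassGroup (𝓞 L) ⧸ H →* ℝ}, ψ ≠ 1 → ψ.comp (QuotientGroup.mk' H) ≠ 1 :=
    fun hψ h => hψ ((MonoidHom.cancel_right (QuotientGroup.mk'_surjective H)).mp
      (h.trans (MonoidHom.one_comp _).symm))
  have hnorm : ∀ (ψ : ClassGroup (𝓞 L) ⧸ H →* ℝ) (I : (Ideal (𝓞 M))⁰),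
      ψ.comp (QuotientGroup.mk' H) (ClassGroup.mk0 (relNorm₀ L I)) = 1 := fun ψ I => by
    rw [MonoidHom.comp_apply, QuotientGroup.mk'_apply, (QuotientGroup.eq_one_iff _).mpr (hH I),
      map_one]
  obtain ⟨C₁, hC₁⟩ := exists_eventually_abs_tsum_twistHom_le (hne h1)
  obtain ⟨C₂, hC₂⟩ := exists_eventually_abs_tsum_twistHom_le (hne h2)
  obtain ⟨C₃, hC₃⟩ := exists_eventually_abs_tsum_twistHom_le (hne h3)
  have hM := (tendsto_sub_one_mul_idealZeta (K := M)).pow 2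
  have hL := ((tendsto_sub_one_mul_idealZeta (K := L)).mul_const
    (C₁ * C₂ * C₃ * idealZeta L 2 ^ 4)).mul
      ((tendsto_nhdsWithin_of_tendsto_nhds (s := Set.Ioi 1)
        (continuous_sub_right (1 : ℝ)).continuousAt.tendsto))
  rw [sub_self, mul_zero] at hL
  refine (pow_pos (dedekindZeta_residue_pos M) 2).not_ge (le_of_tendsto_of_tendsto hM hL ?_)
  filter_upwards [hC₁, hC₂, hC₃, self_mem_nhdsWithin] with s e₁ e₂ e₃ hs
  rw [Set.mem_Ioi] at hs
  have key := idealZeta_sq_le hLM (fun c => hψ₁ _) (fun c => hψ₂ _) (hnorm ψ₁) (hnorm ψ₂) hs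
  have hz2 := idealZeta_anti (K := L) one_lt_two (show 2 ≤ 2 * s by linarith)
  have hz2' := idealZeta_nonneg (K := L) (2 * s)
  have hz := idealZeta_nonneg (K := L) s
  set l₁ := ∑' I, twistHom (ψ₁.comp (QuotientGroup.mk' H)) s I
  set l₂ := ∑' I, twistHom (ψ₂.comp (QuotientGroup.mk' H)) s I
  have e₃' : |∑' I, twistHom (ψ₁.comp (QuotientGroup.mk' H) * ψ₂.comp (QuotientGroup.mk' H)) s I|
    ≤ C₃ := e₃
  set l₃ := ∑' I, twistHom (ψ₁.comp (QuotientGroup.mk' H) * ψ₂.comp (QuotientGroup.mk' H)) s I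
  have hprod : l₁ * l₂ * l₃ ≤ C₁ * C₂ * C₃ := (le_abs_self _).trans <| by
    rw [abs_mul, abs_mul]
    gcongr
    · exact mul_nonneg ((abs_nonneg _).trans e₁) ((abs_nonneg _).trans e₂)
    · exact (abs_nonneg _).trans e₁
  have hC : 0 ≤ C₁ * C₂ * C₃ := mul_nonneg (mul_nonneg ((abs_nonneg _).trans e₁)
    ((abs_nonneg _).trans e₂)) ((abs_nonneg _).trans e₃)
  calc ((s - 1) * idealZeta M s) ^ 2 = (s - 1) ^ 2 * idealZeta M s ^ 2 := by ring
    _ ≤ (s - 1) ^ 2 * (idealZeta L (2 * s) ^ 4 * (idealZeta L s * l₁ * l₂ * l₃)) := by gcongr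
    _ = (s - 1) ^ 2 * (idealZeta L (2 * s) ^ 4 * (idealZeta L s * (l₁ * l₂ * l₃))) := by ring
    _ ≤ (s - 1) ^ 2 * (idealZeta L (2 * s) ^ 4 * (idealZeta L s * (C₁ * C₂ * C₃))) := by gcongr
    _ ≤ (s - 1) ^ 2 * (idealZeta L 2 ^ 4 * (idealZeta L s * (C₁ * C₂ * C₃))) := by gcongr
    _ = _ := by ring

end NormIndex

section InvariantIdeals

open NumberField nonZeroDivisors

/-- If an involution `s` of `B` with ring of invariants `A` admits an element with unit different,
then every `s`-invariant ideal of `B` is extended from `A`. -/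
lemma Ideal.map_comap_eq_of_isUnit_sub {A B : Type*} [CommRing A] [CommRing B] [Algebra A B]
    (s : B →+* B) (hs : ∀ b, s (s b) = b) (hfix : ∀ b, s b = b → b ∈ (algebraMap A B).range)
    {ω : B} (hω : IsUnit (ω - s ω)) {I : Ideal B} (hI : I.map s ≤ I) :
    (I.comap (algebraMap A B)).map (algebraMap A B) = I := by
  refine le_antisymm Ideal.map_comap_le fun x hx => ?_
  have hmem : ∀ y ∈ I, s y = y → y ∈ (I.comap (algebraMap A B)).map (algebraMap A B) := by
    intro y hy hsy
    obtain ⟨a, rfl⟩ := hfix y hsy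
    exact Ideal.mem_map_of_mem _ hy
  have hsx : ∀ y ∈ I, s y ∈ I := fun y hy => hI (Ideal.mem_map_of_mem _ hy)
  have ha := hmem (x + s x) (add_mem hx (hsx x hx)) (by rw [map_add, hs, add_comm])
  have hb := hmem (x * ω + s (x * ω)) (add_mem (I.mul_mem_right _ hx)
    (hsx _ (I.mul_mem_right _ hx))) (by rw [map_add, hs, add_comm])
  obtain ⟨u, hu⟩ := hω
  have : x = ↑u⁻¹ * ((x * ω + s (x * ω)) - s ω * (x + s x)) := by
    rw [map_mul, show x * ω + s x * s ω - s ω * (x + s x) = (ω - s ω) * x by ring, ← hu,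
      Units.inv_mul_cancel_left]
  rw [this]
  exact Ideal.mul_mem_left _ _ (sub_mem hb (Ideal.mul_mem_left _ _ ha))

lemma mem_range_algebraMap_ringOfIntegers {L M : Type*} [Field L] [Field M] [Algebra L M]
    (σ : M ≃ₐ[L] M)
    (hgen : ∀ x : M, σ x = x → x ∈ (algebraMap L M).range) (b : 𝓞 M)
    (hb : RingOfIntegers.mapAlgEquiv σ b = b) : b ∈ (algebraMap (𝓞 L) (𝓞 M)).range := by
  obtain ⟨a, ha⟩ := hgen b (congrArg Subtype.val hb)
  have h_int : IsIntegral ℤ a := by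
    refine (isIntegral_algebraMap_iff (B := M) (algebraMap L M).injective).mp ?_
    rw [ha]; exact b.isIntegral_coe
  exact ⟨⟨a, h_int⟩, RingOfIntegers.ext ha⟩

variable {L M : Type*} [Field L] [NumberField L] [Field M] [NumberField M] [Algebra L M]

lemma map_relNorm_eq_mul_map (hLM : Module.finrank L M = 2) (s : 𝓞 M ≃ₐ[𝓞 L] 𝓞 M)
    (hs : ∀ b, s (s b) = b) (hfix : ∀ b, s b = b → b ∈ (algebraMap (𝓞 L) (𝓞 M)).range)
    {ω : 𝓞 M} (hω : IsUnit (ω - s ω)) (I : Ideal (𝓞 M)) :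
    (Ideal.relNorm (𝓞 L) I).map (algebraMap (𝓞 L) (𝓞 M)) = I * I.map s := by
  have hss : (I.map s).map s = I := by
    have : (s : 𝓞 M →+* 𝓞 M).comp (s : 𝓞 M →+* 𝓞 M) = RingHom.id _ := RingHom.ext hs
    change (I.map (s : 𝓞 M →+* 𝓞 M)).map (s : 𝓞 M →+* 𝓞 M) = I
    rw [Ideal.map_map, this, Ideal.map_id]
  have h := Ideal.map_comap_eq_of_isUnit_sub (s : 𝓞 M →+* 𝓞 M) hs hfix hω (I := I * I.map s) (by
    change Ideal.map s _ ≤ _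
    rw [Ideal.map_mul, hss, mul_comm])
  set J := (I * I.map s).comap (algebraMap (𝓞 L) (𝓞 M))
  have h2 := congrArg (Ideal.relNorm (𝓞 L)) h
  rw [Ideal.relNorm_algebraMap, map_mul, Ideal.relNorm_map_algEquiv,
    ← IsFractionRing.finrank_eq (𝓞 L) L (𝓞 M) M, hLM, ← sq] at h2
  have h3 : J = Ideal.relNorm (𝓞 L) I :=
    le_antisymm (Ideal.dvd_iff_le.mp
      ((UniqueFactorizationMonoid.pow_dvd_pow_iff_dvd two_ne_zero).mp h2.symm.dvd))
      (Ideal.dvd_iff_le.mp ((UniqueFactorizationMonoid.pow_dvd_pow_iff_dvd two_ne_zero).mp h2.dvd))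
  rw [← h3, h]

end InvariantIdeals

section FractionalIdeals

open NumberField nonZeroDivisors FractionalIdeal

lemma Subgroup.relIndex_range_eq_index_map {I J C : Type*} [Group I] [Group J] [Group C]
    (j : I →* J) (c : I →* C) (hc : Function.Surjective c) (U : Subgroup J)
    (hker : c.ker ≤ U.comap j) : U.relIndex j.range = ((U.comap j).map c).index := by
  rw [← Subgroup.index_comap, Subgroup.index_map_eq _ hc hker]

lemma FractionalIdeal.extended_eq_self {B K : Type*} [CommRing B] [Field K] [Algebra B K]
    [IsFractionRing B K] {f : B →+* B} (hf : B⁰ ≤ Submonoid.comap f B⁰) (hid : f = RingHom.id B)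
    (I : FractionalIdeal B⁰ K) : I.extended K hf = I := by
  subst hid
  have h : ⇑(IsLocalization.map (S := K) K (RingHom.id B) hf) = id :=
    funext fun z => IsLocalization.map_id z hf
  rw [← coeToSubmodule_inj, coe_extended_eq_span, h, Set.image_id]
  exact Submodule.span_eq _

/-- The action of a ring automorphism on invertible fractional ideals. -/
noncomputable def fractionalConj {B K : Type*} [CommRing B] [IsDomain B] [Field K] [Algebra B K]
    [IsFractionRing B K] (s : B ≃+* B) : (FractionalIdeal B⁰ K)ˣ →* (FractionalIdeal B⁰ K)ˣ :=
  Units.map (extendedHom' (f := (s : B →+* B)) K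
    (nonZeroDivisors_le_comap_nonZeroDivisors_of_injective _ s.injective) :
      FractionalIdeal B⁰ K →+* FractionalIdeal B⁰ K).toMonoidHom

/-- Extension of invertible fractional ideals. -/
noncomputable def fractionalExtend (A K B L : Type*) [CommRing A] [IsDomain A] [CommRing B]
    [IsDomain B] [Algebra A B] [Module.IsTorsionFree A B] [Field K] [Field L] [Algebra A K]
    [Algebra B L] [IsFractionRing A K] [IsFractionRing B L] :
    (FractionalIdeal A⁰ K)ˣ →* (FractionalIdeal B⁰ L)ˣ :=
  Units.map (extendedHom L B : FractionalIdeal A⁰ K →+* FractionalIdeal B⁰ L).toMonoidHom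

section

variable {B K : Type*} [CommRing B] [IsDomain B] [Field K] [Algebra B K] [IsFractionRing B K]

lemma coe_fractionalConj_of_coeIdeal (s : B ≃+* B) {b : (FractionalIdeal B⁰ K)ˣ} {I : Ideal B}
    (hb : (b : FractionalIdeal B⁰ K) = I) :
    (fractionalConj s b : FractionalIdeal B⁰ K) = (I.map (s : B →+* B) : Ideal B) := by
  exact (congrArg _ hb).trans (extended_coeIdeal_eq_map (K := K) K _ I)

lemma fractionalConj_toPrincipalIdeal (s : B ≃+* B) (σ : K →+* K)
    (hσ : ∀ x, σ (algebraMap B K x) = algebraMap B K (s x)) (x : Kˣ) :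
    fractionalConj s (toPrincipalIdeal B K x) =
      toPrincipalIdeal B K (Units.map (σ : K →* K) x) := by
  refine Units.ext ?_
  have h : IsLocalization.map (S := K) (T := B⁰) K (s : B →+* B)
      (nonZeroDivisors_le_comap_nonZeroDivisors_of_injective _ s.injective) = σ :=
    IsLocalization.ringHom_ext B⁰ (RingHom.ext fun b => by simp [hσ])
  rw [coe_toPrincipalIdeal, Units.coe_map, MonoidHom.coe_coe, ← h]
  rw [fractionalConj, Units.coe_map, coe_toPrincipalIdeal]
  exact extended_spanSingleton (M := B⁰) K _ (x : K)

lemma fractionalConj_fractionalConj (s : B ≃+* B) (hs : ∀ b, s (s b) = b)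
    (b : (FractionalIdeal B⁰ K)ˣ) : fractionalConj s (fractionalConj s b) = b := by
  refine Units.ext ((extended_extended (K := K) K _ (b : FractionalIdeal B⁰ K) _).trans ?_)
  exact extended_eq_self _ (RingHom.ext hs) _

end

section

variable {A K B L : Type*} [CommRing A] [IsDomain A] [CommRing B] [IsDomain B] [Algebra A B]
    [Module.IsTorsionFree A B] [Field K] [Field L] [Algebra A K] [Algebra B L]
    [IsFractionRing A K] [IsFractionRing B L]

lemma coe_fractionalExtend_of_coeIdeal {a : (FractionalIdeal A⁰ K)ˣ} {I : Ideal A}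
    (ha : (a : FractionalIdeal A⁰ K) = I) :
    (fractionalExtend A K B L a : FractionalIdeal B⁰ L) = (I.map (algebraMap A B) : Ideal B) := by
  exact (congrArg _ ha).trans (extendedHom_coeIdeal_eq_map (K := K) L B I)

lemma fractionalExtend_toPrincipalIdeal [Algebra K L] [Algebra A L] [IsScalarTower A B L]
    [IsScalarTower A K L] (x : Kˣ) :
    fractionalExtend A K B L (toPrincipalIdeal A K x) =
      toPrincipalIdeal B L (Units.map (algebraMap K L).toMonoidHom x) := by
  refine Units.ext ?_
  have h :
      (IsFractionRing.map (K := K) (L := L) (FaithfulSMul.algebraMap_injective A B) : K →+* L) =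
      algebraMap K L :=
    IsLocalization.ringHom_ext A⁰ (RingHom.ext fun b => by
      simp [IsFractionRing.map, ← IsScalarTower.algebraMap_apply])
  rw [coe_toPrincipalIdeal, Units.coe_map, RingHom.toMonoidHom_eq_coe, MonoidHom.coe_coe, ← h]
  rw [fractionalExtend, Units.coe_map, coe_toPrincipalIdeal]
  exact extendedHom_spanSingleton L B (x : K)

end

end FractionalIdeals

section FixedFractionalIdeals

open NumberField nonZeroDivisors FractionalIdeal

variable {L M : Type*} [Field L] [NumberField L] [Field M] [NumberField M] [Algebra L M]

/-- Every fractional ideal fixed by `s` is extended from below. -/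
lemma ker_divTwist_fractionalConj_le_range (s : 𝓞 M ≃ₐ[𝓞 L] 𝓞 M)
    (hs : ∀ b, s (s b) = b) (hfix : ∀ b, s b = b → b ∈ (algebraMap (𝓞 L) (𝓞 M)).range)
    {ω : 𝓞 M} (hω : IsUnit (ω - s ω)) :
    (divTwist (fractionalConj (K := M) (s : 𝓞 M ≃+* 𝓞 M))).ker ≤
      (fractionalExtend (𝓞 L) L (𝓞 M) M).range := by
  intro b hb
  have hb : fractionalConj (s : 𝓞 M ≃+* 𝓞 M) b = b := (div_eq_one.mp hb).symm
  obtain ⟨a, I, ha, hI⟩ := exists_eq_spanSingleton_mul (b : FractionalIdeal (𝓞 M)⁰ M)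
  obtain ⟨c, hc⟩ := hfix (a * s a) (by rw [map_mul, hs, mul_comm])
  have hsa : s a ≠ 0 := by simpa using ha
  have hc0 : c ≠ 0 := by rintro rfl; simp [ha, hsa] at hc
  have hcL : algebraMap (𝓞 L) L c ≠ 0 := by simpa using hc0
  set x := fractionalExtend (𝓞 L) L (𝓞 M) M (toPrincipalIdeal (𝓞 L) L (Units.mk0 _ hcL)) with hx
  have hxI : (x : FractionalIdeal (𝓞 M)⁰ M) =
      (Ideal.span {algebraMap (𝓞 L) (𝓞 M) c} : Ideal _) := by
    rw [coe_fractionalExtend_of_coeIdeal (I := Ideal.span {c}), Ideal.map_span, Set.image_singleton]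
    rw [coe_toPrincipalIdeal, Units.val_mk0, coeIdeal_span_singleton]
  have hxb : ((x * b : (FractionalIdeal (𝓞 M)⁰ M)ˣ) : FractionalIdeal (𝓞 M)⁰ M) =
      (Ideal.span {s a} * I : Ideal (𝓞 M)) := by
    have haM : algebraMap (𝓞 M) M a ≠ 0 := by simpa using ha
    rw [Units.val_mul, hxI, hI, hc, coeIdeal_mul, ← mul_assoc, coeIdeal_span_singleton,
      coeIdeal_span_singleton, spanSingleton_mul_spanSingleton, map_mul, mul_comm,
      mul_comm (algebraMap _ _ a), mul_inv_cancel_right₀ haM, mul_comm]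
  have hxfix : fractionalConj (s : 𝓞 M ≃+* 𝓞 M) (x * b) = x * b := by
    rw [map_mul, hb]
    congr 1
    refine Units.ext ?_
    rw [coe_fractionalConj_of_coeIdeal _ hxI, hxI, Ideal.map_span, Set.image_singleton]
    exact congrArg (fun y => ((Ideal.span {y} : Ideal (𝓞 M)) : FractionalIdeal (𝓞 M)⁰ M))
      (s.commutes c)
  have hinv := coe_fractionalConj_of_coeIdeal (s : 𝓞 M ≃+* 𝓞 M) hxb
  rw [hxfix, hxb, coeIdeal_inj] at hinv
  have hcomap := Ideal.map_comap_eq_of_isUnit_sub (s : 𝓞 M →+* 𝓞 M) hs hfix hω hinv.ge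
  set I₀ := (Ideal.span {s a} * I).comap (algebraMap (𝓞 L) (𝓞 M))
  have hI₀ : (I₀ : FractionalIdeal (𝓞 L)⁰ L) ≠ 0 := by
    intro h
    rw [coeIdeal_eq_zero] at h
    refine (x * b).ne_zero ?_
    rw [hxb, ← hcomap, h, Ideal.map_bot, coeIdeal_bot]
  refine ⟨(toPrincipalIdeal (𝓞 L) L (Units.mk0 _ hcL))⁻¹ * Units.mk0 _ hI₀, ?_⟩
  have h : fractionalExtend (𝓞 L) L (𝓞 M) M (Units.mk0 _ hI₀) = x * b := Units.ext <| by
    rw [coe_fractionalExtend_of_coeIdeal (Units.val_mk0 hI₀), hcomap, hxb]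
  rw [map_mul, map_inv, h, inv_mul_cancel_left]

/-- The norm classes have index at most two among the fixed classes. -/
theorem relIndex_fixed_le_two [IsGalois L M] (hLM : Module.finrank L M = 2) (s : 𝓞 M ≃ₐ[𝓞 L] 𝓞 M)
    (hs : ∀ b, s (s b) = b) (hfix : ∀ b, s b = b → b ∈ (algebraMap (𝓞 L) (𝓞 M)).range)
    {ω : 𝓞 M} (hω : IsUnit (ω - s ω)) {DL : Subgroup (FractionalIdeal (𝓞 M)⁰ M)ˣ}
    (hDL : ∀ x : Lˣ, toPrincipalIdeal (𝓞 M) M (Units.map (algebraMap L M).toMonoidHom x) ∈ DL) :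
    DL.relIndex (divTwist (fractionalConj (K := M) (s : 𝓞 M ≃+* 𝓞 M))).ker ≠ 0 ∧
    ((mulTwist (fractionalConj (K := M) (s : 𝓞 M ≃+* 𝓞 M))).range ⊔ DL).relIndex
      (divTwist (fractionalConj (K := M) (s : 𝓞 M ≃+* 𝓞 M))).ker ≤ 2 := by
  have hle := ker_divTwist_fractionalConj_le_range s hs hfix hω
  set j := fractionalExtend (𝓞 L) L (𝓞 M) M
  set c : (FractionalIdeal (𝓞 L)⁰ L)ˣ →* ClassGroup (𝓞 L) :=
    (ClassGroup.equiv L).symm.toMonoidHom.comp (QuotientGroup.mk' (toPrincipalIdeal (𝓞 L) L).range)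
    with hcdef
  have hc : Function.Surjective c :=
    (ClassGroup.equiv L).symm.surjective.comp (QuotientGroup.mk'_surjective _)
  have hker : c.ker ≤ DL.comap j := by
    intro x hx
    have hx : (ClassGroup.equiv L).symm (QuotientGroup.mk' _ x) = 1 := hx
    rw [EmbeddingLike.map_eq_one_iff, QuotientGroup.mk'_apply, QuotientGroup.eq_one_iff] at hx
    obtain ⟨y, rfl⟩ := hx
    rw [Subgroup.mem_comap, fractionalExtend_toPrincipalIdeal]
    exact hDL y
  have h0 : ∀ U, DL ≤ U → U.relIndex j.range ≠ 0 := fun U hU => by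
    rw [Subgroup.relIndex_range_eq_index_map j c hc U (hker.trans (Subgroup.comap_mono hU))]
    exact Subgroup.FiniteIndex.index_ne_zero
  refine ⟨fun h => h0 _ le_rfl (Subgroup.relIndex_eq_zero_of_le_right hle h),
    (Subgroup.relIndex_le_of_le_right hle (h0 _ le_sup_right)).trans ?_⟩
  rw [Subgroup.relIndex_range_eq_index_map j c hc _
    (hker.trans (Subgroup.comap_mono le_sup_right))]
  refine index_le_two_of_relNorm_mem hLM _ fun I => ⟨FractionalIdeal.mk0 L (relNorm₀ L I), ?_, ?_⟩
  · refine Subgroup.mem_sup_left ⟨FractionalIdeal.mk0 M I, Units.ext ?_⟩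
    rw [mulTwist_apply, Units.val_mul, coe_fractionalConj_of_coeIdeal _ (coe_mk0 M I),
      coe_mk0, ← coeIdeal_mul, coe_fractionalExtend_of_coeIdeal (coe_mk0 L _)]
    exact congrArg _ (map_relNorm_eq_mul_map hLM s hs hfix hω I).symm
  · change (ClassGroup.equiv L).symm (QuotientGroup.mk' _ _) = _
    rw [← ClassGroup.equiv_mk0, MulEquiv.symm_apply_apply]

end FixedFractionalIdeals

section NormEquation

open NumberField nonZeroDivisors FractionalIdeal

/-- Transfer of the two unit indices along an injective equivariant homomorphism. -/
lemma relIndex_twist_range {A X : Type*} [CommGroup A] [CommGroup X] (ψ : A →* X)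
    (hψ : Function.Injective ψ) (s : A →* A) (σ : X →* X) (h : ∀ a, ψ (s a) = σ (ψ a)) :
    (ψ.range.map (mulTwist σ)).relIndex (ψ.range ⊓ (divTwist σ).ker) =
      (mulTwist s).range.relIndex (divTwist s).ker ∧
    (ψ.range.map (divTwist σ)).relIndex (ψ.range ⊓ (mulTwist σ).ker) =
      (divTwist s).range.relIndex (mulTwist s).ker := by
  have hm : (mulTwist σ).comp ψ = ψ.comp (mulTwist s) := by ext; simp [h]
  have hd : (divTwist σ).comp ψ = ψ.comp (divTwist s) := by ext; simp [h]
  have hker : ∀ f : A →* A, (ψ.comp f).ker = f.ker := fun f => by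
    ext a; simp [MonoidHom.mem_ker, map_eq_one_iff ψ hψ]
  constructor
  · rw [MonoidHom.map_range, hm, ← MonoidHom.map_range, ← Subgroup.map_comap_eq,
      MonoidHom.comap_ker, hd, hker, Subgroup.relIndex_map_map_of_injective _ _ hψ]
  · rw [MonoidHom.map_range, hd, ← MonoidHom.map_range, ← Subgroup.map_comap_eq,
      MonoidHom.comap_ker, hm, hker, Subgroup.relIndex_map_map_of_injective _ _ hψ]

lemma ker_toPrincipalIdeal {B K : Type*} [CommRing B] [IsDomain B] [Field K] [Algebra B K]
    [IsFractionRing B K] :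
    (toPrincipalIdeal B K).ker = (Units.map (algebraMap B K : B →* K)).range := by
  ext x
  rw [MonoidHom.mem_ker, Units.ext_iff, coe_toPrincipalIdeal, Units.val_one]
  constructor
  · intro h
    have h1 : (x : K) ∈ (1 : FractionalIdeal B⁰ K) := h ▸ mem_spanSingleton_self _ _
    have h2 : ((x⁻¹ : Kˣ) : K) ∈ (1 : FractionalIdeal B⁰ K) := by
      have : spanSingleton B⁰ ((x⁻¹ : Kˣ) : K) = 1 := by
        have := spanSingleton_mul_spanSingleton (S := B⁰) (x : K) ((x⁻¹ : Kˣ) : K)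
        rwa [h, one_mul, Units.mul_inv, spanSingleton_one] at this
      exact this ▸ mem_spanSingleton_self _ _
    obtain ⟨a, ha⟩ := (mem_one_iff _).mp h1
    obtain ⟨b, hb⟩ := (mem_one_iff _).mp h2
    have hab : a * b = 1 := IsFractionRing.injective B K (by rw [map_mul, ha, hb, map_one,
      Units.mul_inv])
    exact ⟨Units.mkOfMulEqOne a b hab, Units.ext ha⟩
  · rintro ⟨u, rfl⟩
    refine le_antisymm ?_ ?_
    · rw [spanSingleton_le_iff_mem]
      exact (mem_one_iff _).mpr ⟨u, rfl⟩
    · rw [FractionalIdeal.one_le, mem_spanSingleton]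
      exact ⟨(u⁻¹ : Bˣ), by simp [Algebra.smul_def]⟩

variable {L M : Type*} [Field L] [NumberField L] [Field M] [NumberField M] [Algebra L M]

lemma card_infinitePlace_eq_two_mul [IsTotallyComplex L] [IsTotallyComplex M]
    (hLM : Module.finrank L M = 2) :
    Fintype.card (InfinitePlace M) = 2 * Fintype.card (InfinitePlace L) := by
  have h1 := IsTotallyComplex.finrank (K := M)
  have h2 := IsTotallyComplex.finrank (K := L)
  have h3 := Module.finrank_mul_finrank ℚ L M
  rw [hLM] at h3
  have h4 := InfinitePlace.card_eq_nrRealPlaces_add_nrComplexPlaces (K := M)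
  have h5 := InfinitePlace.card_eq_nrRealPlaces_add_nrComplexPlaces (K := L)
  rw [IsTotallyComplex.nrRealPlaces_eq_zero] at h4 h5
  omega

lemma finrank_units_eq [IsTotallyComplex L] [IsTotallyComplex M]
    (hLM : Module.finrank L M = 2) (s : 𝓞 M ≃ₐ[𝓞 L] 𝓞 M)
    (hfix : ∀ b, s b = b → b ∈ (algebraMap (𝓞 L) (𝓞 M)).range) :
    Module.finrank ℤ (Additive (𝓞 M)ˣ) =
      2 * Module.finrank ℤ (Additive (divTwist (Units.map (s : 𝓞 M →* 𝓞 M))).ker) + 1 := by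
  set ι : (𝓞 L)ˣ →* (𝓞 M)ˣ := Units.map (algebraMap (𝓞 L) (𝓞 M) : 𝓞 L →* 𝓞 M) with hι
  have hinj : Function.Injective (algebraMap (𝓞 L) (𝓞 M)) := FaithfulSMul.algebraMap_injective _ _
  have hιinj : Function.Injective ι := Units.map_injective hinj
  have hker : (divTwist (Units.map (s : 𝓞 M →* 𝓞 M))).ker = ι.range := by
    ext u
    rw [MonoidHom.mem_ker, divTwist_apply, div_eq_one]
    constructor
    · intro hu
      have hu : Units.map (s : 𝓞 M →* 𝓞 M) u = u := hu.symm
      obtain ⟨a, ha⟩ := hfix u (congrArg Units.val hu)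
      obtain ⟨b, hb⟩ := hfix (u⁻¹ : (𝓞 M)ˣ) (congrArg Units.val (by rw [map_inv, hu] :
        Units.map (s : 𝓞 M →* 𝓞 M) u⁻¹ = u⁻¹))
      have hab : a * b = 1 := hinj (by rw [map_mul, ha, hb, map_one, Units.mul_inv])
      exact ⟨Units.mkOfMulEqOne a b hab, Units.ext ha⟩
    · rintro ⟨v, rfl⟩
      exact Units.ext (s.commutes v).symm
  have hfr : Module.finrank ℤ (Additive ι.range) = Module.finrank ℤ (Additive (𝓞 L)ˣ) :=
    (MulEquiv.toAdditive (MonoidHom.ofInjective hιinj)).toIntLinearEquiv.finrank_eq.symm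
  rw [hker, hfr, Units.finrank_eq, Units.finrank_eq, Units.rank, Units.rank,
    card_infinitePlace_eq_two_mul hLM]
  have : 0 < Fintype.card (InfinitePlace L) := Fintype.card_pos
  omega

/-- In an everywhere unramified quadratic extension of totally complex number fields, `-1` is a
norm. -/
theorem exists_mul_conj_eq_neg_one [IsTotallyComplex L] [IsTotallyComplex M] [IsGalois L M]
    (hLM : Module.finrank L M = 2) (σ : M ≃ₐ[L] M) (hσ : ∀ x, σ (σ x) = x)
    (hgen : ∀ x, σ x = x → x ∈ (algebraMap L M).range) {ω : 𝓞 M}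
    (hω : IsUnit (ω - RingOfIntegers.mapAlgEquiv σ ω)) : ∃ z : M, z * σ z = -1 := by
  set s : 𝓞 M ≃ₐ[𝓞 L] 𝓞 M := RingOfIntegers.mapAlgEquiv σ with hs_def
  have hcoe : ∀ b : 𝓞 M, ((s b : 𝓞 M) : M) = σ b := fun b => rfl
  have hs : ∀ b, s (s b) = b := fun b => RingOfIntegers.ext (hσ b)
  have hfix : ∀ b, s b = b → b ∈ (algebraMap (𝓞 L) (𝓞 M)).range :=
    mem_range_algebraMap_ringOfIntegers σ hgen
  set σX : Mˣ →* Mˣ := Units.map (σ : M →* M) with hσX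
  set sU : (𝓞 M)ˣ →* (𝓞 M)ˣ := Units.map (s : 𝓞 M →* 𝓞 M) with hsU
  set τ := fractionalConj (K := M) (s : 𝓞 M ≃+* 𝓞 M) with hτ
  set ψ : (𝓞 M)ˣ →* Mˣ := Units.map (algebraMap (𝓞 M) M : 𝓞 M →* M) with hψ
  set d := toPrincipalIdeal (𝓞 M) M with hd
  have hψinj : Function.Injective ψ := Units.map_injective (IsFractionRing.injective (𝓞 M) M)
  have hdker : d.ker = ψ.range := ker_toPrincipalIdeal
  have hDL : ∀ x : Lˣ, d (Units.map (algebraMap L M).toMonoidHom x) ∈ (divTwist σX).ker.map d :=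
    fun x => ⟨_, div_eq_one.mpr (Units.ext (σ.commutes x).symm), rfl⟩
  obtain ⟨hfin', hB⟩ := relIndex_fixed_le_two hLM s hs hfix hω hDL
  obtain ⟨hA, hA0⟩ := two_mul_relIndex_range_mulTwist sU (fun a => Units.ext (hs a)) (ε := -1)
    (fun h => by
      have := congrArg (fun u : (𝓞 M)ˣ => ((u : 𝓞 M) : M)) h
      norm_num at this)
    (by norm_num) (fun a ha => by
      have : (a : 𝓞 M) ^ 2 = 1 := by rw [← Units.val_pow_eq_pow_val, ha, Units.val_one]
      exact (sq_eq_one_iff.mp this).imp Units.ext Units.ext)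
    (Units.ext (by simp [hsU])) (finrank_units_eq hLM s hfix)
  obtain ⟨e₁, e₂⟩ := relIndex_twist_range ψ hψinj sU σX fun a => Units.ext rfl
  have key := mem_range_mulTwist_of_index_le σX τ d (fun x => Units.ext (hσ x))
    (fractionalConj_fractionalConj _ hs)
    (fun x => (fractionalConj_toPrincipalIdeal (s : 𝓞 M ≃+* 𝓞 M) (σ : M →+* M)
      (fun b => (hcoe b).symm) x).symm) ?_ ?_ hfin' hB (by rw [hdker, e₁, e₂, hA])
      (by rwa [hdker, e₁])
  · have hmem : (-1 : Mˣ) ∈ d.ker ⊓ (divTwist σX).ker := by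
      refine ⟨?_, ?_⟩
      · rw [hdker]; exact ⟨-1, Units.ext (by simp [hψ])⟩
      · exact div_eq_one.mpr (Units.ext (by simp [hσX]))
    obtain ⟨z, hz⟩ := key hmem
    exact ⟨z, congrArg Units.val hz⟩
  · intro x hx
    have hx : (x : M) * σ x = 1 := congrArg Units.val (show x * σX x = 1 from hx)
    by_cases h1 : 1 + (x : M) = 0
    · have hω0 : algebraMap (𝓞 M) M (ω - s ω) ≠ 0 :=
        (map_ne_zero_iff _ (IsFractionRing.injective _ _)).mpr hω.ne_zero
      refine ⟨Units.mk0 _ hω0, ?_⟩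
      rw [divTwist_apply, div_eq_iff_eq_mul]
      refine Units.ext ?_
      have hx1 : (x : M) = -1 := by linear_combination h1
      change algebraMap (𝓞 M) M (ω - s ω) = x * σ (algebraMap (𝓞 M) M (ω - s ω))
      have : σ (algebraMap (𝓞 M) M (ω - s ω)) = algebraMap (𝓞 M) M (s ω - ω) := by
        rw [← RingOfIntegers.coe_eq_algebraMap, ← hcoe, map_sub, hs]
      rw [this, hx1, map_sub, map_sub]
      ring
    · refine ⟨Units.mk0 _ h1, ?_⟩
      rw [divTwist_apply, div_eq_iff_eq_mul]
      refine Units.ext ?_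
      change 1 + (x : M) = x * σ (1 + x)
      rw [map_add, map_one, mul_add, hx, mul_one, add_comm]
  · have : Finite ((FractionalIdeal (𝓞 M)⁰ M)ˣ ⧸ d.range) :=
      Finite.of_equiv _ (ClassGroup.equiv (R := 𝓞 M) M).toEquiv
    exact Subgroup.index_ne_zero_of_finite

end NormEquation

section LevelTwo

open NumberField Polynomial

lemma exists_involution {L M : Type*} [Field L] [Field M] [Algebra L M] [IsGalois L M]
    (hLM : Module.finrank L M = 2) :
    ∃ σ : M ≃ₐ[L] M, (∀ x, σ (σ x) = x) ∧ ∀ x, σ x = x → x ∈ (algebraMap L M).range := by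
  have : FiniteDimensional L M := Module.finite_of_finrank_eq_succ hLM
  have hcard : Nat.card (M ≃ₐ[L] M) = 2 := (IsGalois.card_aut_eq_finrank L M).trans hLM
  have : Fact (Nat.Prime 2) := ⟨Nat.prime_two⟩
  obtain ⟨σ, hσ⟩ := (Nat.card_eq_two_iff' (1 : M ≃ₐ[L] M)).mp hcard
  refine ⟨σ, fun x => ?_, fun x hx => ?_⟩
  · have h : σ ^ 2 = 1 := hcard ▸ pow_card_eq_one'
    rw [sq] at h
    exact AlgEquiv.congr_fun h x
  · refine (IsGalois.mem_range_algebraMap_iff_fixed x).mpr fun f => ?_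
    by_cases hf : f = 1
    · rw [hf, AlgEquiv.one_apply]
    · rw [hσ.2 f hf, hx]

lemma exists_sq_add_sq_eq_neg_one_of_finrank_eq_two {L M : Type*} [Field L] [NumberField L]
    [IsTotallyComplex L] [Field M] [NumberField M] [Algebra L M] (hLM : Module.finrank L M = 2)
    (hL : ¬∃ i : L, i ^ 2 = -1) {i : M} (hi : i ^ 2 = -1) (t : 𝓞 L) (ht : 8 ∣ t ^ 2 + 1) :
    ∃ x y : L, x ^ 2 + y ^ 2 = -1 := by
  have : IsTotallyComplex M := isTotallyComplex_of_algebra L M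
  have : Algebra.IsQuadraticExtension L M := { finrank_eq_two' := hLM }
  obtain ⟨σ, hσ, hgen⟩ := exists_involution hLM
  have hσi : σ i = -i := by
    have h : (σ i - i) * (σ i + i) = 0 := by
      have := congrArg σ hi
      rw [map_pow, map_neg, map_one] at this
      linear_combination this - hi
    rcases mul_eq_zero.mp h with h | h
    · obtain ⟨j, hj⟩ := hgen i (sub_eq_zero.mp h)
      refine absurd ⟨j, (algebraMap L M).injective ?_⟩ hL
      rw [map_pow, hj, hi, map_neg, map_one]
    · exact eq_neg_of_add_eq_zero_left h
  have hi0 : i ≠ 0 := fun h => by simp [h] at hi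
  obtain ⟨s, hs⟩ := ht
  have hω : IsIntegral (𝓞 L) ((algebraMap (𝓞 L) M t - i) / 2) := by
    refine ⟨X ^ 2 + (C (-t) * X + C (2 * s)), monic_X_pow_add (by compute_degree!), ?_⟩
    have hs' : algebraMap (𝓞 L) M t ^ 2 + 1 = 8 * algebraMap (𝓞 L) M s := by
      simpa only [map_add, map_pow, map_one, map_mul, map_ofNat]
        using (congrArg (algebraMap (𝓞 L) M) hs)
    simp only [eval₂_add, eval₂_mul, eval₂_pow, eval₂_X, eval₂_C, map_neg, map_mul, map_ofNat,
      eval₂_neg, eval₂_ofNat]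
    linear_combination hi / 4 - hs' / 4
  let ω : 𝓞 M := ⟨_, isIntegral_trans (R := ℤ) (A := 𝓞 L) _ hω⟩
  have hωM : (ω : M) = (algebraMap (𝓞 L) M t - i) / 2 := rfl
  have hunit : IsUnit (ω - RingOfIntegers.mapAlgEquiv σ ω) := by
    refine IsUnit.of_pow_eq_one (n := 4) (RingOfIntegers.ext ?_) (by norm_num)
    have h1 : ((RingOfIntegers.mapAlgEquiv σ ω : 𝓞 M) : M) = (algebraMap (𝓞 L) M t + i) / 2 := by
      change σ (ω : M) = _
      rw [hωM, map_div₀, map_sub, hσi, map_ofNat, IsScalarTower.algebraMap_apply (𝓞 L) L M,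
        σ.commutes]
      ring
    rw [RingOfIntegers.coe_eq_algebraMap] at h1 ⊢
    rw [map_pow, map_sub, h1, RingOfIntegers.coe_eq_algebraMap, map_one,
        ← RingOfIntegers.coe_eq_algebraMap, hωM]
    linear_combination (i ^ 2 - 1) * hi
  obtain ⟨z, hz⟩ := exists_mul_conj_eq_neg_one hLM σ hσ hgen hunit
  obtain ⟨a, ha⟩ := hgen ((z + σ z) / 2) (by rw [map_div₀, map_add, hσ, map_ofNat, add_comm])
  obtain ⟨b, hb⟩ := hgen ((z - σ z) / (2 * i)) (by
    rw [map_div₀, map_sub, map_mul, hσ, map_ofNat, hσi]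
    field_simp
    ring)
  refine ⟨a, b, (algebraMap L M).injective ?_⟩
  rw [map_add, map_pow, map_pow, ha, hb, map_neg, map_one, ← hz, div_pow, div_pow, mul_pow, hi]
  ring

/-- A totally complex number field in which `-1` is a square modulo `8` has level at most `2`. -/
theorem level_two {L : Type*} [Field L] [NumberField L] [IsTotallyComplex L] (t : 𝓞 L)
    (ht : 8 ∣ t ^ 2 + 1) : ∃ x y : L, x ^ 2 + y ^ 2 = -1 := by
  by_cases hL : ∃ i : L, i ^ 2 = -1
  · obtain ⟨i, hi⟩ := hL
    exact ⟨i, 0, by rw [hi]; ring⟩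
  have hdeg : (X ^ 2 - C (-1) : L[X]).natDegree = 2 := natDegree_X_pow_sub_C
  have hirr : Irreducible (X ^ 2 - C (-1) : L[X]) := by
    rw [irreducible_iff_roots_eq_zero_of_degree_le_three (by rw [hdeg]) (by rw [hdeg]; norm_num)]
    refine Multiset.eq_zero_of_forall_notMem fun i hi => hL ⟨i, ?_⟩
    have := isRoot_of_mem_roots hi
    simpa [sub_eq_zero, add_eq_zero_iff_eq_neg] using this
  have : Fact (Irreducible (X ^ 2 - C (-1) : L[X])) := ⟨hirr⟩
  let M := AdjoinRoot (X ^ 2 - C (-1) : L[X])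
  have hLM : Module.finrank L M = 2 :=
    ((AdjoinRoot.powerBasis hirr.ne_zero).finrank.trans (AdjoinRoot.powerBasis_dim _)).trans hdeg
  have : Module.Finite L M := Module.finite_of_finrank_eq_succ hLM
  have : NumberField M := NumberField.of_module_finite L M
  refine exists_sq_add_sq_eq_neg_one_of_finrank_eq_two hLM hL (i := AdjoinRoot.root _) ?_ t ht
  have := AdjoinRoot.eval₂_root (X ^ 2 - C (-1) : L[X])
  simpa [add_eq_zero_iff_eq_neg] using this

end LevelTwo

section SumFourSquaresExistence

open NumberField Polynomial Filter

namespace Polynomial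

theorem IsSumFourSq.map {F F' : Type*} [Field F] [Field F'] (φ : F →+* F') {p : F[X]}
    (hp : p.IsSumFourSq) : (p.map φ).IsSumFourSq := by
  obtain ⟨d, a, b, c, e, hd, h⟩ := hp
  refine ⟨d.map φ, a.map φ, b.map φ, c.map φ, e.map φ, ?_, ?_⟩
  · rwa [Ne, Polynomial.map_eq_zero]
  · simpa using congrArg (Polynomial.map φ) h

/-- A monic real polynomial of even degree is bounded below. -/
theorem exists_lower_bound_of_monic {p : ℝ[X]} (hp : p.Monic) (h0 : p.natDegree ≠ 0)
    (he : Even p.natDegree) : ∃ M : ℝ, ∀ x, M ≤ p.eval x := by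
  have key : ∀ q : ℝ[X], q.natDegree = p.natDegree → q.leadingCoeff = 1 →
      Tendsto (fun x => q.eval x) atTop atTop := fun q hq hl =>
    q.tendsto_atTop_of_leadingCoeff_nonneg
      (natDegree_pos_iff_degree_pos.1 (by omega)) (by rw [hl]; exact zero_le_one)
  have h1 := key p rfl hp
  have h2 := key (p.comp (-X)) (by simp [natDegree_comp]) (by
    rw [leadingCoeff_comp (by simp)]; simp [hp.leadingCoeff, he])
  have h3 : Tendsto (fun x => p.eval x) atBot atTop := by
    refine (h2.comp tendsto_neg_atBot_atTop).congr fun x => ?_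
    simp
  have h4 : Tendsto (fun x => p.eval x) (cocompact ℝ) atTop := by
    rw [cocompact_eq_atBot_atTop]
    exact h3.sup h1
  obtain ⟨x, hx⟩ := p.continuous.exists_forall_le h4
  exact ⟨p.eval x, hx⟩

end Polynomial

theorem NumberField.exists_isSumFourSq_add_C {F : Type*} [Field F] [NumberField F] (φ : F →+* ℝ)
    {g : F[X]} (hg : g.Monic) (h0 : g.natDegree ≠ 0) (he : Even g.natDegree) :
    ∃ ξ : F, (g + C ξ).IsSumFourSq := by
  classical
  obtain ⟨N, hN⟩ := he
  rw [← two_mul] at hN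
  obtain ⟨D, hD0, hD⟩ := exists_integral_multiples ℤ ℚ (L := F) (g.support.image g.coeff)
  have hDj : ∀ j, IsIntegral ℤ ((D : F) * g.coeff j) := fun j => by
    by_cases hj : g.coeff j = 0
    · simpa [hj] using isIntegral_zero
    · have := hD (g.coeff j) (Finset.mem_image_of_mem _ (by simpa using hj))
      rwa [zsmul_eq_mul] at this
  set B : F := 8 * D with hB
  have hB0 : B ≠ 0 := by simp [hB, hD0]
  have hBint : IsIntegral ℤ B := by
    have : B = algebraMap ℤ F (8 * D) := by simp [hB]
    rw [this]; exact isIntegral_algebraMap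
  have hfin : Finite (F →+* ℝ) := by
    refine Finite.of_injective (fun ρ : F →+* ℝ => Complex.ofRealHom.comp ρ) fun ρ ρ' h => ?_
    ext x
    have := congrArg (fun r : F →+* ℂ => r x) h
    simpa using this
  have hbd : ∀ ρ : F →+* ℝ, ∃ M : ℝ, ∀ x, M ≤ (g.map ρ).eval x := fun ρ =>
    exists_lower_bound_of_monic (hg.map ρ) (by simpa using h0) (by simp [hN])
  choose M hM using hbd
  obtain ⟨e, he⟩ : ∃ e : ℕ, ∀ ρ : F →+* ℝ, - M ρ * ρ B ^ (2 * N) < 8 * e + 1 := by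
    obtain ⟨S, hS⟩ := (Set.finite_range fun ρ : F →+* ℝ => - M ρ * ρ B ^ (2 * N)).bddAbove
    obtain ⟨e, he⟩ := exists_nat_gt S
    refine ⟨e, fun ρ => ?_⟩
    have := hS ⟨ρ, rfl⟩
    have he' : (0 : ℝ) ≤ e := Nat.cast_nonneg e
    simp only at this
    linarith
  set ξ : F := (8 * e + 1) / B ^ (2 * N) with hξ
  have hpos : ∀ (ρ : F →+* ℝ) (x : ℝ), 0 < (g.map ρ).eval x + ρ ξ := fun ρ x => by
    have hBρ : 0 < ρ B ^ (2 * N) := by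
      rw [pow_mul]; exact pow_pos (by positivity [(map_ne_zero ρ).2 hB0]) _
    have h1 : ρ ξ = (8 * e + 1) / ρ B ^ (2 * N) := by
      rw [hξ, map_div₀, map_add, map_mul, map_one, map_natCast, map_pow, map_ofNat ρ 8]
    have h2 : - M ρ < ρ ξ := by
      rw [h1, lt_div_iff₀ hBρ]; exact he ρ
    linarith [hM ρ x]
  have hmonic : (g + C ξ).Monic := hg.add_of_left (by
    refine degree_C_le.trans_lt ?_
    exact natDegree_pos_iff_degree_pos.1 (by omega))
  have hdeg : (g + C ξ).natDegree = 2 * N := by rw [natDegree_add_C, hN]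
  refine ⟨ξ, isSumFourSq_of_factors φ hmonic fun q hq hqg => ?_⟩
  have : Fact (Irreducible q) := ⟨hq⟩
  let L := AdjoinRoot q
  have : FiniteDimensional F L := (AdjoinRoot.powerBasis hq.ne_zero).finite
  have : CharZero L := charZero_of_injective_algebraMap (algebraMap F L).injective
  have : FiniteDimensional ℚ L := FiniteDimensional.trans ℚ F L
  have : NumberField L := { }
  let θ : L := AdjoinRoot.root q
  have hθ : aeval θ (g + C ξ) = 0 := by
    rw [AdjoinRoot.aeval_eq, AdjoinRoot.mk_eq_zero]; exact hqg
  have : IsTotallyComplex L := ⟨fun v => by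
    by_contra hv
    rw [InfinitePlace.not_isComplex_iff_isReal] at hv
    let ψ : L →+* ℝ := InfinitePlace.embedding_of_isReal hv
    have h1 := congrArg ψ hθ
    rw [map_zero, aeval_def, hom_eval₂, eval₂_eq_eval_map, Polynomial.map_add, eval_add, map_C,
      eval_C] at h1
    exact (hpos (ψ.comp (algebraMap F L)) (ψ θ)).ne' h1⟩
  set w : L := algebraMap F L B * θ with hw
  have hcoef : ∀ j < 2 * N, ∃ z : 𝓞 L,
      (algebraMap F L (g.coeff j * B ^ (2 * N - j)) : L) = 8 * z := fun j hj => by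
    have h1 : IsIntegral ℤ ((D : F) * g.coeff j * B ^ (2 * N - j - 1)) :=
      (hDj j).mul (hBint.pow _)
    refine ⟨⟨algebraMap F L ((D : F) * g.coeff j * B ^ (2 * N - j - 1)), h1.algebraMap⟩, ?_⟩
    obtain ⟨i, hi⟩ : ∃ i, 2 * N - j = i + 1 := ⟨2 * N - j - 1, by omega⟩
    have h2 : g.coeff j * B ^ (2 * N - j) =
        8 * ((D : F) * g.coeff j * B ^ (2 * N - j - 1)) := by
      rw [hi, Nat.add_sub_cancel, pow_succ]
      nth_rewrite 2 [hB]
      ring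
    rw [h2, map_mul, map_ofNat (algebraMap F L) 8]
    rfl
  choose! z hz using hcoef
  have hrel : w ^ (2 * N) + ∑ j ∈ Finset.range (2 * N), 8 * (z j : L) * w ^ j + (8 * e + 1) =
      0 := by
    have hθ' : θ ^ (2 * N) + ∑ j ∈ Finset.range (2 * N), algebraMap F L (g.coeff j) * θ ^ j +
        algebraMap F L ξ = 0 := by
      rw [← hθ, map_add, aeval_C, aeval_eq_sum_range, hN, Finset.sum_range_succ]
      have : g.coeff (2 * N) = 1 := by rw [← hN]; exact hg
      simp only [Algebra.smul_def, this, map_one, one_mul]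
      ring
    have hE : algebraMap F L B ^ (2 * N) * algebraMap F L ξ = 8 * e + 1 := by
      rw [← map_pow, ← map_mul, hξ, mul_div_cancel₀ _ (pow_ne_zero _ hB0)]
      rw [map_add, map_mul, map_natCast, map_one, map_ofNat (algebraMap F L) 8]
    rw [← mul_zero (algebraMap F L B ^ (2 * N)), ← hθ', mul_add, mul_add, hE, Finset.mul_sum, hw,
      mul_pow]
    congr 2
    refine Finset.sum_congr rfl fun j hj => ?_
    have hj := Finset.mem_range.1 hj
    rw [← hz j hj, map_mul, map_pow, mul_pow, ← Nat.sub_add_cancel hj.le, pow_add,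
      Nat.sub_add_cancel hj.le]
    ring
  have hwint : IsIntegral ℤ w := by
    have hmon : ((X : (𝓞 L)[X]) ^ (2 * N) + (∑ j ∈ Finset.range (2 * N), C (8 * z j) * X ^ j +
        C (8 * (e : 𝓞 L) + 1))).Monic := by
      refine monic_X_pow_add ?_
      refine (degree_add_le _ _).trans_lt (max_lt ?_ ?_)
      · refine (degree_sum_le _ _).trans_lt ?_
        rw [Finset.sup_lt_iff (WithBot.bot_lt_coe _)]
        intro j hj
        exact (degree_C_mul_X_pow_le _ _).trans_lt (by exact_mod_cast Finset.mem_range.1 hj)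
      · exact degree_C_le.trans_lt (by exact_mod_cast (by omega : 0 < 2 * N))
    have : IsIntegral (𝓞 L) w := by
      refine ⟨_, hmon, ?_⟩
      rw [← hrel]
      simp [eval₂_finsetSum, add_assoc, map_ofNat (algebraMap (𝓞 L) L) 8]
    exact isIntegral_trans (R := ℤ) (A := 𝓞 L) _ this
  let W : 𝓞 L := ⟨w, hwint⟩
  obtain ⟨x, y, hxy⟩ := level_two (W ^ N)
    (⟨-(∑ j ∈ Finset.range (2 * N), z j * W ^ j + e), by
      apply RingOfIntegers.ext
      have hW : (W : L) = w := rfl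
      simp only [map_add, map_pow, map_one, map_mul, map_neg, map_sum, map_natCast, hW]
      have h8 : algebraMap (𝓞 L) L 8 = 8 := map_ofNat _ 8
      rw [h8, mul_neg, mul_add, Finset.mul_sum, ← pow_mul, mul_comm N 2]
      simp only [← mul_assoc]
      linear_combination hrel⟩)
  obtain ⟨a, rfl⟩ := AdjoinRoot.mk_surjective x
  obtain ⟨b, rfl⟩ := AdjoinRoot.mk_surjective y
  refine ⟨a, b, ?_⟩
  rw [← AdjoinRoot.mk_eq_zero, map_add, map_add, map_pow, map_pow, map_one, hxy]
  ring

theorem exists_isSumFourSq_add_C_of_real {k : Type*} [Field k] [CharZero k]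
    [Algebra.IsAlgebraic ℚ k] (φ : k →+* ℝ) {g : k[X]} (hg : g.Monic) (h0 : g.natDegree ≠ 0)
    (he : Even g.natDegree) : ∃ ξ : k, (g + C ξ).IsSumFourSq := by
  classical
  let F := IntermediateField.adjoin ℚ (g.coeffs : Set k)
  have : FiniteDimensional ℚ F := IntermediateField.finiteDimensional_adjoin
    fun x _ => (Algebra.IsAlgebraic.isAlgebraic (R := ℚ) x).isIntegral
  have : NumberField F := { }
  have hl : g ∈ Polynomial.lifts (algebraMap F k) := by
    rw [lifts_iff_coeff_lifts]
    intro n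
    by_cases hn : g.coeff n = 0
    · exact ⟨0, by simp [hn]⟩
    · exact ⟨⟨g.coeff n, IntermediateField.subset_adjoin _ _ (coeff_mem_coeffs hn)⟩, rfl⟩
  obtain ⟨g₀, hg₀, hd, hm⟩ := lifts_and_natDegree_eq_and_monic hl hg
  obtain ⟨ξ, hξ⟩ := NumberField.exists_isSumFourSq_add_C (φ.comp (algebraMap F k)) hm
    (by rwa [hd]) (by rwa [hd])
  refine ⟨algebraMap F k ξ, ?_⟩
  have := hξ.map (algebraMap F k)
  rwa [Polynomial.map_add, hg₀, map_C] at this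

/-- The existence half of the theorem, in terms of rational functions over `k`. -/
theorem exists_isSumFourSq_cubic {k : Type*} [Field k] [CharZero k]
    [Algebra.IsAlgebraic ℚ k] (φ : k →+* ℝ) (P : k[X]) (h0 : P.natDegree ≠ 0)
    (he : Even P.natDegree) : ∃ ξ₁ ξ₂ ξ₃ : k, ξ₁ ≠ 0 ∧ ξ₂ ≠ 0 ∧
      (C ξ₁ * P ^ 3 + C ξ₂ * X + C ξ₃).IsSumFourSq := by
  have hP : P.leadingCoeff ≠ 0 := by
    rw [Ne, leadingCoeff_eq_zero]; rintro rfl; simp at h0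
  have hc : (P.leadingCoeff ^ 3)⁻¹ ≠ 0 := inv_ne_zero (pow_ne_zero 3 hP)
  have hd : (C (P.leadingCoeff ^ 3)⁻¹ * P ^ 3).natDegree = 3 * P.natDegree := by
    rw [natDegree_C_mul hc, natDegree_pow]
  have hm : (C (P.leadingCoeff ^ 3)⁻¹ * P ^ 3).Monic := by
    rw [Monic, leadingCoeff_mul, leadingCoeff_C, leadingCoeff_pow]
    exact inv_mul_cancel₀ (pow_ne_zero 3 hP)
  have hlt : (X : k[X]).natDegree < (C (P.leadingCoeff ^ 3)⁻¹ * P ^ 3).natDegree := by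
    rw [hd, natDegree_X]; omega
  have hd' : (C (P.leadingCoeff ^ 3)⁻¹ * P ^ 3 + X).natDegree = 3 * P.natDegree := by
    rw [natDegree_add_eq_left_of_natDegree_lt hlt, hd]
  obtain ⟨ξ, hξ⟩ := exists_isSumFourSq_add_C_of_real φ
    (hm.add_of_left (degree_lt_degree hlt)) (by rw [hd']; omega)
    (by rw [hd']; exact he.mul_left 3)
  exact ⟨_, 1, ξ, hc, one_ne_zero, by simpa using hξ⟩

end SumFourSquaresExistence

/-- the four-squares form over a formally real constant field
algebraic over `ℚ` containing `√2`. -/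
theorem quadratic_form_real_case
    (k : Type*) [Field k] [CharZero k] [Algebra.IsAlgebraic ℚ k]
    (hreal : Nonempty (k →+* ℝ))
    (hsqrt2 : ∃ r : k, r ^ 2 = 2)
    (K : Type*) [Field K] [Algebra k K]
    (T : K) (hT : Transcendental k T)
    (hfin : FiniteDimensional (IntermediateField.adjoin k {T}) K)
    (hrelclosed : ∀ x : K, IsAlgebraic k x → ∃ c : k, algebraMap k K c = x)
    (q : FFPrime k K) (hdeg : q.DegreeOne) (hordT : q.ord T = -1) :
    (∀ f : K, Odd (q.ord f) → ∀ ξ₁ ξ₂ ξ₃ : k, ξ₁ ≠ 0 → ξ₂ ≠ 0 →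
      ¬ ∃ X Y Z W : K,
        X ^ 2 + Y ^ 2 + Z ^ 2 + W ^ 2 =
          algebraMap k K ξ₁ * f ^ 3 + algebraMap k K ξ₂ * T + algebraMap k K ξ₃) ∧
    (∀ P : Polynomial k, P.natDegree ≠ 0 → Even P.natDegree →
      ∃ ξ₁ ξ₂ ξ₃ : k, ξ₁ ≠ 0 ∧ ξ₂ ≠ 0 ∧ ∃ X Y Z W : K,
        X ^ 2 + Y ^ 2 + Z ^ 2 + W ^ 2 =
          algebraMap k K ξ₁ * (Polynomial.aeval T P) ^ 3 +
            algebraMap k K ξ₂ * T + algebraMap k K ξ₃) := by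
  obtain ⟨φ⟩ := hreal
  refine ⟨fun f hf ξ₁ ξ₂ ξ₃ h₁ h₂ ⟨x, y, z, w, h⟩ => ?_, fun P h0 he => ?_⟩
  · have heven := q.even_ord_sum_four_sq hdeg φ ![x, y, z, w]
    rw [Fin.sum_univ_four] at heven
    simp only [Matrix.cons_val] at heven
    rw [h] at heven
    exact Int.not_even_iff_odd.mpr (q.odd_ord_cubic hordT hf h₁ h₂) heven
  · obtain ⟨ξ₁, ξ₂, ξ₃, h₁, h₂, d, a, b, c, e, hd, h⟩ :=
      exists_isSumFourSq_cubic φ P h0 he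
    refine ⟨ξ₁, ξ₂, ξ₃, h₁, h₂, Polynomial.aeval T a / Polynomial.aeval T d,
      Polynomial.aeval T b / Polynomial.aeval T d, Polynomial.aeval T c / Polynomial.aeval T d,
      Polynomial.aeval T e / Polynomial.aeval T d, ?_⟩
    have hd0 : Polynomial.aeval T d ≠ 0 := fun hz => hT ⟨d, hd, hz⟩
    have hh := congrArg (Polynomial.aeval T) h
    simp only [map_mul, map_add, map_pow, Polynomial.aeval_C, Polynomial.aeval_X] at hh
    rw [div_pow, div_pow, div_pow, div_pow, ← add_div, ← add_div, ← add_div, ← hh,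
      mul_div_cancel_left₀ _ (pow_ne_zero 2 hd0)]
end

section
/- For every positive integer d and every s ∈ {−1, 1}, there exist infinitely many positive integers n of the special form (n = pm with p prime and m dividing p−1) such that the n-th cyclotomic polynomial satisfies Φ_n(T) ≡ 1 + s·T^d (mod T^{2d}) in ℤ[T]. -/
open Polynomial

/-- A positive integer is of the special form if it is `p * m` with `p` prime and
`m` dividing `p − 1`. -/
def SpecialForm (n : ℕ) : Prop :=
  ∃ p m : ℕ, p.Prime ∧ m ∣ p - 1 ∧ n = p * m

theorem coeff_one_cyclotomic_mul_prime {p n : ℕ} (hp : p.Prime) (hn : 1 < n) (hdiv : ¬p ∣ n) :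
    (cyclotomic (n * p) ℤ).coeff 1 = -(cyclotomic n ℤ).coeff 1 := by
  have h := congrArg (fun f : ℤ[X] => f.coeff 1) (cyclotomic_expand_eq_cyclotomic_mul hp hdiv ℤ)
  have hnp : 1 < n * p := lt_of_lt_of_le hn (Nat.le_mul_of_pos_right n hp.pos)
  simp only [coeff_expand hp.pos, Nat.dvd_one, hp.ne_one, if_false, mul_coeff_one,
    cyclotomic_coeff_zero ℤ hn, cyclotomic_coeff_zero ℤ hnp] at h
  linarith

theorem exists_forall_prime_dvd_and_coeff_one_cyclotomic (d : ℕ) (hd : d ≠ 0) :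
    ∃ n : ℕ, 1 < n ∧ (∀ q : ℕ, q.Prime → q ∣ d → q ∣ n) ∧
      ((cyclotomic n ℤ).coeff 1 = 1 ∨ (cyclotomic n ℤ).coeff 1 = -1) := by
  induction d using induction_on_primes with
  | zero => exact absurd rfl hd
  | one =>
    refine ⟨2, one_lt_two, fun q hq h => absurd (Nat.dvd_one.1 h) hq.ne_one, Or.inl ?_⟩
    simp [cyclotomic_two, coeff_one]
  | prime_mul p a hp ih =>
    obtain ⟨n, hn, hdvd, h⟩ := ih (right_ne_zero_of_mul hd)
    by_cases hpn : p ∣ n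
    · refine ⟨n, hn, fun q hq hqd => ?_, h⟩
      rcases hq.dvd_mul.1 hqd with hqp | hqa
      · exact hqp.trans hpn
      · exact hdvd q hq hqa
    · refine ⟨n * p, lt_of_lt_of_le hn (Nat.le_mul_of_pos_right n hp.pos), fun q hq hqd => ?_, ?_⟩
      · rcases hq.dvd_mul.1 hqd with hqp | hqa
        · exact hqp.mul_left n
        · exact (hdvd q hq hqa).mul_right p
      · rw [coeff_one_cyclotomic_mul_prime hp hn hpn]
        lia

theorem exists_forall_prime_dvd_and_coeff_one_cyclotomic_eq (d : ℕ) (hd : d ≠ 0) (s : ℤ)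
    (hs : s = 1 ∨ s = -1) :
    ∃ n : ℕ, 1 < n ∧ (∀ q : ℕ, q.Prime → q ∣ d → q ∣ n) ∧ (cyclotomic n ℤ).coeff 1 = s := by
  obtain ⟨n, hn, hdvd, h⟩ := exists_forall_prime_dvd_and_coeff_one_cyclotomic d hd
  by_cases hc : (cyclotomic n ℤ).coeff 1 = s
  · exact ⟨n, hn, hdvd, hc⟩
  · obtain ⟨p, hnp, hp⟩ := Nat.exists_infinite_primes (n + 1)
    refine ⟨n * p, lt_of_lt_of_le hn (Nat.le_mul_of_pos_right n hp.pos),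
      fun q hq h => (hdvd q hq h).mul_right p, ?_⟩
    rw [coeff_one_cyclotomic_mul_prime hp hn (Nat.not_dvd_of_pos_of_lt (by lia) (by lia))]
    lia

theorem expand_cyclotomic_of_forall_prime_dvd {d n : ℕ} (hd : d ≠ 0)
    (hdvd : ∀ q : ℕ, q.Prime → q ∣ d → q ∣ n) (R : Type*) [CommRing R] :
    expand R d (cyclotomic n R) = cyclotomic (n * d) R := by
  induction d using induction_on_primes with
  | zero => exact absurd rfl hd
  | one => simp
  | prime_mul p a hp ih =>
    rw [expand_mul, ih (right_ne_zero_of_mul hd) fun q hq h => hdvd q hq (h.mul_left p),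
      cyclotomic_expand_eq_cyclotomic hp ((hdvd p hp (dvd_mul_right p a)).mul_right a),
      mul_assoc, mul_comm a p]

theorem X_pow_dvd_expand_sub {R : Type*} [CommRing R] (d : ℕ) (f : R[X]) :
    X ^ (2 * d) ∣ expand R d f - (C (f.coeff 0) + C (f.coeff 1) * X ^ d) := by
  have h : X ^ 2 ∣ f - (C (f.coeff 0) + C (f.coeff 1) * X) := by
    rw [X_pow_dvd_iff]
    intro k hk
    interval_cases k <;> simp [coeff_C]
  simpa only [map_sub, map_add, map_mul, map_pow, expand_X, expand_C, pow_mul'] using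
    map_dvd (expand R d) h

/-- for every `d > 0` and sign `s`, infinitely many `n` of the special
form satisfy `Φₙ(T) ≡ 1 + s·T^d (mod T^{2d})`. -/
theorem infinitely_many_special_cyclotomic (d : ℕ) (hd : 0 < d) (s : ℤ)
    (hs : s = 1 ∨ s = -1) :
    {n : ℕ | 0 < n ∧ SpecialForm n ∧
      (X : Polynomial ℤ) ^ (2 * d) ∣
        Polynomial.cyclotomic n ℤ - (1 + Polynomial.C s * X ^ d)}.Infinite := by
  obtain ⟨n, hn, hdvd, hcoeff⟩ :=
    exists_forall_prime_dvd_and_coeff_one_cyclotomic_eq d hd.ne' (-s) (by lia)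
  have hnd : n * d ≠ 0 := mul_ne_zero (by lia) hd.ne'
  refine Set.infinite_of_forall_exists_gt fun b => ?_
  obtain ⟨p, hp, hbp, hmod⟩ := Nat.exists_prime_gt_modEq_one (n + b) hnd
  have hpn : ¬p ∣ n := Nat.not_dvd_of_pos_of_lt (by lia) (by lia)
  refine ⟨p * (n * d), ⟨Nat.mul_pos hp.pos (Nat.pos_of_ne_zero hnd), ⟨p, n * d, hp,
    (Nat.modEq_iff_dvd' hp.one_lt.le).1 hmod.symm, rfl⟩, ?_⟩,
    lt_of_lt_of_le (by lia) (Nat.le_mul_of_pos_right p (Nat.pos_of_ne_zero hnd))⟩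
  have hnp : 1 < n * p := lt_of_lt_of_le hn (Nat.le_mul_of_pos_right n hp.pos)
  have h := X_pow_dvd_expand_sub d (cyclotomic (n * p) ℤ)
  rwa [expand_cyclotomic_of_forall_prime_dvd hd.ne' fun q hq hqd => (hdvd q hq hqd).mul_right p,
    cyclotomic_coeff_zero ℤ hnp, coeff_one_cyclotomic_mul_prime hp hn hpn, hcoeff, neg_neg, C_1,
    mul_comm n p, mul_assoc] at h
end
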